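/- There is a unique basis B of U_q^-(𝔤) such that: (1) B is contained in 𝓛, the residues B + q𝓛 form a basis of 𝓛/q𝓛, and this set of residues agrees with B_i + q𝓛 for some (equivalently any) reduced expression i of w_0; and (2) every element of B is fixed by the bar involution. Furthermore, for any reduced expression i, the change of basis from B_i to B is unit-triangular with respect to the partial order ≺: the element of B corresponding to F_i^a equals F_i^a plus a ℚ(q)-linear combination of monomials F_i^{a′} with a′ ≺ a. -/

import Mathlib

/-!
Common setup: the quantized universal enveloping algebra `U_q(𝔤)` of a simple
complex Lie algebra of type ADE, presented by the Chevalley generators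
`E i`, `F i`, `K i`, `K i⁻¹` over `ℚ(q)`, together with the combinatorics of
words in the Weyl group, PBW root vectors and monomials, Lusztig's braid group
automorphisms, the bar involution, lattices, and partial orders on Lusztig data.
-/

noncomputable section

open scoped BigOperators

/-- The base field `ℚ(q)`. -/
abbrev 𝕂 : Type := RatFunc ℚ

/-- The indeterminate `q ∈ ℚ(q)`. -/
noncomputable def qq : 𝕂 := RatFunc.X

/-- The Cartan matrix attached to an adjacency function: `2` on the diagonal,
`-1` for adjacent vertices, `0` otherwise. -/
def cartanOf {I : Type} [DecidableEq I] (adj : I → I → Bool) (i j : I) : ℤ :=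
  if i = j then 2 else if adj i j then -1 else 0

/-- The datum of a simply laced (ADE) Dynkin diagram of a simple Lie algebra:
a finite nonempty vertex set with a symmetric irreflexive adjacency relation,
connected (simple `𝔤`), whose Cartan matrix is positive definite (finite type;
together with simply-lacedness this characterizes types A, D, E). -/
structure ADEData (I : Type) [Fintype I] [DecidableEq I] : Type where
  nonE : Nonempty I
  adj : I → I → Bool
  symm : ∀ i j, adj i j = adj j i
  irrefl : ∀ i, adj i i = false
  conn : ∀ i j : I, Relation.ReflTransGen (fun a b => adj a b = true) i j
  posdef : ∀ v : I → ℚ, v ≠ 0 → 0 < ∑ i, ∑ j, (cartanOf adj i j : ℚ) * v i * v j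

variable {I : Type} [Fintype I] [DecidableEq I]

/-- Generators `E i`, `F i`, `K i`, `K i⁻¹` of `U_q(𝔤)`. -/
inductive Gen (I : Type) : Type
  | E : I → Gen I
  | F : I → Gen I
  | K : I → Gen I
  | Kinv : I → Gen I

/-- The free `ℚ(q)`-algebra on the generators. -/
abbrev FA (I : Type) := FreeAlgebra 𝕂 (Gen I)

def gE (i : I) : FA I := FreeAlgebra.ι 𝕂 (Gen.E i)
def gF (i : I) : FA I := FreeAlgebra.ι 𝕂 (Gen.F i)
def gK (i : I) : FA I := FreeAlgebra.ι 𝕂 (Gen.K i)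
def gKinv (i : I) : FA I := FreeAlgebra.ι 𝕂 (Gen.Kinv i)

/-- The defining relations of `U_q(𝔤)` (type ADE). -/
inductive QRel (D : ADEData I) : FA I → FA I → Prop
  | KKinv (i : I) : QRel D (gK i * gKinv i) 1
  | KinvK (i : I) : QRel D (gKinv i * gK i) 1
  | KcommK (i j : I) : QRel D (gK i * gK j) (gK j * gK i)
  | KEself (i : I) : QRel D (gK i * gE i * gKinv i) ((qq ^ 2) • gE i)
  | KFself (i : I) : QRel D (gK i * gF i * gKinv i) ((qq ^ 2)⁻¹ • gF i)
  | EFdiff (i j : I) (h : i ≠ j) : QRel D (gE i * gF j - gF j * gE i) 0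
  | EFself (i : I) :
      QRel D (gE i * gF i - gF i * gE i) ((qq - qq⁻¹)⁻¹ • (gK i - gKinv i))
  | serreE (i j : I) (h : D.adj i j = true) :
      QRel D (gE i ^ 2 * gE j + gE j * gE i ^ 2) ((qq + qq⁻¹) • (gE i * gE j * gE i))
  | serreF (i j : I) (h : D.adj i j = true) :
      QRel D (gF i ^ 2 * gF j + gF j * gF i ^ 2) ((qq + qq⁻¹) • (gF i * gF j * gF i))
  | KEadj (i j : I) (h : D.adj i j = true) :
      QRel D (gK i * gE j * gKinv i) (qq⁻¹ • gE j)
  | KFadj (i j : I) (h : D.adj i j = true) :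
      QRel D (gK i * gF j * gKinv i) (qq • gF j)
  | EEfar (i j : I) (h : i ≠ j) (h' : D.adj i j = false) :
      QRel D (gE i * gE j) (gE j * gE i)
  | FFfar (i j : I) (h : i ≠ j) (h' : D.adj i j = false) :
      QRel D (gF i * gF j) (gF j * gF i)
  | KEfar (i j : I) (h : i ≠ j) (h' : D.adj i j = false) :
      QRel D (gK i * gE j * gKinv i) (gE j)
  | KFfar (i j : I) (h : i ≠ j) (h' : D.adj i j = false) :
      QRel D (gK i * gF j * gKinv i) (gF j)

/-- The quantized universal enveloping algebra `U_q(𝔤)`. -/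
abbrev Uq (D : ADEData I) := RingQuot (QRel D)

/-- The generator `E i` of `U_q(𝔤)`. -/
def EE (D : ADEData I) (i : I) : Uq D := RingQuot.mkAlgHom 𝕂 (QRel D) (gE i)
/-- The generator `F i` of `U_q(𝔤)`. -/
def FF (D : ADEData I) (i : I) : Uq D := RingQuot.mkAlgHom 𝕂 (QRel D) (gF i)
/-- The generator `K i` of `U_q(𝔤)`. -/
def KK (D : ADEData I) (i : I) : Uq D := RingQuot.mkAlgHom 𝕂 (QRel D) (gK i)
/-- The generator `K i ⁻¹` of `U_q(𝔤)`. -/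
def KKinv (D : ADEData I) (i : I) : Uq D := RingQuot.mkAlgHom 𝕂 (QRel D) (gKinv i)

/-- The quantum integer `[n] = q^{n-1} + q^{n-3} + ⋯ + q^{-n+1}`. -/
def qInt (n : ℕ) : 𝕂 := ∑ t ∈ Finset.range n, qq ^ ((n : ℤ) - 1 - 2 * (t : ℤ))

/-- The quantum factorial `[n]! = [n][n-1]⋯[2][1]`. -/
def qFact (n : ℕ) : 𝕂 := ∏ t ∈ Finset.range n, qInt (t + 1)

/-- The `q`-divided power `X^{(n)} = X^n / [n]!`. -/
def dp {D : ADEData I} (x : Uq D) (n : ℕ) : Uq D := (qFact n)⁻¹ • x ^ n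

/-- `U_q^-(𝔤)`: the subalgebra generated by the `F i`. -/
def Uminus (D : ADEData I) : Subalgebra 𝕂 (Uq D) :=
  Algebra.adjoin 𝕂 (Set.range (FF D))

/-- `U_q^{≥0}(𝔤)`: the subalgebra generated by the `E i` and `K i^{±1}`. -/
def Ugeq0 (D : ADEData I) : Subalgebra 𝕂 (Uq D) :=
  Algebra.adjoin 𝕂 (Set.range (EE D) ∪ Set.range (KK D) ∪ Set.range (KKinv D))

/-- A family of algebra automorphisms `T i` is the family of Lusztig braid
automorphisms if it takes the prescribed values on all generators. -/
def IsLusztigAuts (D : ADEData I) (T : I → (Uq D ≃ₐ[𝕂] Uq D)) : Prop :=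
  ∀ i j : I,
    (T i (FF D i) = -(KKinv D i * EE D i)) ∧
    (D.adj i j = true → T i (FF D j) = FF D j * FF D i - qq • (FF D i * FF D j)) ∧
    (i ≠ j → D.adj i j = false → T i (FF D j) = FF D j) ∧
    (T i (EE D i) = -(FF D i * KK D i)) ∧
    (D.adj i j = true → T i (EE D j) = EE D i * EE D j - qq⁻¹ • (EE D j * EE D i)) ∧
    (i ≠ j → D.adj i j = false → T i (EE D j) = EE D j) ∧
    (T i (KK D i) = KKinv D i) ∧
    (D.adj i j = true → T i (KK D j) = KK D i * KK D j) ∧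
    (i ≠ j → D.adj i j = false → T i (KK D j) = KK D j)

/-- The Cartan matrix of the diagram. -/
def cartan (D : ADEData I) : I → I → ℤ := cartanOf D.adj

/-- The simple root `α i`, as a vector in the root lattice `ℤ^I`. -/
def simpleRoot (i : I) : I → ℤ := fun j => if j = i then 1 else 0

/-- The standard pairing `(v, α i)` on the root lattice. -/
def pairing (D : ADEData I) (v : I → ℤ) (i : I) : ℤ := ∑ j, v j * cartan D j i

/-- The simple reflection `s i` acting on the root lattice. -/
def sref (D : ADEData I) (i : I) (v : I → ℤ) : I → ℤ :=
  fun j => v j - pairing D v i * simpleRoot i j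

/-- Action of a word `(i₁, …, i_N)` on the root lattice: `s_{i₁} ∘ ⋯ ∘ s_{i_N}`. -/
def wordAct (D : ADEData I) : List I → (I → ℤ) → (I → ℤ)
  | [] => fun v => v
  | i :: l => fun v => sref D i (wordAct D l v)

/-- A word in the generators of the Weyl group is reduced if no shorter word
defines the same element (i.e., the same action on the root lattice). -/
def IsReducedWord (D : ADEData I) (w : List I) : Prop :=
  ∀ w' : List I, wordAct D w' = wordAct D w → w.length ≤ w'.length

/-- `w` is a reduced expression of the longest element `w₀` of the Weyl group. -/
def IsRedW0 (D : ADEData I) (w : List I) : Prop :=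
  IsReducedWord D w ∧ ∀ w' : List I, IsReducedWord D w' → w'.length ≤ w.length

/-- The root `β_k = s_{i₁} ⋯ s_{i_{k-1}} (α_{i_k})` attached to the `k`-th letter
of the word `w` (here `k` is 0-indexed). -/
def beta (D : ADEData I) (w : List I) (k : Fin w.length) : I → ℤ :=
  wordAct D (w.take k) (simpleRoot (w.get k))

/-- `v` is a root: it lies in the Weyl group orbit of a simple root. -/
def IsRoot (D : ADEData I) (v : I → ℤ) : Prop :=
  ∃ (l : List I) (i : I), v = wordAct D l (simpleRoot i)

/-- `v` is a positive root. -/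
def IsPosRoot (D : ADEData I) (v : I → ℤ) : Prop :=
  IsRoot D v ∧ ∀ j, 0 ≤ v j

/-- Apply `T_{i₁} ∘ T_{i₂} ∘ ⋯ ∘ T_{i_m}` for a word `(i₁, …, i_m)`. -/
def applyT {D : ADEData I} (T : I → (Uq D ≃ₐ[𝕂] Uq D)) : List I → Uq D → Uq D
  | [], x => x
  | i :: l, x => T i (applyT T l x)

/-- Apply `T_{i_m}^{-1} ∘ ⋯ ∘ T_{i₁}^{-1}` for a word `(i₁, …, i_m)`. -/
def applyTinv {D : ADEData I} (T : I → (Uq D ≃ₐ[𝕂] Uq D)) : List I → Uq D → Uq D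
  | [], x => x
  | i :: l, x => applyTinv T l ((T i).symm x)

/-- The PBW root vector `F_{i;β_k} = T_{i₁} ⋯ T_{i_{k-1}} (F_{i_k})`
(`k` is 0-indexed). -/
def rootVec {D : ADEData I} (T : I → (Uq D ≃ₐ[𝕂] Uq D)) (w : List I)
    (k : Fin w.length) : Uq D :=
  applyT T (w.take k) (FF D (w.get k))

/-- The PBW monomial `F^a = F_{β₁}^{(a₁)} F_{β₂}^{(a₂)} ⋯ F_{β_N}^{(a_N)}`
attached to the Lusztig datum `a`. -/
def pbw {D : ADEData I} (T : I → (Uq D ≃ₐ[𝕂] Uq D)) (w : List I)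
    (a : Fin w.length → ℕ) : Uq D :=
  ((List.finRange w.length).map (fun k => dp (rootVec T w k) (a k))).prod

/-- `u` is a homogeneous element of weight `μ` for the root-lattice grading of
`U_q(𝔤)`: conjugation by `K i` multiplies it by `q^{(μ, α_i)}`. -/
def HasWeight (D : ADEData I) (u : Uq D) (μ : I → ℤ) : Prop :=
  ∀ i, KK D i * u * KKinv D i = (qq ^ pairing D μ i) • u

/-- The weight `Σ_k a_k β_k` of a Lusztig datum. -/
def wtData (D : ADEData I) (w : List I) (a : Fin w.length → ℕ) : I → ℤ :=
  ∑ k, (a k : ℤ) • beta D w k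

/-- `a` is less than `b` in the left lexicographic order on Lusztig data:
at the first index where they differ, `a` is **bigger**. -/
def LtLeft {N : ℕ} (a b : Fin N → ℕ) : Prop :=
  ∃ k, b k < a k ∧ ∀ l, l < k → a l = b l

/-- `a` is less than `b` in the right lexicographic order on Lusztig data:
at the last index where they differ, `a` is **bigger**. -/
def LtRight {N : ℕ} (a b : Fin N → ℕ) : Prop :=
  ∃ k, b k < a k ∧ ∀ l, k < l → a l = b l

/-- The partial order `≺` on Lusztig data: same weight, and strictly smaller in
both lexicographic orders. -/
def Prec (D : ADEData I) (w : List I) (a b : Fin w.length → ℕ) : Prop :=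
  wtData D w a = wtData D w b ∧ LtLeft a b ∧ LtRight a b

/-- Two words are related by a single braid move. -/
def BraidMove (D : ADEData I) (w w' : List I) : Prop :=
  (∃ (w₁ w₂ : List I) (a b : I), a ≠ b ∧ D.adj a b = false ∧
      w = w₁ ++ a :: b :: w₂ ∧ w' = w₁ ++ b :: a :: w₂) ∨
  (∃ (w₁ w₂ : List I) (a b : I), D.adj a b = true ∧
      w = w₁ ++ a :: b :: a :: w₂ ∧ w' = w₁ ++ b :: a :: b :: w₂)

instance : Algebra (Polynomial ℤ) 𝕂 :=
  ((Polynomial.aeval qq : Polynomial ℤ →ₐ[ℤ] 𝕂)).toRingHom.toAlgebra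

instance (D : ADEData I) : Module (Polynomial ℤ) (Uq D) :=
  Module.compHom _ (algebraMap (Polynomial ℤ) 𝕂)

/-- The `ℤ[q]`-lattice `𝓛` spanned by the PBW monomials of `B_i`. -/
def latt {D : ADEData I} (T : I → (Uq D ≃ₐ[𝕂] Uq D)) (w : List I) :
    Submodule (Polynomial ℤ) (Uq D) :=
  Submodule.span (Polynomial ℤ) (Set.range (pbw T w))

/-- The sublattice `q𝓛`. -/
def qlatt {D : ADEData I} (T : I → (Uq D ≃ₐ[𝕂] Uq D)) (w : List I) :
    Submodule (Polynomial ℤ) (Uq D) :=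
  Submodule.span (Polynomial ℤ) ((fun x => qq • x) '' ((latt T w : Submodule (Polynomial ℤ) (Uq D)) : Set (Uq D)))

/-- `bar` is the bar involution: the `ℚ`-algebra involution fixing `E i` and
`F i`, sending `K i` to `K i⁻¹` and `q` to `q⁻¹`. -/
def IsBar (D : ADEData I) (bar : Uq D →+* Uq D) : Prop :=
  (∀ i, bar (EE D i) = EE D i) ∧ (∀ i, bar (FF D i) = FF D i) ∧
  (∀ i, bar (KK D i) = KKinv D i) ∧
  bar (algebraMap 𝕂 (Uq D) qq) = algebraMap 𝕂 (Uq D) qq⁻¹ ∧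
  ∀ x, bar (bar x) = x

/-- `c ∈ ℚ(q)` is a Laurent polynomial in `q`. -/
def IsLaurent (c : 𝕂) : Prop :=
  ∃ (f : Polynomial ℚ) (m : ℕ), c = qq⁻¹ ^ m * Polynomial.aeval qq f

/-- `b` is (an indexing of) the canonical basis: it lies in the lattice `𝓛`,
its residues mod `q𝓛` are the residues of the PBW monomials, and it is
bar-invariant. -/
def IsCanBasis {D : ADEData I} (T : I → (Uq D ≃ₐ[𝕂] Uq D)) (w : List I)
    (bar : Uq D →+* Uq D) (b : (Fin w.length → ℕ) → Uq D) : Prop :=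
  (∀ a, b a ∈ latt T w) ∧ (∀ a, b a - pbw T w a ∈ qlatt T w) ∧ (∀ a, bar (b a) = b a)

/-- The braid move from `w` to `w'` does not change the relative position of the
roots `u` and `v` in the enumerations of positive roots attached to `w`, `w'`. -/
def SameRelPos (D : ADEData I) (w w' : List I) (u v : I → ℤ) : Prop :=
  ∀ (k l : Fin w.length) (k' l' : Fin w'.length),
    beta D w k = u → beta D w l = v → beta D w' k' = u → beta D w' l' = v →
    ((k : ℕ) < (l : ℕ) ↔ (k' : ℕ) < (l' : ℕ))

/-- The subring `ℚ[q]₀ ⊆ ℚ(q)` of rational functions regular at `q = 0`. -/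
def Reg0 : Subring 𝕂 where
  carrier := {x | ∃ f g : Polynomial ℚ, Polynomial.eval 0 g ≠ 0 ∧
    x * algebraMap (Polynomial ℚ) 𝕂 g = algebraMap (Polynomial ℚ) 𝕂 f}
  zero_mem' := ⟨0, 1, by simp, by simp⟩
  one_mem' := ⟨1, 1, by simp, by simp⟩
  add_mem' := by
    rintro x y ⟨f1, g1, h1, e1⟩ ⟨f2, g2, h2, e2⟩
    refine ⟨f1 * g2 + f2 * g1, g1 * g2, by simpa using mul_ne_zero h1 h2, ?_⟩
    rw [map_mul, map_add, map_mul, map_mul, ← e1, ← e2]; ring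
  mul_mem' := by
    rintro x y ⟨f1, g1, h1, e1⟩ ⟨f2, g2, h2, e2⟩
    refine ⟨f1 * f2, g1 * g2, by simpa using mul_ne_zero h1 h2, ?_⟩
    rw [map_mul, map_mul, ← e1, ← e2]; ring
  neg_mem' := by
    rintro x ⟨f, g, h, e⟩
    exact ⟨-f, g, h, by rw [map_neg, ← e]; ring⟩

instance (D : ADEData I) : Module ↥Reg0 (Uq D) :=
  Module.compHom _ (Reg0.subtype)

/-- Iterated application of a family of operators along a word. -/
def applyOps {D : ADEData I} (Ft : I → Uq D → Uq D) : List I → Uq D → Uq D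
  | [], x => x
  | i :: l, x => Ft i (applyOps Ft l x)

/-- Kashiwara's lattice `𝓛(∞)`: the `ℚ[q]₀`-span of all elements obtained from
`1` by applying sequences of the Kashiwara operators. -/
def lattInf {D : ADEData I} (Ft : I → Uq D → Uq D) : Submodule ↥Reg0 (Uq D) :=
  Submodule.span ↥Reg0 {x : Uq D | ∃ l : List I, x = applyOps Ft l 1}

/-- The sublattice `q𝓛(∞)`. -/
def qlattInf {D : ADEData I} (Ft : I → Uq D → Uq D) : Submodule ↥Reg0 (Uq D) :=
  Submodule.span ↥Reg0 ((fun x => qq • x) '' ((lattInf Ft : Submodule ↥Reg0 (Uq D)) : Set (Uq D)))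

end
noncomputable section

open scoped BigOperators

namespace CB
section scal
open Polynomial LaurentPolynomial

lemma qq_ne : (qq : 𝕂) ≠ 0 := RatFunc.X_ne_zero

lemma qq_trans : Transcendental ℚ (qq : 𝕂) := by
  rw [transcendental_iff]
  intro p hp
  have h : Polynomial.aeval (qq : 𝕂) p = algebraMap ℚ[X] 𝕂 p := by
    have e : (qq : 𝕂) = algebraMap ℚ[X] 𝕂 X := by simp [qq]
    rw [e, Polynomial.aeval_algebraMap_apply]; simp
  rw [h] at hp
  exact (map_eq_zero_iff _ (RatFunc.algebraMap_injective ℚ)).mp hp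

lemma aeval_inj : Function.Injective (Polynomial.aeval (R := ℚ) (qq : 𝕂)) :=
  transcendental_iff_injective.mp qq_trans

lemma aeval_inv_inj : Function.Injective (Polynomial.aeval (R := ℚ) (qq⁻¹ : 𝕂)) := by
  rw [← transcendental_iff_injective]
  intro h
  exact qq_trans (by simpa using h.inv)

/-- The semilinear twist. -/
def sg : 𝕂 →+* 𝕂 :=
  RatFunc.liftRingHom (Polynomial.aeval (R := ℚ) (qq⁻¹ : 𝕂)).toRingHom (by
    intro p hp
    rw [Submonoid.mem_comap]
    refine mem_nonZeroDivisors_of_ne_zero ?_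
    intro h
    have := aeval_inv_inj (h.trans (map_zero _).symm)
    exact nonZeroDivisors.ne_zero hp this)

lemma sg_algebraMap (p : ℚ[X]) : sg (algebraMap ℚ[X] 𝕂 p) = Polynomial.aeval (qq⁻¹ : 𝕂) p := by
  unfold sg
  rw [RatFunc.liftRingHom_algebraMap]; rfl

@[simp] lemma sg_qq : sg qq = qq⁻¹ := by
  have : (qq : 𝕂) = algebraMap ℚ[X] 𝕂 X := by simp [qq]
  rw [this, sg_algebraMap, this]; simp

@[simp] lemma sg_sg (x : 𝕂) : sg (sg x) = x := by
  have h1 : (sg.comp sg) = RingHom.id 𝕂 := by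
    apply IsFractionRing.injective_comp_algebraMap (A := ℚ[X])
    apply Polynomial.ringHom_ext
    · intro a
      simp
    · have : (algebraMap ℚ[X] 𝕂 X) = qq := by simp [qq]
      simp [this]
  exact congrArg (fun f => f x) h1

/-- Evaluation of Laurent polynomials. -/
def ev : ℤ[T;T⁻¹] →+* 𝕂 := LaurentPolynomial.eval₂ (Int.castRingHom 𝕂) (Units.mk0 qq qq_ne)

@[simp] lemma ev_T (n : ℤ) : ev (T n) = qq ^ n := by
  simp [ev, LaurentPolynomial.eval₂_T]

lemma ev_toLaurent (p : ℤ[X]) : ev (toLaurent p) = algebraMap ℤ[X] 𝕂 p := by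
  rw [ev, LaurentPolynomial.eval₂_toLaurent]
  change _ = Polynomial.aeval qq p
  rw [Polynomial.aeval_def]
  congr 1
  exact RingHom.ext_int _ _

lemma coeff_CT (a : ℤ) (m n : ℤ) : (LaurentPolynomial.C a * T m).coeff n = if m = n then a else 0 := by
  rw [← single_eq_C_mul_T, AddMonoidAlgebra.coeff_single, Finsupp.single_apply]

lemma algMap_inj : Function.Injective (algebraMap ℤ[X] 𝕂) := by
  intro p r h
  have h1 : ∀ p : ℤ[X], algebraMap ℤ[X] 𝕂 p = Polynomial.aeval (qq : 𝕂) (p.map (Int.castRingHom ℚ)) := by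
    intro p
    change Polynomial.aeval qq p = _
    rw [Polynomial.aeval_def, Polynomial.aeval_def, Polynomial.eval₂_map]
    congr 1
    exact RingHom.ext_int _ _
  rw [h1, h1] at h
  exact Polynomial.map_injective _ Int.cast_injective (aeval_inj h)

lemma algMap_X : algebraMap ℤ[X] 𝕂 X = qq := by
  change Polynomial.aeval qq X = _
  simp

lemma ev_inj : Function.Injective ev := by
  rw [injective_iff_map_eq_zero]
  intro g hg
  obtain ⟨n, p, hp⟩ := exists_T_pow g
  have : ev (toLaurent p) = 0 := by rw [hp, map_mul, hg, zero_mul]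
  rw [ev_toLaurent] at this
  have hp0 : p = 0 := algMap_inj (this.trans (map_zero _).symm)
  rw [hp0, map_zero] at hp
  have h2 : g * T n * T (-n) = 0 := by rw [← hp, zero_mul]
  rw [mul_T_assoc] at h2
  simpa using h2

lemma sg_ev (g : ℤ[T;T⁻¹]) : sg (ev g) = ev (invert g) := by
  induction g using LaurentPolynomial.induction_on' with
  | add p q hp hq => simp [hp, hq]
  | C_mul_T n a =>
    have : ev (C a) = (a : 𝕂) := by simp [ev]
    simp [map_zpow₀, this]

/-- The ring of integral Laurent polynomials inside `𝕂`. -/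
def A : Subring 𝕂 := ev.range

lemma zpow_mem_A (n : ℤ) : (qq : 𝕂) ^ n ∈ A := ⟨T n, ev_T n⟩
lemma qq_mem_A : (qq : 𝕂) ∈ A := by simpa using zpow_mem_A 1
lemma qqinv_mem_A : (qq⁻¹ : 𝕂) ∈ A := by simpa using zpow_mem_A (-1)

lemma sg_mem_A {c : 𝕂} (h : c ∈ A) : sg c ∈ A := by
  obtain ⟨g, rfl⟩ := h
  exact ⟨_, (sg_ev g).symm⟩

lemma poly_mem_A (p : ℤ[X]) : algebraMap ℤ[X] 𝕂 p ∈ A := ⟨toLaurent p, ev_toLaurent p⟩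

lemma coeff_toLaurent_nonpos (p : ℤ[X]) (n : ℤ) (hn : n ≤ 0) :
    (toLaurent (X * p)).coeff n = 0 := by
  rw [map_mul, toLaurent_X]
  induction p using Polynomial.induction_on' with
  | add p q hp hq =>
    rw [map_add, mul_add, AddMonoidAlgebra.coeff_add, Finsupp.add_apply, hp, hq, add_zero]
  | monomial k a =>
    rw [← C_mul_X_pow_eq_monomial, map_mul, toLaurent_C, toLaurent_X_pow]
    rw [mul_left_comm, ← T_add, coeff_CT, if_neg]
    omega

lemma anti_split {c : 𝕂} (hc : c ∈ A) (h : sg c = -c) :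
    ∃ p : ℤ[X], c = algebraMap ℤ[X] 𝕂 (X * p) - sg (algebraMap ℤ[X] 𝕂 (X * p)) := by
  obtain ⟨g, rfl⟩ := hc
  rw [sg_ev, ← map_neg] at h
  have h := ev_inj h
  have hcoef : ∀ n, g.coeff (-n) = - g.coeff n := fun n => by
    rw [← invert_apply, h]; simp
  have h0 : g.coeff 0 = 0 := by have := hcoef 0; simp at this; omega
  -- positive part
  set p : ℤ[X] := Polynomial.divX (trunc g) with hp
  have key : ∀ n : ℤ, (toLaurent (X * p)).coeff n = if 0 < n then g.coeff n else 0 := by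
    intro n
    split_ifs with hn
    · have htr : (trunc g).coeff n.toNat = g.coeff n := by
        have : ∀ g : ℤ[T;T⁻¹], (trunc g).coeff n.toNat = g.coeff n := by
          intro g
          induction g using LaurentPolynomial.induction_on' with
          | add p q hp hq => simp [hp, hq]
          | C_mul_T m a =>
            rw [trunc_C_mul_T, coeff_CT]
            split_ifs with hm h2 h2
            · rw [Polynomial.coeff_monomial, if_pos (by omega)]
            · rw [Polynomial.coeff_monomial, if_neg (by omega)]
            · omega
            · simp
        exact this g
      obtain ⟨k, rfl⟩ : ∃ k : ℕ, n = (k + 1 : ℕ) := ⟨n.toNat - 1, by omega⟩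
      have h3 : ∀ r : ℤ[X], (toLaurent r).coeff ((k + 1 : ℕ) : ℤ) = r.coeff (k + 1) := by
        intro r
        induction r using Polynomial.induction_on' with
        | add p q hp hq => simp only [map_add, Polynomial.coeff_add]; rw [← hp, ← hq]; rfl
        | monomial m a =>
          rw [← C_mul_X_pow_eq_monomial, map_mul, toLaurent_C, toLaurent_X_pow,
            coeff_CT, Polynomial.coeff_C_mul_X_pow]
          congr 1
          apply propext; omega
      rw [h3, ← htr]
      have : (((k+1 : ℕ) : ℤ)).toNat = k + 1 := by omega
      rw [this, Polynomial.coeff_X_mul, hp, Polynomial.coeff_divX]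
    · exact coeff_toLaurent_nonpos p n (by omega)
  refine ⟨p, ?_⟩
  rw [← ev_toLaurent, sg_ev, ← map_sub]
  congr 1
  ext n
  have : (toLaurent (X * p) - invert (toLaurent (X * p))).coeff n =
    (toLaurent (X * p)).coeff n - (toLaurent (X * p)).coeff (-n) := by
    rw [← invert_apply]; simp
  rw [this, key, key]
  have := hcoef n
  split_ifs with h1 h2 h2
  · omega
  · simp
  · omega
  · have : n = 0 := by omega
    subst this; simp [h0]

lemma inv_zero (p : ℤ[X]) (h : sg (algebraMap ℤ[X] 𝕂 (X * p)) = algebraMap ℤ[X] 𝕂 (X * p)) :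
    algebraMap ℤ[X] 𝕂 (X * p) = 0 := by
  rw [← ev_toLaurent, sg_ev] at h
  have h := ev_inj h
  rw [← ev_toLaurent]
  have : toLaurent (X * p) = 0 := by
    ext n
    rcases le_total n 0 with hn | hn
    · simpa using coeff_toLaurent_nonpos p n hn
    · rw [← h, invert_apply]
      simpa using coeff_toLaurent_nonpos p (-n) (by omega)
  rw [this, map_zero]

lemma qq_zpow_inj {m n : ℤ} (h : (qq : 𝕂) ^ m = qq ^ n) : m = n := by
  rw [← ev_T, ← ev_T] at h
  have := ev_inj h
  have h2 := congrArg (fun f => f.coeff m) this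
  simp at h2
  exact h2.symm

lemma qd_ne : (qq - qq⁻¹ : 𝕂) ≠ 0 := by
  intro h
  have : (qq : 𝕂) ^ (1 : ℤ) = qq ^ (-1 : ℤ) := by simpa using sub_eq_zero.mp h
  have := qq_zpow_inj this
  omega

lemma qInt_mul (n : ℕ) : (qq - qq⁻¹) * qInt n = qq ^ (n : ℤ) - qq ^ (-(n : ℤ)) := by
  have := qq_ne
  unfold qInt
  rw [Finset.mul_sum]
  have h : ∀ t ∈ Finset.range n, (qq - qq⁻¹) * qq ^ ((n : ℤ) - 1 - 2 * (t : ℤ)) =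
      qq ^ ((n : ℤ) - 2 * (t : ℕ)) - qq ^ ((n : ℤ) - 2 * ((t + 1 : ℕ) : ℤ)) := by
    intro t _
    rw [sub_mul]
    congr 1
    · nth_rewrite 1 [← zpow_one qq]
      rw [← zpow_add₀ this]; congr 1; ring
    · rw [← zpow_neg_one qq, ← zpow_add₀ this]; congr 1; push_cast; ring
  rw [Finset.sum_congr rfl h, Finset.sum_range_sub' (fun t : ℕ => (qq : 𝕂) ^ ((n : ℤ) - 2 * (t : ℕ)))]
  have e : (n : ℤ) - 2 * (n : ℕ) = -n := by ring
  simp [e]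

lemma qInt_eq (n : ℕ) : qInt n = (qq ^ (n : ℤ) - qq ^ (-(n : ℤ))) / (qq - qq⁻¹) := by
  rw [eq_div_iff qd_ne, mul_comm, qInt_mul]

lemma qInt_ne {n : ℕ} (hn : n ≠ 0) : qInt n ≠ 0 := by
  rw [qInt_eq]
  refine div_ne_zero ?_ qd_ne
  intro h
  have := qq_zpow_inj (sub_eq_zero.mp h)
  omega

lemma qFact_ne (n : ℕ) : qFact n ≠ 0 :=
  Finset.prod_ne_zero_iff.mpr fun t _ => qInt_ne (Nat.succ_ne_zero t)

lemma qFact_succ (n : ℕ) : qFact (n + 1) = qFact n * qInt (n + 1) := Finset.prod_range_succ _ _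
@[simp] lemma qFact_zero : qFact 0 = 1 := rfl
@[simp] lemma qInt_zero : qInt 0 = 0 := rfl
@[simp] lemma qInt_one : qInt 1 = 1 := by simp [qInt]
lemma qInt_two : qInt 2 = qq + qq⁻¹ := by
  simp [qInt, Finset.sum_range_succ]
@[simp] lemma qFact_one : qFact 1 = 1 := by simp [qFact_succ]

lemma sg_zpow (n : ℤ) : sg (qq ^ n) = qq ^ (-n) := by rw [map_zpow₀]; simp

lemma sg_qInt (n : ℕ) : sg (qInt n) = qInt n := by
  rw [qInt_eq, map_div₀, map_sub, map_sub, sg_zpow, sg_zpow]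
  simp only [map_inv₀, sg_qq, inv_inv, neg_neg]
  rw [← neg_sub, ← neg_sub qq, neg_div_neg_eq]

lemma sg_qFact (n : ℕ) : sg (qFact n) = qFact n := by
  simp [qFact, map_prod, sg_qInt]

lemma qInt_mem_A (n : ℕ) : qInt n ∈ A := sum_mem fun _ _ => zpow_mem_A _

lemma qInt_add (m n : ℕ) : qInt (m + n) = qq ^ (n : ℤ) * qInt m + qq ^ (-(m : ℤ)) * qInt n := by
  have := qd_ne
  have h0 := qq_ne
  apply mul_left_cancel₀ this
  rw [qInt_mul, mul_add, mul_left_comm, qInt_mul, mul_left_comm, qInt_mul, mul_sub, mul_sub]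
  simp only [← zpow_add₀ h0]
  push_cast
  have e1 : (n : ℤ) + -(m:ℤ) = -m + n := by ring
  have e2 : (n : ℤ) + m = m + n := by ring
  have e3 : -(m : ℤ) + -n = -(m + n) := by ring
  rw [e1, e2, e3]; ring

/-- Gaussian binomial. -/
def qbin (m n : ℕ) : 𝕂 := qFact (m + n) / (qFact m * qFact n)

lemma qbin_mem_A (m n : ℕ) : qbin m n ∈ A := by
  induction m generalizing n with
  | zero => simp [qbin, qFact_ne, one_mem]
  | succ m ihm =>
    induction n with
    | zero => simp [qbin, qFact_ne, one_mem]
    | succ n ihn =>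
      have : qbin (m + 1) (n + 1) = qq ^ ((n + 1 : ℕ) : ℤ) * qbin m (n + 1)
          + qq ^ (-((m + 1 : ℕ) : ℤ)) * qbin (m + 1) n := by
        unfold qbin
        have e : m + 1 + (n + 1) = (m + n + 1) + 1 := by ring
        have e1 : m + (n + 1) = m + n + 1 := by ring
        have e2 : m + 1 + n = m + n + 1 := by ring
        have e3 : qInt (m + n + 1 + 1) = _ := (congrArg qInt e).symm.trans (qInt_add (m + 1) (n + 1))
        rw [e, e1, e2, qFact_succ (m + n + 1), e3, qFact_succ m, qFact_succ n]
        have := qFact_ne m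
        have := qFact_ne n
        have := qInt_ne (Nat.succ_ne_zero m)
        have := qInt_ne (Nat.succ_ne_zero n)
        have := qFact_ne (m + n + 1)
        field_simp
      rw [this]
      exact add_mem (mul_mem (zpow_mem_A _) (ihm _)) (mul_mem (zpow_mem_A _) ihn)

end scal
end CB
end

noncomputable section
open scoped BigOperators
set_option linter.all false
namespace CB
section words
variable {I : Type} [Fintype I] [DecidableEq I] (D : ADEData I)

lemma cartan_self (i : I) : cartan D i i = 2 := by simp [cartan, cartanOf]
lemma adj_ne {i j : I} (h : D.adj i j = true) : i ≠ j := by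
  rintro rfl; rw [D.irrefl] at h; cases h
lemma cartan_adj {i j : I} (h : D.adj i j = true) : cartan D i j = -1 := by
  simp [cartan, cartanOf, adj_ne D h, h]
lemma cartan_far {i j : I} (hn : i ≠ j) (h : D.adj i j = false) : cartan D i j = 0 := by
  simp [cartan, cartanOf, hn, h]
lemma cartan_symm (i j : I) : cartan D i j = cartan D j i := by
  simp only [cartan, cartanOf, D.symm i j, eq_comm (a := i)]
lemma cartan_nonpos {i j : I} (h : i ≠ j) : cartan D i j ≤ 0 := by
  simp only [cartan, cartanOf, h, if_false]; split_ifs <;> simp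

lemma pairing_add (u v : I → ℤ) (i : I) : pairing D (u + v) i = pairing D u i + pairing D v i := by
  simp [pairing, add_mul, Finset.sum_add_distrib]
lemma pairing_smul (c : ℤ) (v : I → ℤ) (i : I) : pairing D (c • v) i = c * pairing D v i := by
  simp [pairing, Finset.mul_sum, mul_assoc]
lemma pairing_neg (v : I → ℤ) (i : I) : pairing D (-v) i = - pairing D v i := by
  simp [pairing]
lemma pairing_sub (u v : I → ℤ) (i : I) : pairing D (u - v) i = pairing D u i - pairing D v i := by
  rw [sub_eq_add_neg, pairing_add, pairing_neg]; ring
lemma pairing_simple (i j : I) : pairing D (simpleRoot j) i = cartan D j i := by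
  simp [pairing, simpleRoot]

lemma sref_eq (i : I) (v : I → ℤ) : sref D i v = v - pairing D v i • simpleRoot i := by
  ext j; simp [sref]

/-- The bilinear form. -/
def bil (u v : I → ℤ) : ℤ := ∑ i, v i * pairing D u i

lemma bil_add_right (u v w : I → ℤ) : bil D u (v + w) = bil D u v + bil D u w := by
  simp [bil, add_mul, Finset.sum_add_distrib]
lemma bil_smul_right (c : ℤ) (u v : I → ℤ) : bil D u (c • v) = c * bil D u v := by
  simp [bil, Finset.mul_sum, mul_assoc]
lemma bil_symm (u v : I → ℤ) : bil D u v = bil D v u := by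
  simp only [bil, pairing, Finset.mul_sum]
  rw [Finset.sum_comm]
  refine Finset.sum_congr rfl fun i _ => Finset.sum_congr rfl fun j _ => ?_
  rw [cartan_symm D i j]; ring
lemma bil_simple (u : I → ℤ) (i : I) : bil D u (simpleRoot i) = pairing D u i := by
  simp [bil, simpleRoot]
lemma bil_sub_right (u v w : I → ℤ) : bil D u (v - w) = bil D u v - bil D u w := by
  simp [bil, sub_mul]
lemma bil_sub_left (u v w : I → ℤ) : bil D (v - w) u = bil D v u - bil D w u := by
  rw [bil_symm, bil_sub_right, bil_symm D u v, bil_symm D u w]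
lemma bil_smul_left (c : ℤ) (u v : I → ℤ) : bil D (c • u) v = c * bil D u v := by
  rw [bil_symm, bil_smul_right, bil_symm]
lemma bil_add_left (u v w : I → ℤ) : bil D (v + w) u = bil D v u + bil D w u := by
  rw [bil_symm, bil_add_right, bil_symm D u v, bil_symm D u w]
lemma bil_simple_left (u : I → ℤ) (i : I) : bil D (simpleRoot i) u = pairing D u i := by
  rw [bil_symm, bil_simple]

lemma bil_sref (i : I) (u v : I → ℤ) : bil D (sref D i u) (sref D i v) = bil D u v := by
  rw [sref_eq, sref_eq, bil_sub_left, bil_sub_right, bil_sub_right, bil_smul_left, bil_smul_right,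
    bil_smul_left, bil_smul_right, bil_simple, bil_simple_left, bil_simple, pairing_simple, cartan_self]
  ring

lemma bil_pos (v : I → ℤ) (hv : v ≠ 0) : 0 < bil D v v := by
  have := D.posdef (fun i => (v i : ℚ)) (by
    intro h; apply hv; ext i; have := congrFun h i; simpa using this)
  have e : ((bil D v v : ℤ) : ℚ) = ∑ i, ∑ j, (cartanOf D.adj i j : ℚ) * v i * v j := by
    simp only [bil, pairing, Finset.mul_sum]
    push_cast
    refine Finset.sum_congr rfl fun i _ => Finset.sum_congr rfl fun j _ => ?_
    rw [cartan_symm D j i]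
    simp only [cartan]; ring
  rw [← e] at this
  exact_mod_cast this

lemma bil_even (v : I → ℤ) : Even (bil D v v) := by
  have key : ∀ s : Finset I, Even (bil D (∑ i ∈ s, v i • simpleRoot i) (∑ i ∈ s, v i • simpleRoot i)) := by
    intro s
    induction s using Finset.induction_on with
    | empty => simp [bil]
    | insert a s ha ih =>
      rw [Finset.sum_insert ha, bil_add_left, bil_add_right, bil_add_right, bil_smul_left, bil_smul_right,
        bil_simple, pairing_simple, cartan_self, bil_symm D _ (v a • simpleRoot a)]
      obtain ⟨k, hk⟩ := ih
      rw [hk]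
      exact ⟨v a * v a + bil D (v a • simpleRoot a) (∑ i ∈ s, v i • simpleRoot i) + k, by ring⟩
  have e : ∑ i, v i • simpleRoot i = v := by
    ext j; simp [simpleRoot]
  have k := key Finset.univ
  rw [e] at k; exact k

/-- Nonnegative vector. -/
def Pos (v : I → ℤ) : Prop := ∀ j, 0 ≤ v j

lemma Pos.add {u v : I → ℤ} (hu : Pos u) (hv : Pos v) : Pos (u + v) := fun j => add_nonneg (hu j) (hv j)
lemma pos_simple (i : I) : Pos (simpleRoot i) := fun j => by simp [simpleRoot]; split_ifs <;> simp

lemma dich (v : I → ℤ) (h : bil D v v = 2) : Pos v ∨ Pos (-v) := by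
  by_contra hcon
  push Not at hcon
  set p : I → ℤ := fun i => max (v i) 0 with hp
  set n : I → ℤ := fun i => max (- v i) 0 with hn
  have hv : v = p - n := by
    ext i; simp only [hp, hn, Pi.sub_apply]; omega
  have hp0 : p ≠ 0 := by
    intro h0; apply hcon.2; intro j
    have := congrFun h0 j; simp only [hp, Pi.zero_apply] at this; simp; omega
  have hn0 : n ≠ 0 := by
    intro h0; apply hcon.1; intro j
    have := congrFun h0 j; simp only [hn, Pi.zero_apply] at this; omega
  have hpn : bil D p n ≤ 0 := by
    simp only [bil, pairing, Finset.mul_sum]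
    refine Finset.sum_nonpos fun i _ => Finset.sum_nonpos fun j _ => ?_
    by_cases hij : j = i
    · subst hij
      rcases le_total (v j) 0 with h | h
      · have : p j = 0 := by simp [hp, h]
        simp [this]
      · have : n j = 0 := by simp [hn, h]
        simp [this]
    · have h1 : 0 ≤ n i := le_max_right _ _
      have h2 : 0 ≤ p j := le_max_right _ _
      have h3 := cartan_nonpos D hij
      exact mul_nonpos_of_nonneg_of_nonpos h1 (mul_nonpos_of_nonneg_of_nonpos h2 h3)
  rw [hv, bil_sub_left, bil_sub_right, bil_sub_right, bil_symm D n p] at h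
  have a1 := bil_pos D p hp0
  have a2 := bil_pos D n hn0
  obtain ⟨k1, b1⟩ := bil_even D p
  obtain ⟨k2, b2⟩ := bil_even D n
  omega

lemma rt_ne {v : I → ℤ} (h : bil D v v = 2) : v ≠ 0 := by
  rintro rfl; simp [bil] at h

lemma not_pos_both {v : I → ℤ} (h : bil D v v = 2) (h1 : Pos v) (h2 : Pos (-v)) : False := by
  apply rt_ne D h
  ext j; have := h1 j; have := h2 j; simp at *; omega

lemma simple_rt (i : I) : bil D (simpleRoot i) (simpleRoot i) = 2 := by
  rw [bil_simple, pairing_simple, cartan_self]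

lemma pos_sref {v : I → ℤ} (h : bil D v v = 2) (hp : Pos v) (i : I) (hs : ¬ Pos (sref D i v)) :
    v = simpleRoot i := by
  have h2 : bil D (sref D i v) (sref D i v) = 2 := by rw [bil_sref, h]
  have hn := (dich D _ h2).resolve_left hs
  have hz : ∀ j, j ≠ i → v j = 0 := by
    intro j hj
    have a := hn j
    have b := hp j
    simp [sref, simpleRoot, hj] at a
    omega
  have hv : v = v i • simpleRoot i := by
    ext j
    by_cases hj : j = i
    · subst hj; simp [simpleRoot]
    · simp [simpleRoot, hj, hz j hj]
  rw [hv, bil_smul_left, bil_smul_right, simple_rt] at h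
  have hi := hp i
  have : v i = 1 := by nlinarith
  rw [hv, this, one_smul]

lemma sref_sref (i : I) (v : I → ℤ) : sref D i (sref D i v) = v := by
  rw [sref_eq D i (sref D i v), sref_eq, pairing_sub, pairing_smul, pairing_simple, cartan_self]
  ext j; simp; ring

lemma sref_add (i : I) (u v : I → ℤ) : sref D i (u + v) = sref D i u + sref D i v := by
  simp only [sref_eq, pairing_add, add_smul]; abel
lemma sref_smul (i : I) (c : ℤ) (v : I → ℤ) : sref D i (c • v) = c • sref D i v := by
  simp only [sref_eq, pairing_smul, smul_sub, mul_smul]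
lemma sref_neg (i : I) (v : I → ℤ) : sref D i (-v) = - sref D i v := by
  simp only [sref_eq, pairing_neg, neg_smul]; abel

lemma sref_simple_self (i : I) : sref D i (simpleRoot i) = - simpleRoot i := by
  rw [sref_eq, pairing_simple, cartan_self]; ext j; simp; ring
lemma sref_simple_adj {i j : I} (h : D.adj i j = true) :
    sref D i (simpleRoot j) = simpleRoot i + simpleRoot j := by
  rw [sref_eq, pairing_simple, cartan_symm, cartan_adj D h]; ext j; simp; ring
lemma sref_simple_far {i j : I} (hn : i ≠ j) (h : D.adj i j = false) :
    sref D i (simpleRoot j) = simpleRoot j := by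
  rw [sref_eq, pairing_simple, cartan_symm, cartan_far D hn h]; simp

lemma wordAct_append (l m : List I) (v : I → ℤ) :
    wordAct D (l ++ m) v = wordAct D l (wordAct D m v) := by
  induction l with
  | nil => rfl
  | cons i l ih => simp [wordAct, ih]
lemma wordAct_add (l : List I) (u v : I → ℤ) : wordAct D l (u + v) = wordAct D l u + wordAct D l v := by
  induction l with
  | nil => rfl
  | cons i l ih => simp [wordAct, ih, sref_add]
lemma wordAct_neg (l : List I) (v : I → ℤ) : wordAct D l (-v) = - wordAct D l v := by
  induction l with
  | nil => rfl
  | cons i l ih => simp [wordAct, ih, sref_neg]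
lemma wordAct_smul (l : List I) (c : ℤ) (v : I → ℤ) : wordAct D l (c • v) = c • wordAct D l v := by
  induction l with
  | nil => rfl
  | cons i l ih =>
    change sref D i (wordAct D l (c • v)) = c • sref D i (wordAct D l v)
    rw [ih, sref_smul]
lemma bil_wordAct (l : List I) (u v : I → ℤ) : bil D (wordAct D l u) (wordAct D l v) = bil D u v := by
  induction l with
  | nil => rfl
  | cons i l ih => simp [wordAct, ih, bil_sref]
lemma wordAct_rt (l : List I) (j : I) :
    bil D (wordAct D l (simpleRoot j)) (wordAct D l (simpleRoot j)) = 2 := by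
  rw [bil_wordAct, simple_rt]

lemma wordAct_conj {t : List I} {i j : I} (h : wordAct D t (simpleRoot j) = simpleRoot i) (v : I → ℤ) :
    wordAct D t (sref D j v) = sref D i (wordAct D t v) := by
  rw [sref_eq, sub_eq_add_neg, wordAct_add, wordAct_neg, wordAct_smul, h, sref_eq, ← sub_eq_add_neg]
  congr 2
  rw [← bil_simple, ← bil_simple, ← h, bil_wordAct]

lemma exch (l : List I) (j : I) (h : ¬ Pos (wordAct D l (simpleRoot j))) :
    ∃ l' : List I, l'.length + 1 = l.length ∧ wordAct D l' = wordAct D (l ++ [j]) := by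
  induction l with
  | nil => exact absurd (pos_simple j) h
  | cons i t ih =>
    by_cases ht : Pos (wordAct D t (simpleRoot j))
    · have e := pos_sref D (wordAct_rt D t j) ht i h
      refine ⟨t, rfl, ?_⟩
      ext1 v
      change wordAct D t v = sref D i (wordAct D (t ++ [j]) v)
      rw [wordAct_append]
      change _ = sref D i (wordAct D t (sref D j v))
      rw [wordAct_conj D e, sref_sref]
    · obtain ⟨t', h1, h2⟩ := ih ht
      refine ⟨i :: t', by simp [h1], ?_⟩
      ext1 v
      simp [wordAct, h2]

lemma red_left {x y : List I} (h : IsReducedWord D (x ++ y)) : IsReducedWord D x := by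
  intro x' hx
  have := h (x' ++ y) (by ext1 v; simp [wordAct_append, hx])
  simpa using this
lemma red_right {x y : List I} (h : IsReducedWord D (x ++ y)) : IsReducedWord D y := by
  intro y' hy
  have := h (x ++ y') (by ext1 v; simp [wordAct_append, hy])
  simpa using this

lemma red_snoc_pos {x : List I} {k : I} (h : IsReducedWord D (x ++ [k])) :
    Pos (wordAct D x (simpleRoot k)) := by
  by_contra hc
  obtain ⟨l', h1, h2⟩ := exch D x k hc
  have := h l' h2
  simp at this; omega

lemma red_snoc {x : List I} {k : I} (h : IsReducedWord D x) (hp : Pos (wordAct D x (simpleRoot k))) :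
    IsReducedWord D (x ++ [k]) := by
  intro u hu
  have hneg : ¬ Pos (wordAct D u (simpleRoot k)) := by
    intro hc
    rw [hu, wordAct_append] at hc
    change Pos (wordAct D x (sref D k (simpleRoot k))) at hc
    rw [sref_simple_self, wordAct_neg] at hc
    exact not_pos_both D (wordAct_rt D x k) hp hc
  obtain ⟨u', h1, h2⟩ := exch D u k hneg
  have := h u' (by
    rw [h2]; ext1 v
    rw [wordAct_append, hu, wordAct_append]
    change wordAct D x (sref D k (sref D k v)) = _
    rw [sref_sref])
  simp; omega

lemma wordAct_reverse (w : List I) (v : I → ℤ) : wordAct D w.reverse (wordAct D w v) = v := by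
  induction w generalizing v with
  | nil => rfl
  | cons i w ih =>
    rw [List.reverse_cons, wordAct_append]
    change wordAct D w.reverse (sref D i (sref D i (wordAct D w v))) = v
    rw [sref_sref, ih]
lemma wordAct_reverse' (w : List I) (v : I → ℤ) : wordAct D w (wordAct D w.reverse v) = v := by
  have := wordAct_reverse D w.reverse v
  simpa using this

lemma red_reverse {w : List I} (h : IsReducedWord D w) : IsReducedWord D w.reverse := by
  intro u hu
  have := h u.reverse (by
    ext1 v
    have h1 := wordAct_reverse D u (wordAct D w v)
    rw [hu, wordAct_reverse] at h1
    exact h1)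
  simpa using this

/-- Braid equivalence. -/
def Br : List I → List I → Prop := Relation.ReflTransGen (BraidMove D)

lemma bm_act {w w' : List I} (h : BraidMove D w w') : wordAct D w = wordAct D w' := by
  rcases h with ⟨w₁, w₂, a, b, hn, hab, rfl, rfl⟩ | ⟨w₁, w₂, a, b, hab, rfl, rfl⟩
  · ext1 v
    rw [wordAct_append, wordAct_append]
    congr 1
    have := wordAct_conj D (t := [a]) (i := b) (j := b) (sref_simple_far D hn hab)
    exact this (wordAct D w₂ v)
  · ext1 v
    rw [wordAct_append, wordAct_append]
    congr 1
    have hba : D.adj b a = true := by rw [D.symm]; exact hab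
    have e : wordAct D [a, b] (simpleRoot a) = simpleRoot b := by
      change sref D a (sref D b (simpleRoot a)) = _
      rw [sref_simple_adj D hba, sref_add, sref_simple_self, sref_simple_adj D hab]
      abel
    exact wordAct_conj D e (wordAct D w₂ v)

lemma bm_len {w w' : List I} (h : BraidMove D w w') : w.length = w'.length := by
  rcases h with ⟨w₁, w₂, a, b, hn, hab, rfl, rfl⟩ | ⟨w₁, w₂, a, b, hab, rfl, rfl⟩ <;> simp

lemma br_act {w w' : List I} (h : Br D w w') : wordAct D w = wordAct D w' := by
  induction h with
  | refl => rfl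
  | tail _ h ih => rw [ih, bm_act D h]
lemma br_len {w w' : List I} (h : Br D w w') : w.length = w'.length := by
  induction h with
  | refl => rfl
  | tail _ h ih => rw [ih, bm_len D h]
lemma br_red {w w' : List I} (h : Br D w w') (hw : IsReducedWord D w) : IsReducedWord D w' := by
  intro u hu
  rw [← br_len D h]
  exact hw u (by rw [hu, br_act D h])

lemma bm_append_right {w w' : List I} (h : BraidMove D w w') (z : List I) :
    BraidMove D (w ++ z) (w' ++ z) := by
  rcases h with ⟨w₁, w₂, a, b, hn, hab, rfl, rfl⟩ | ⟨w₁, w₂, a, b, hab, rfl, rfl⟩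
  · exact Or.inl ⟨w₁, w₂ ++ z, a, b, hn, hab, by simp, by simp⟩
  · exact Or.inr ⟨w₁, w₂ ++ z, a, b, hab, by simp, by simp⟩
lemma br_append_right {w w' : List I} (h : Br D w w') (z : List I) : Br D (w ++ z) (w' ++ z) := by
  induction h with
  | refl => exact .refl
  | tail _ h ih => exact ih.tail (bm_append_right D h z)
lemma bm_reverse {w w' : List I} (h : BraidMove D w w') : BraidMove D w.reverse w'.reverse := by
  rcases h with ⟨w₁, w₂, a, b, hn, hab, rfl, rfl⟩ | ⟨w₁, w₂, a, b, hab, rfl, rfl⟩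
  · exact Or.inl ⟨w₂.reverse, w₁.reverse, b, a, hn.symm, by rw [D.symm]; exact hab, by simp, by simp⟩
  · exact Or.inr ⟨w₂.reverse, w₁.reverse, a, b, hab, by simp, by simp⟩
lemma br_reverse {w w' : List I} (h : Br D w w') : Br D w.reverse w'.reverse := by
  induction h with
  | refl => exact .refl
  | tail _ h ih => exact ih.tail (bm_reverse D h)

lemma neg_of_not_pos {l : List I} {j : I} (h : ¬ Pos (wordAct D l (simpleRoot j))) :
    Pos (wordAct D l (-simpleRoot j)) := by
  rw [wordAct_neg]; exact (dich D _ (wordAct_rt D l j)).resolve_left h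
lemma not_pos_of_neg {l : List I} {j : I} (h : Pos (wordAct D l (-simpleRoot j))) :
    ¬ Pos (wordAct D l (simpleRoot j)) := by
  rw [wordAct_neg] at h; exact fun h' => not_pos_both D (wordAct_rt D l j) h' h

lemma descent (n : ℕ) : ∀ (w : List I) (i : I), w.length = n → IsReducedWord D w →
    Pos (wordAct D w (-simpleRoot i)) → ∃ l, Br D w (l ++ [i]) := by
  induction n using Nat.strong_induction_on with
  | _ n IH =>
  intro w i hlen hred hneg
  rcases List.eq_nil_or_concat w with rfl | ⟨x, j, rfl⟩
  · exact absurd (pos_simple i) (not_pos_of_neg D hneg)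
  · rw [List.concat_eq_append] at *
    have hxred := red_left D hred
    have hl : x.length + 1 = n := by simpa using hlen
    by_cases hij : j = i
    · subst hij; exact ⟨x, Relation.ReflTransGen.refl⟩
    have wx : ∀ v, wordAct D x v = wordAct D (x ++ [j]) (sref D j v) := by
      intro v; rw [wordAct_append]; change _ = wordAct D x (sref D j (sref D j v)); rw [sref_sref]
    rcases hadj : D.adj j i with _ | _
    · have h1 : Pos (wordAct D x (-simpleRoot i)) := by
        rw [wx, sref_neg, sref_simple_far D hij hadj]; exact hneg
      obtain ⟨l, hl'⟩ := IH x.length (by omega) x i rfl hxred h1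
      refine ⟨l ++ [j], (br_append_right D hl' [j]).tail ?_⟩
      exact Or.inl ⟨l, [], i, j, fun h => hij h.symm, by rw [D.symm]; exact hadj, by simp, by simp⟩
    · have hnj : Pos (wordAct D (x ++ [j]) (-simpleRoot j)) := by
        rw [wordAct_append]
        change Pos (wordAct D x (sref D j (-simpleRoot j)))
        rw [sref_neg, sref_simple_self, neg_neg]
        exact red_snoc_pos D hred
      have h1 : Pos (wordAct D x (-simpleRoot i)) := by
        rw [wx, sref_neg, sref_simple_adj D hadj, neg_add, wordAct_add]
        exact hnj.add hneg
      obtain ⟨y, hy⟩ := IH x.length (by omega) x i rfl hxred h1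
      have hyred := br_red D hy hxred
      have hylen := br_len D hy
      have hadj' : D.adj i j = true := by rw [D.symm]; exact hadj
      have h2 : Pos (wordAct D y (-simpleRoot j)) := by
        have : wordAct D y (-simpleRoot j) = wordAct D (x ++ [j]) (-simpleRoot i) := by
          have e1 : wordAct D y (-simpleRoot j) = wordAct D (y ++ [i]) (sref D i (-simpleRoot j)) := by
            rw [wordAct_append]
            change _ = wordAct D y (sref D i (sref D i _))
            rw [sref_sref]
          rw [e1, ← br_act D hy, wx]
          congr 1
          rw [sref_neg, sref_neg, sref_simple_adj D hadj', sref_add, sref_simple_self,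
            sref_simple_adj D hadj]
          abel
        rw [this]; exact hneg
      obtain ⟨z, hz⟩ := IH y.length (by simp at hylen; omega) y j rfl (red_left D hyred) h2
      refine ⟨z ++ [i, j], ?_⟩
      have b1 := br_append_right D hy [j]
      have b2 := br_append_right D (br_append_right D hz [i]) [j]
      refine (b1.trans b2).tail ?_
      exact Or.inr ⟨z, [], j, i, hadj, by simp, by simp⟩

variable {D}

lemma w0_neg {w : List I} (h : IsRedW0 D w) (j : I) : Pos (wordAct D w (-simpleRoot j)) := by
  apply neg_of_not_pos
  intro hc
  have := h.2 _ (red_snoc D h.1 hc)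
  simp at this

lemma w0_reverse {w : List I} (h : IsRedW0 D w) : IsRedW0 D w.reverse :=
  ⟨red_reverse D h.1, fun w' h' => by simpa using h.2 w' h'⟩

lemma w0_of_len {w w' : List I} (h : IsRedW0 D w) (hr : IsReducedWord D w') (hl : w'.length = w.length) :
    IsRedW0 D w' := ⟨hr, fun u hu => hl ▸ h.2 u hu⟩

lemma w0_br {w w' : List I} (h : IsRedW0 D w) (hb : Br D w w') : IsRedW0 D w' :=
  w0_of_len h (br_red D hb h.1) (br_len D hb).symm

lemma w0_start {w : List I} (h : IsRedW0 D w) (i : I) : ∃ l, Br D w (i :: l) := by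
  obtain ⟨l, hl⟩ := descent D _ w.reverse i rfl (w0_reverse h).1 (w0_neg (w0_reverse h) i)
  refine ⟨l.reverse, ?_⟩
  simpa using br_reverse D hl

lemma rotate {i : I} {l : List I} (h : IsRedW0 D (i :: l)) :
    ∃ j, IsRedW0 D (l ++ [j]) ∧ wordAct D l (simpleRoot j) = simpleRoot i := by
  set w := i :: l with hw
  -- γ = w^{-1}(-α_i) = l^{-1} α_i
  set γ := wordAct D w.reverse (-simpleRoot i) with hγ
  have hγpos : Pos γ := w0_neg (w0_reverse h) i
  have hwγ : wordAct D w γ = -simpleRoot i := wordAct_reverse' D w _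
  have hsum : γ = ∑ j, γ j • simpleRoot j := by ext k; simp [simpleRoot]
  have hw_sum : wordAct D w (-γ) = ∑ j, γ j • wordAct D w (-simpleRoot j) := by
    conv_lhs => rw [hsum]
    have : ∀ s : Finset I, wordAct D w (-∑ j ∈ s, γ j • simpleRoot j) =
        ∑ j ∈ s, γ j • wordAct D w (-simpleRoot j) := by
      intro s
      induction s using Finset.induction_on with
      | empty => rw [Finset.sum_empty, Finset.sum_empty, wordAct_neg]
                 have := wordAct_smul D w 0 0
                 simp at this; simp [this]
      | insert a s ha ih => rw [Finset.sum_insert ha, Finset.sum_insert ha, neg_add, wordAct_add, ih,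
                              ← smul_neg, wordAct_smul]
    exact this _
  rw [wordAct_neg, hwγ, neg_neg] at hw_sum
  have hht : (1 : ℤ) = ∑ j, γ j * ∑ k, wordAct D w (-simpleRoot j) k := by
    have : (1 : ℤ) = ∑ k, simpleRoot i k := by simp [simpleRoot]
    rw [this, hw_sum]
    simp only [Finset.sum_apply, Pi.smul_apply, smul_eq_mul, Finset.mul_sum]
    rw [Finset.sum_comm]
  have hge : ∀ j, 1 ≤ ∑ k, wordAct D w (-simpleRoot j) k := by
    intro j
    by_contra hc
    have hz : ∑ k, wordAct D w (-simpleRoot j) k = 0 :=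
      le_antisymm (by omega) (Finset.sum_nonneg fun k _ => w0_neg h j k)
    rw [Finset.sum_eq_zero_iff_of_nonneg (fun k _ => w0_neg h j k)] at hz
    have h2 := wordAct_rt D w j
    apply rt_ne D h2
    have : wordAct D w (-simpleRoot j) = 0 := by ext k; exact hz k (Finset.mem_univ k)
    rw [wordAct_neg] at this
    exact neg_eq_zero.mp this
  have hle : ∑ j, γ j ≤ 1 := by
    rw [hht]
    exact Finset.sum_le_sum fun j _ => le_mul_of_one_le_right (hγpos j) (hge j)
  have hne : ∃ j, γ j ≠ 0 := by
    by_contra hc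
    push Not at hc
    simp [hc] at hht
  obtain ⟨j, hj⟩ := hne
  have hγj : γ = simpleRoot j := by
    have h1 := Finset.add_sum_erase Finset.univ γ (Finset.mem_univ j)
    have h2 : 0 ≤ ∑ x ∈ Finset.univ.erase j, γ x := Finset.sum_nonneg fun k _ => hγpos k
    have h3 := hγpos j
    have h4 : ∑ x ∈ Finset.univ.erase j, γ x = 0 := by omega
    rw [Finset.sum_eq_zero_iff_of_nonneg (fun k _ => hγpos k)] at h4
    ext k
    by_cases hk : k = j
    · subst hk; simp [simpleRoot]; omega
    · simp [simpleRoot, hk]; exact h4 k (by simp [hk])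
  rw [hγj] at hwγ
  have hl : wordAct D l (simpleRoot j) = simpleRoot i := by
    have : sref D i (wordAct D l (simpleRoot j)) = -simpleRoot i := hwγ
    have h2 := congrArg (sref D i) this
    rw [sref_sref, sref_neg, sref_simple_self, neg_neg] at h2
    exact h2
  refine ⟨j, ?_, hl⟩
  refine w0_of_len h ?_ (by simp [hw])
  refine red_snoc D ?_ (by rw [hl]; exact pos_simple i)
  have := h.1
  rw [hw, ← List.singleton_append] at this
  exact red_right D this

lemma rotate' {j : I} {l : List I} (h : IsRedW0 D (l ++ [j])) :
    ∃ i, IsRedW0 D (i :: l) ∧ wordAct D l (simpleRoot j) = simpleRoot i := by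
  have h1 := w0_reverse h
  rw [List.reverse_append, List.reverse_singleton, List.singleton_append] at h1
  obtain ⟨i, h2, h3⟩ := rotate h1
  refine ⟨i, ?_, ?_⟩
  · have := w0_reverse h2; simpa using this
  · rw [← h3, wordAct_reverse']

lemma red_tail {i : I} {l : List I} (h : IsReducedWord D (i :: l)) : IsReducedWord D l := by
  rw [← List.singleton_append] at h
  exact red_right D h

end words
end CB
end

noncomputable section
open scoped BigOperators
set_option linter.all false
namespace CB
section gen
variable {k : Type*} [Field k] {R : Type*} [Ring R] [Algebra k R]

lemma asc {R : Type*} [Semigroup R] {a b c : R} (h : a * b = c) (x : R) : a * (b * x) = c * x := by rw [← mul_assoc, h]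

lemma gen_TTF (q : k) (hq : q ≠ 0) (hd : q - q⁻¹ ≠ 0) (e f g K k : R) (kK : k * K = 1) (Kk : K * k = 1)
    (kg : k * g = q⁻¹ • (g * k)) (kf : k * f = q ^ 2 • (f * k))
    (Kg : K * g = q • (g * K)) (eg : e * g = g * e)
    (ef : e * f = f * e + (q - q⁻¹)⁻¹ • (K - k)) :
    (-(k * e)) * (g * f - q • (f * g)) - q • ((g * f - q • (f * g)) * (-(k * e))) = g := by
  have hd2 : q ^ 2 - 1 ≠ 0 := by
    intro h; apply hd; field_simp; simpa using h
  simp only [mul_add, add_mul, mul_sub, sub_mul, smul_mul_assoc, mul_smul_comm, mul_assoc, neg_mul, mul_neg,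
    eg, asc eg, ef, asc ef, kg, asc kg, kf, asc kf, Kg, asc Kg, kK, asc kK, Kk, asc Kk, smul_add, smul_sub, mul_one, one_mul]
  match_scalars <;> field_simp <;> ring

lemma gen_TTE (q : k) (hq : q ≠ 0) (hd : q - q⁻¹ ≠ 0) (e e' f K k : R) (kK : k * K = 1) (Kk : K * k = 1)
    (Ke : K * e' = q⁻¹ • (e' * K)) (Kf : K * e = q ^ 2 • (e * K))
    (ke : k * e' = q • (e' * k)) (eg : e' * f = f * e')
    (ef : e * f = f * e + (q - q⁻¹)⁻¹ • (K - k)) :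
    (e * e' - q⁻¹ • (e' * e)) * (-(f * K)) - q⁻¹ • ((-(f * K)) * (e * e' - q⁻¹ • (e' * e))) = e' := by
  have hd2 : q ^ 2 - 1 ≠ 0 := by
    intro h; apply hd; field_simp; simpa using h
  simp only [mul_add, add_mul, mul_sub, sub_mul, smul_mul_assoc, mul_smul_comm, mul_assoc, neg_mul, mul_neg,
    eg, asc eg, ef, asc ef, Ke, asc Ke, Kf, asc Kf, ke, asc ke, kK, asc kK, Kk, asc Kk, smul_add, smul_sub, mul_one, one_mul]
  match_scalars <;> field_simp <;> ring
lemma gen_assoc (q : k) (x y z : R) (h : x * z = z * x) :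
    (x * y - q • (y * x)) * z - q • (z * (x * y - q • (y * x))) =
    x * (y * z - q • (z * y)) - q • ((y * z - q • (z * y)) * x) := by
  simp only [mul_sub, sub_mul, smul_mul_assoc, mul_smul_comm, mul_assoc, smul_sub, h, asc h]
  match_scalars <;> ring
lemma gen_assocE (q : k) (x y z : R) (h : x * z = z * x) :
    z * (y * x - q • (x * y)) - q • ((y * x - q • (x * y)) * z) =
    (z * y - q • (y * z)) * x - q • (x * (z * y - q • (y * z))) := by
  simp only [mul_sub, sub_mul, smul_mul_assoc, mul_smul_comm, mul_assoc, smul_sub, h, asc h]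
  match_scalars <;> ring
end gen

section rels
variable {I : Type} [Fintype I] [DecidableEq I] (D : ADEData I)

lemma rel_of {a b : FA I} (h : QRel D a b) :
    RingQuot.mkAlgHom 𝕂 (QRel D) a = RingQuot.mkAlgHom 𝕂 (QRel D) b := RingQuot.mkAlgHom_rel 𝕂 h

lemma KKk (i : I) : KK D i * KKinv D i = 1 := by
  have := rel_of D (QRel.KKinv i); simpa [KK, KKinv] using this
lemma kKK (i : I) : KKinv D i * KK D i = 1 := by
  have := rel_of D (QRel.KinvK i); simpa [KK, KKinv] using this
lemma KcK (i j : I) : KK D i * KK D j = KK D j * KK D i := by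
  have := rel_of D (QRel.KcommK i j); simpa [KK, KKinv] using this
lemma EF_ne {i j : I} (h : i ≠ j) : EE D i * FF D j = FF D j * EE D i := by
  have := rel_of D (QRel.EFdiff i j h)
  simp only [map_sub, map_mul, map_zero] at this
  exact sub_eq_zero.mp this
lemma EF_self (i : I) : EE D i * FF D i = FF D i * EE D i + (qq - qq⁻¹)⁻¹ • (KK D i - KKinv D i) := by
  have := rel_of D (QRel.EFself i)
  simp only [map_sub, map_mul, map_smul] at this
  exact sub_eq_iff_eq_add'.mp this

lemma mv {R : Type*} [Ring R] [Algebra 𝕂 R] {K k x : R} {c : 𝕂} (kK : k * K = 1) (h : K * x * k = c • x) :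
    K * x = c • (x * K) := by
  rw [← smul_mul_assoc, ← h, mul_assoc, kK, mul_one]
lemma mv' {R : Type*} [Ring R] [Algebra 𝕂 R] {K k x : R} {c : 𝕂} (kK : k * K = 1) (hc : c ≠ 0) (h : K * x * k = c • x) :
    k * x = c⁻¹ • (x * k) := by
  have : k * (K * x * k) = x * k := by rw [← mul_assoc, ← mul_assoc, kK, one_mul]
  rw [← this, h, mul_smul_comm, smul_smul, inv_mul_cancel₀ hc, one_smul]

lemma KFc (i j : I) : KK D i * FF D j * KKinv D i = qq ^ (-cartan D i j) • FF D j := by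
  by_cases h : i = j
  · subst h
    have := rel_of D (QRel.KFself i)
    simp only [map_mul, map_smul] at this
    rw [cartan_self]
    exact this
  · rcases ha : D.adj i j with _ | _
    · have := rel_of D (QRel.KFfar i j h ha)
      simp only [map_mul, map_smul] at this
      rw [cartan_far D h ha]; simpa [KK, KKinv, FF] using this
    · have := rel_of D (QRel.KFadj i j ha)
      simp only [map_mul, map_smul] at this
      rw [cartan_adj D ha]; simpa [KK, KKinv, FF] using this
lemma KEc (i j : I) : KK D i * EE D j * KKinv D i = qq ^ (cartan D i j) • EE D j := by
  by_cases h : i = j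
  · subst h
    have := rel_of D (QRel.KEself i)
    simp only [map_mul, map_smul] at this
    rw [cartan_self]
    exact this
  · rcases ha : D.adj i j with _ | _
    · have := rel_of D (QRel.KEfar i j h ha)
      simp only [map_mul, map_smul] at this
      rw [cartan_far D h ha]; simpa [KK, KKinv, EE] using this
    · have := rel_of D (QRel.KEadj i j ha)
      simp only [map_mul, map_smul] at this
      rw [cartan_adj D ha]; simpa [KK, KKinv, EE] using this

lemma qz (n : ℤ) : qq ^ n ≠ 0 := zpow_ne_zero _ qq_ne

lemma KF (i j : I) : KK D i * FF D j = qq ^ (-cartan D i j) • (FF D j * KK D i) := mv (kKK D i) (KFc D i j)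
lemma KE (i j : I) : KK D i * EE D j = qq ^ (cartan D i j) • (EE D j * KK D i) := mv (kKK D i) (KEc D i j)
lemma kF (i j : I) : KKinv D i * FF D j = qq ^ (cartan D i j) • (FF D j * KKinv D i) := by
  have := mv' (kKK D i) (qz _) (KFc D i j)
  rwa [← zpow_neg, neg_neg] at this
lemma kE (i j : I) : KKinv D i * EE D j = qq ^ (-cartan D i j) • (EE D j * KKinv D i) := by
  have := mv' (kKK D i) (qz _) (KEc D i j)
  rwa [← zpow_neg] at this

lemma serreF {i j : I} (h : D.adj i j = true) :
    FF D i ^ 2 * FF D j + FF D j * FF D i ^ 2 = (qq + qq⁻¹) • (FF D i * FF D j * FF D i) := by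
  have := rel_of D (QRel.serreF i j h); simp only [map_mul, map_add, map_smul, map_pow] at this; exact this
lemma serreE {i j : I} (h : D.adj i j = true) :
    EE D i ^ 2 * EE D j + EE D j * EE D i ^ 2 = (qq + qq⁻¹) • (EE D i * EE D j * EE D i) := by
  have := rel_of D (QRel.serreE i j h); simp only [map_mul, map_add, map_smul, map_pow] at this; exact this
lemma FFf {i j : I} (hn : i ≠ j) (h : D.adj i j = false) : FF D i * FF D j = FF D j * FF D i := by
  have := rel_of D (QRel.FFfar i j hn h); simp only [map_mul] at this; exact this
lemma EEf {i j : I} (hn : i ≠ j) (h : D.adj i j = false) : EE D i * EE D j = EE D j * EE D i := by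
  have := rel_of D (QRel.EEfar i j hn h); simp only [map_mul] at this; exact this

/-- extensionality for algebra homs out of Uq -/
lemma hom_ext' {S : Type*} [Ring S] [Algebra 𝕂 S] (f g : Uq D →ₐ[𝕂] S) (hE : ∀ i, f (EE D i) = g (EE D i))
    (hF : ∀ i, f (FF D i) = g (FF D i)) (hK : ∀ i, f (KK D i) = g (KK D i)) : f = g := by
  apply RingQuot.ringQuot_ext'
  apply FreeAlgebra.hom_ext
  funext x
  cases x with
  | E i => exact hE i
  | F i => exact hF i
  | K i => exact hK i
  | Kinv i =>
    change f (KKinv D i) = g (KKinv D i)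
    have h1 : f (KKinv D i) * f (KK D i) = 1 := by rw [← map_mul, kKK, map_one]
    have h2 : g (KK D i) * g (KKinv D i) = 1 := by rw [← map_mul, KKk, map_one]
    rw [hK] at h1
    calc f (KKinv D i) = f (KKinv D i) * (g (KK D i) * g (KKinv D i)) := by rw [h2, mul_one]
      _ = g (KKinv D i) := by rw [← mul_assoc, h1, one_mul]


variable {D}
section T
variable {T : I → (Uq D ≃ₐ[𝕂] Uq D)}

lemma TFs (hT : IsLusztigAuts D T) (i : I) : T i (FF D i) = -(KKinv D i * EE D i) := (hT i i).1
lemma TFa (hT : IsLusztigAuts D T) {i j : I} (h : D.adj i j = true) :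
  T i (FF D j) = FF D j * FF D i - qq • (FF D i * FF D j) := (hT i j).2.1 h
lemma TFf (hT : IsLusztigAuts D T) {i j : I} (hn : i ≠ j) (h : D.adj i j = false) :
  T i (FF D j) = FF D j := (hT i j).2.2.1 hn h
lemma TEs (hT : IsLusztigAuts D T) (i : I) : T i (EE D i) = -(FF D i * KK D i) := (hT i i).2.2.2.1
lemma TEa (hT : IsLusztigAuts D T) {i j : I} (h : D.adj i j = true) :
  T i (EE D j) = EE D i * EE D j - qq⁻¹ • (EE D j * EE D i) := (hT i j).2.2.2.2.1 h
lemma TEf (hT : IsLusztigAuts D T) {i j : I} (hn : i ≠ j) (h : D.adj i j = false) :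
  T i (EE D j) = EE D j := (hT i j).2.2.2.2.2.1 hn h
lemma TKs (hT : IsLusztigAuts D T) (i : I) : T i (KK D i) = KKinv D i := (hT i i).2.2.2.2.2.2.1
lemma TKa (hT : IsLusztigAuts D T) {i j : I} (h : D.adj i j = true) :
  T i (KK D j) = KK D i * KK D j := (hT i j).2.2.2.2.2.2.2.1 h
lemma TKf (hT : IsLusztigAuts D T) {i j : I} (hn : i ≠ j) (h : D.adj i j = false) :
  T i (KK D j) = KK D j := (hT i j).2.2.2.2.2.2.2.2 hn h

lemma adj_symm {i j : I} (h : D.adj i j = true) : D.adj j i = true := by rw [D.symm]; exact h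
lemma far_symm {i j : I} (h : D.adj i j = false) : D.adj j i = false := by rw [D.symm]; exact h

lemma TTF (hT : IsLusztigAuts D T) {a b : I} (h : D.adj a b = true) : T a (T b (FF D a)) = FF D b := by
  rw [TFa hT (adj_symm h), map_sub, map_smul, map_mul, map_mul, TFs hT, TFa hT h]
  refine gen_TTF qq qq_ne qd_ne _ _ _ (KK D a) _ (kKK D a) (KKk D a) ?_ ?_ ?_ (EF_ne D (adj_ne D h)) (EF_self D a)
  · rw [kF, cartan_adj D h]; simp
  · rw [kF, cartan_self]; rfl
  · rw [KF, cartan_adj D h]; simp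
lemma TTE (hT : IsLusztigAuts D T) {a b : I} (h : D.adj a b = true) : T a (T b (EE D a)) = EE D b := by
  rw [TEa hT (adj_symm h), map_sub, map_smul, map_mul, map_mul, TEs hT, TEa hT h]
  refine gen_TTE qq qq_ne qd_ne _ _ _ (KK D a) (KKinv D a) (kKK D a) (KKk D a) ?_ ?_ ?_ (EF_ne D (adj_ne D h).symm) (EF_self D a)
  · rw [KE, cartan_adj D h]; simp
  · rw [KE, cartan_self]; rfl
  · rw [kE, cartan_adj D h]; simp
lemma TTK (hT : IsLusztigAuts D T) {a b : I} (h : D.adj a b = true) : T a (T b (KK D a)) = KK D b := by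
  rw [TKa hT (adj_symm h), map_mul, TKs hT, TKa hT h, KcK, mul_assoc, KKk, mul_one]

lemma inv_unique {R : Type*} [Ring R] {x y z : R} (h1 : y * x = 1) (h2 : x * z = 1) : y = z := by
  calc y = y * (x * z) := by rw [h2, mul_one]
    _ = z := by rw [← mul_assoc, h1, one_mul]

lemma Tk_of {f : Uq D →ₐ[𝕂] Uq D} {i j : I} (h : f (KK D i) = KK D j) : f (KKinv D i) = KKinv D j := by
  refine inv_unique (x := KK D j) ?_ (KKk D j)
  rw [← h, ← map_mul, kKK, map_one]
lemma Tks (hT : IsLusztigAuts D T) (i : I) : T i (KKinv D i) = KK D i := by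
  refine inv_unique (x := KKinv D i) ?_ (kKK D i)
  have := congrArg (T i) (kKK D i)
  rwa [map_mul, map_one, TKs hT] at this
lemma TTk (hT : IsLusztigAuts D T) {a b : I} (h : D.adj a b = true) : T a (T b (KKinv D a)) = KKinv D b :=
  Tk_of (f := ((T a).toAlgHom.comp (T b).toAlgHom)) (TTK hT h)

lemma no_triangle {a b k : I} (h1 : D.adj a b = true) (h2 : D.adj a k = true) (h3 : D.adj b k = true) : False := by
  have := bil_pos D (simpleRoot a + simpleRoot b + simpleRoot k) (by
    intro h
    have := congrFun h a
    have p1 := pos_simple b a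
    have p2 := pos_simple k a
    have p3 : simpleRoot a a = 1 := by simp [simpleRoot]
    simp only [Pi.add_apply, Pi.zero_apply] at this
    omega)
  simp only [bil_add_right, bil_simple, pairing_add, pairing_simple, cartan_self, cartan_adj D h1,
    cartan_adj D h2, cartan_adj D h3, cartan_adj D (adj_symm h1), cartan_adj D (adj_symm h2),
    cartan_adj D (adj_symm h3)] at this
  omega

lemma far_braid (hT : IsLusztigAuts D T) {a b : I} (hn : a ≠ b) (h : D.adj a b = false) (x : Uq D) :
    T a (T b x) = T b (T a x) := by
  have hn' := hn.symm
  have h' := far_symm h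
  have : ((T a).toAlgHom.comp (T b).toAlgHom) = ((T b).toAlgHom.comp (T a).toAlgHom) := by
    have k1 : ∀ {a b : I}, a ≠ b → D.adj a b = false → T b (KKinv D a) = KKinv D a := fun {a b} hn h =>
      Tk_of (f := (T b).toAlgHom) (TKf hT hn.symm (far_symm h))
    apply hom_ext'
    · intro k
      change T a (T b (EE D k)) = T b (T a (EE D k))
      by_cases ka : a = k
      · subst ka
        rw [TEf hT hn' h', TEs hT, map_neg, map_mul, TFf hT hn' h', TKf hT hn' h']
      by_cases kb : b = k
      · subst kb
        rw [TEf hT hn h, TEs hT, map_neg, map_mul, TFf hT hn h, TKf hT hn h]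
      rcases ha : D.adj a k with _ | _ <;> rcases hb : D.adj b k with _ | _
      · rw [TEf hT ka ha, TEf hT kb hb, TEf hT ka ha]
      · rw [TEf hT ka ha, TEa hT hb, map_sub, map_smul, map_mul, map_mul, TEf hT ka ha, TEf hT hn h]
      · rw [TEf hT kb hb, TEa hT ha, map_sub, map_smul, map_mul, map_mul, TEf hT kb hb, TEf hT hn' h']
      · rw [TEa hT ha, TEa hT hb, map_sub, map_smul, map_mul, map_mul, map_sub, map_smul, map_mul, map_mul,
          TEf hT hn h, TEf hT hn' h', TEa hT ha, TEa hT hb]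
        have e := EEf D hn h
        simp only [mul_sub, sub_mul, smul_mul_assoc, mul_smul_comm, mul_assoc, smul_sub, e, asc e]
        abel
    · intro k
      change T a (T b (FF D k)) = T b (T a (FF D k))
      by_cases ka : a = k
      · subst ka
        rw [TFf hT hn' h', TFs hT, map_neg, map_mul, TEf hT hn' h', k1 hn h]
      by_cases kb : b = k
      · subst kb
        rw [TFf hT hn h, TFs hT, map_neg, map_mul, TEf hT hn h, k1 hn' h']
      rcases ha : D.adj a k with _ | _ <;> rcases hb : D.adj b k with _ | _
      · rw [TFf hT ka ha, TFf hT kb hb, TFf hT ka ha]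
      · rw [TFf hT ka ha, TFa hT hb, map_sub, map_smul, map_mul, map_mul, TFf hT ka ha, TFf hT hn h]
      · rw [TFf hT kb hb, TFa hT ha, map_sub, map_smul, map_mul, map_mul, TFf hT kb hb, TFf hT hn' h']
      · rw [TFa hT ha, TFa hT hb, map_sub, map_smul, map_mul, map_mul, map_sub, map_smul, map_mul, map_mul,
          TFf hT hn h, TFf hT hn' h', TFa hT ha, TFa hT hb]
        have e := FFf D hn h
        simp only [mul_sub, sub_mul, smul_mul_assoc, mul_smul_comm, mul_assoc, smul_sub, e, asc e]
        abel
    · intro k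
      change T a (T b (KK D k)) = T b (T a (KK D k))
      by_cases ka : a = k
      · subst ka
        rw [TKf hT hn' h', TKs hT, k1 hn h]
      by_cases kb : b = k
      · subst kb
        rw [TKf hT hn h, TKs hT, k1 hn' h']
      rcases ha : D.adj a k with _ | _ <;> rcases hb : D.adj b k with _ | _
      · rw [TKf hT ka ha, TKf hT kb hb, TKf hT ka ha]
      · rw [TKf hT ka ha, TKa hT hb, map_mul, TKf hT ka ha, TKf hT hn h]
      · rw [TKf hT kb hb, TKa hT ha, map_mul, TKf hT kb hb, TKf hT hn' h']
      · rw [TKa hT ha, TKa hT hb, map_mul, map_mul, TKf hT hn h, TKf hT hn' h', TKa hT ha, TKa hT hb,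
          ← mul_assoc, KcK D b a, mul_assoc]
  exact DFunLike.congr_fun this x

lemma adj_braid (hT : IsLusztigAuts D T) {a b : I} (h : D.adj a b = true) (x : Uq D) :
    T a (T b (T a x)) = T b (T a (T b x)) := by
  have h' := adj_symm h
  have : ((T a).toAlgHom.comp ((T b).toAlgHom.comp (T a).toAlgHom)) =
      ((T b).toAlgHom.comp ((T a).toAlgHom.comp (T b).toAlgHom)) := by
    apply hom_ext'
    · intro k
      change T a (T b (T a (EE D k))) = T b (T a (T b (EE D k)))
      by_cases ka : a = k
      · subst ka
        rw [TTE hT h, TEs hT, TEs hT, map_neg, map_neg, map_mul, map_mul, TTF hT h, TTK hT h]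
      by_cases kb : b = k
      · subst kb
        rw [TTE hT h', TEs hT, TEs hT, map_neg, map_neg, map_mul, map_mul, TTF hT h', TTK hT h']
      rcases ha : D.adj a k with _ | _ <;> rcases hb : D.adj b k with _ | _
      · rw [TEf hT ka ha, TEf hT kb hb, TEf hT ka ha, TEf hT kb hb]
      · rw [TEf hT ka ha, TEa hT hb]
        simp only [map_sub, map_smul, map_mul]
        rw [TTE hT h', TEf hT ka ha, TEa hT hb, TEa hT h]
        exact (gen_assocE _ _ _ _ (EEf D (Ne.symm ka) (far_symm ha))).symm
      · rw [TEf hT kb hb, TEa hT ha]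
        simp only [map_sub, map_smul, map_mul]
        rw [TTE hT h, TEf hT kb hb, TEa hT ha, TEa hT h']
        exact (gen_assocE _ _ _ _ (EEf D (Ne.symm kb) (far_symm hb)))
      · exact (no_triangle h ha hb).elim
    · intro k
      change T a (T b (T a (FF D k))) = T b (T a (T b (FF D k)))
      by_cases ka : a = k
      · subst ka
        rw [TTF hT h, TFs hT, TFs hT, map_neg, map_neg, map_mul, map_mul, TTE hT h, TTk hT h]
      by_cases kb : b = k
      · subst kb
        rw [TTF hT h', TFs hT, TFs hT, map_neg, map_neg, map_mul, map_mul, TTE hT h', TTk hT h']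
      rcases ha : D.adj a k with _ | _ <;> rcases hb : D.adj b k with _ | _
      · rw [TFf hT ka ha, TFf hT kb hb, TFf hT ka ha, TFf hT kb hb]
      · rw [TFf hT ka ha, TFa hT hb]
        simp only [map_sub, map_smul, map_mul]
        rw [TTF hT h', TFf hT ka ha, TFa hT hb, TFa hT h]
        exact (gen_assoc _ _ _ _ (FFf D (Ne.symm ka) (far_symm ha))).symm
      · rw [TFf hT kb hb, TFa hT ha]
        simp only [map_sub, map_smul, map_mul]
        rw [TTF hT h, TFf hT kb hb, TFa hT ha, TFa hT h']
        exact (gen_assoc _ _ _ _ (FFf D (Ne.symm kb) (far_symm hb)))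
      · exact (no_triangle h ha hb).elim
    · intro k
      change T a (T b (T a (KK D k))) = T b (T a (T b (KK D k)))
      by_cases ka : a = k
      · subst ka
        rw [TTK hT h, TKs hT, TKs hT, TTk hT h]
      by_cases kb : b = k
      · subst kb
        rw [TTK hT h', TKs hT, TKs hT, TTk hT h']
      rcases ha : D.adj a k with _ | _ <;> rcases hb : D.adj b k with _ | _
      · rw [TKf hT ka ha, TKf hT kb hb, TKf hT ka ha, TKf hT kb hb]
      · rw [TKf hT ka ha, TKa hT hb]
        simp only [map_mul]
        rw [TTK hT h', TKf hT ka ha, TKa hT hb, TKa hT h, mul_assoc]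
      · rw [TKf hT kb hb, TKa hT ha]
        simp only [map_mul]
        rw [TTK hT h, TKf hT kb hb, TKa hT ha, TKa hT h', mul_assoc]
      · exact (no_triangle h ha hb).elim
  exact DFunLike.congr_fun this x

/-- applyT as an algebra equivalence -/
def TT (T : I → (Uq D ≃ₐ[𝕂] Uq D)) : List I → (Uq D →ₐ[𝕂] Uq D)
  | [] => AlgHom.id 𝕂 _
  | i :: l => (T i).toAlgHom.comp (TT T l)

lemma TT_cons (i : I) (l : List I) (x : Uq D) : TT T (i :: l) x = T i (TT T l x) := rfl
lemma TT_nil (x : Uq D) : TT T [] x = x := rfl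
lemma TT_append (l m : List I) (x : Uq D) : TT T (l ++ m) x = TT T l (TT T m x) := by
  induction l with
  | nil => rfl
  | cons i l ih => rw [List.cons_append, TT_cons, ih, TT_cons]
lemma TT_snoc (l : List I) (i : I) (x : Uq D) : TT T (l ++ [i]) x = TT T l (T i x) := TT_append l [i] x
lemma applyT_eq (l : List I) (x : Uq D) : applyT T l x = TT T l x := by
  induction l with
  | nil => rfl
  | cons i l ih => rw [TT_cons, ← ih]; rfl
lemma TT_inj (l : List I) : Function.Injective (TT T l) := by
  induction l with
  | nil => exact fun _ _ h => h
  | cons i l ih => exact (T i).injective.comp ih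

lemma TT_bm (hT : IsLusztigAuts D T) {w w' : List I} (h : BraidMove D w w') (x : Uq D) :
    TT T w x = TT T w' x := by
  rcases h with ⟨w₁, w₂, a, b, hn, hab, rfl, rfl⟩ | ⟨w₁, w₂, a, b, hab, rfl, rfl⟩
  · rw [TT_append, TT_append, TT_cons, TT_cons, far_braid hT hn hab]; rfl
  · rw [TT_append, TT_append, TT_cons, TT_cons, TT_cons, adj_braid hT hab]; rfl
lemma TT_br (hT : IsLusztigAuts D T) {w w' : List I} (h : Br D w w') (x : Uq D) :
    TT T w x = TT T w' x := by
  induction h with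
  | refl => rfl
  | tail _ h ih => rw [ih, TT_bm hT h]
end T
end rels
end CB
end

noncomputable section
open scoped BigOperators
set_option linter.all false
namespace CB

/-- integer-indexed quantum integer -/
def qz' (n : ℤ) : 𝕂 := (qq ^ n - qq ^ (-n)) / (qq - qq⁻¹)
lemma qz'_nat (n : ℕ) : qz' n = qInt n := (qInt_eq n).symm
lemma qz'_zero : qz' 0 = 0 := by simp [qz']
lemma qz'_id (c r : ℤ) : qq ^ (-r) * qz' (c - r) + qq ^ (c - r) * qz' r = qz' c := by
  have := qq_ne
  simp only [qz']
  rw [← mul_div_assoc, ← mul_div_assoc, ← add_div]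
  congr 1
  simp only [mul_sub, ← zpow_add₀ qq_ne]
  ring_nf

section rk2
variable {R : Type*} [Ring R] [Algebra 𝕂 R]

/-- generic divided power -/
def dpg (x : R) (n : ℕ) : R := (qFact n)⁻¹ • x ^ n
/-- integer-indexed divided power -/
def dz (x : R) (n : ℤ) : R := if n < 0 then 0 else dpg x n.toNat

lemma dpg_zero (x : R) : dpg x 0 = 1 := by simp [dpg, qFact_zero]
lemma dpg_one (x : R) : dpg x 1 = x := by simp [dpg, qFact_one]
lemma dz_nat (x : R) (n : ℕ) : dz x n = dpg x n := by simp [dz]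
lemma dz_neg (x : R) {n : ℤ} (h : n < 0) : dz x n = 0 := by simp [dz, h]
lemma mul_dpg (x : R) (n : ℕ) : x * dpg x n = qInt (n + 1) • dpg x (n + 1) := by
  simp only [dpg, mul_smul_comm, smul_smul, qFact_succ, pow_succ']
  congr 1
  have := qFact_ne n
  have := qInt_ne (Nat.succ_ne_zero n)
  field_simp
lemma dpg_mul (x : R) (n : ℕ) : dpg x n * x = qInt (n + 1) • dpg x (n + 1) := by
  rw [← mul_dpg]; simp [dpg, mul_smul_comm, smul_mul_assoc, ← pow_succ, ← pow_succ']
lemma mul_dz (x : R) (n : ℤ) : x * dz x n = qz' (n + 1) • dz x (n + 1) := by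
  rcases lt_trichotomy n (-1) with h | h | h
  · rw [dz_neg x (by omega), dz_neg x (by omega)]; simp
  · subst h; rw [dz_neg x (by omega)]; simp [qz'_zero]
  · obtain ⟨m, rfl⟩ := Int.eq_ofNat_of_zero_le (by omega : 0 ≤ n)
    have : ((m : ℤ) + 1) = ((m + 1 : ℕ) : ℤ) := by push_cast; rfl
    rw [this, dz_nat, dz_nat, mul_dpg, qz'_nat]
lemma dz_mul (x : R) (n : ℤ) : dz x n * x = qz' (n + 1) • dz x (n + 1) := by
  rw [← mul_dz]
  unfold dz
  split_ifs
  · simp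
  · simp [dpg, mul_smul_comm, smul_mul_assoc, ← pow_succ, ← pow_succ']

lemma qcomm_pow {x z : R} {c : 𝕂} (h : x * z = c • (z * x)) (m n : ℕ) :
    x ^ m * z ^ n = c ^ (m * n) • (z ^ n * x ^ m) := by
  have h1 : ∀ n, x * z ^ n = c ^ n • (z ^ n * x) := by
    intro n
    induction n with
    | zero => simp
    | succ n ih =>
      rw [pow_succ, ← mul_assoc, ih, smul_mul_assoc, mul_assoc, h, mul_smul_comm, smul_smul, ← mul_assoc,
        pow_succ]
  induction m with
  | zero => simp
  | succ m ih =>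
    rw [pow_succ', mul_assoc, ih, mul_smul_comm, ← mul_assoc, h1, smul_mul_assoc, smul_smul, mul_assoc,
      ← pow_add]
    congr 2
    ring
lemma qcomm_dpg {x z : R} {c : 𝕂} (h : x * z = c • (z * x)) (m n : ℕ) :
    dpg x m * dpg z n = c ^ (m * n) • (dpg z n * dpg x m) := by
  simp only [dpg, smul_mul_assoc, mul_smul_comm, qcomm_pow h, smul_smul]
  congr 1; ring

structure R2 (x y z : R) : Prop where
  yx : y * x = qq • (x * y) + z
  zx : z * x = qq⁻¹ • (x * z)
  yz : y * z = qq⁻¹ • (z * y)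

lemma R2.y_dz {x y z : R} (h : R2 x y z) (a : ℕ) :
    y * dpg x a = qq ^ (a : ℤ) • (dpg x a * y) + dz x (a - 1) * z := by
  induction a with
  | zero => simp [dpg_zero, dz_neg]
  | succ a ih =>
    have hne := qInt_ne (Nat.succ_ne_zero a)
    have e1 : dpg x (a + 1) = (qInt (a + 1))⁻¹ • (dpg x a * x) := by
      rw [dpg_mul, smul_smul, inv_mul_cancel₀ hne, one_smul]
    have e2 : y * (dpg x a * x) = qInt (a + 1) • (qq ^ ((a + 1 : ℕ) : ℤ) • (dpg x (a + 1) * y) + dpg x a * z) := by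
      rw [← mul_assoc, ih, add_mul, smul_mul_assoc, mul_assoc, h.yx, mul_assoc, h.zx, mul_add, mul_smul_comm,
        mul_smul_comm, ← mul_assoc, dpg_mul, ← mul_assoc, dz_mul, sub_add_cancel, dz_nat, qz'_nat]
      have e3 : qInt (a + 1) = qq ^ (a : ℤ) + qq⁻¹ * qInt a := by
        rw [add_comm a 1, qInt_add 1 a]; simp [qInt_one]
      simp only [smul_add, smul_mul_assoc, smul_smul]
      rw [add_assoc, ← add_smul]
      congr 1
      · congr 1
        push_cast
        rw [zpow_add_one₀ qq_ne]; ring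
      · rw [e3]
    rw [e1, mul_smul_comm, e2, smul_smul, inv_mul_cancel₀ hne, one_smul, ← e1]
    congr 2
    push_cast
    rw [add_sub_cancel_right, dz_nat]

lemma R2.y_dz' {x y z : R} (h : R2 x y z) (a : ℤ) :
    y * dz x a = qq ^ a • (dz x a * y) + dz x (a - 1) * z := by
  by_cases ha : a < 0
  · rw [dz_neg x ha, dz_neg x (by omega)]; simp
  · obtain ⟨m, rfl⟩ := Int.eq_ofNat_of_zero_le (by omega : 0 ≤ a)
    rw [dz_nat, h.y_dz]

lemma R2.y_dpz {x y z : R} (h : R2 x y z) (r : ℕ) :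
    y * dpg z r = qq ^ (-(r : ℤ)) • (dpg z r * y) := by
  have := qcomm_dpg h.yz 1 r
  rw [dpg_one, one_mul] at this
  rw [this]; congr 1
  rw [zpow_neg, inv_pow]; rfl

lemma R2.formula {x y z : R} (h : R2 x y z) (a c : ℕ) :
    dpg y c * dpg x a = ∑ r ∈ Finset.range (c + 1),
      qq ^ (((a : ℤ) - r) * ((c : ℤ) - r)) • (dz x ((a : ℤ) - r) * dpg z r * dz y ((c : ℤ) - r)) := by
  induction c with
  | zero => simp [dpg_zero, dz_nat, dz]
  | succ c ih =>
    have hne := qInt_ne (Nat.succ_ne_zero c)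
    have e1 : dpg y (c + 1) = (qInt (c + 1))⁻¹ • (y * dpg y c) := by
      rw [mul_dpg, smul_smul, inv_mul_cancel₀ hne, one_smul]
    rw [e1, smul_mul_assoc, mul_assoc, ih, Finset.mul_sum]
    set F : ℕ → R := fun r => (qq ^ (((a : ℤ) - r) * ((c + 1 : ℤ) - r)) * (qq ^ (-(r : ℤ)) * qz' (c + 1 - r))) •
      (dz x ((a : ℤ) - r) * dpg z r * dz y ((c : ℤ) + 1 - r)) with hF
    set G : ℕ → R := fun r => (qq ^ (((a : ℤ) - r) * ((c + 1 : ℤ) - r)) * (qq ^ ((c : ℤ) + 1 - r) * qz' r)) •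
      (dz x ((a : ℤ) - r) * dpg z r * dz y ((c : ℤ) + 1 - r)) with hG
    have key : ∀ r ∈ Finset.range (c + 1), y * (qq ^ (((a : ℤ) - r) * ((c : ℤ) - r)) •
        (dz x ((a : ℤ) - r) * dpg z r * dz y ((c : ℤ) - r))) = F r + G (r + 1) := by
      intro r _
      rw [mul_smul_comm, ← mul_assoc, ← mul_assoc, h.y_dz', add_mul, add_mul, smul_add]
      congr 1
      · simp only [hF]
        rw [smul_mul_assoc, smul_mul_assoc, mul_assoc (dz x _) y, h.y_dpz, mul_smul_comm, smul_mul_assoc,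
          ← mul_assoc, mul_assoc _ y, mul_dz, mul_smul_comm, smul_smul, smul_smul, smul_smul,
          show (c : ℤ) - r + 1 = c + 1 - r by ring]
        congr 1
        rw [show ((a : ℤ) - r) * ((c + 1 : ℤ) - r) = ((a : ℤ) - r) * ((c : ℤ) - r) + ((a : ℤ) - r) by ring,
          zpow_add₀ qq_ne]
        ring
      · simp only [hG]
        rw [mul_assoc (dz x _) z, mul_dpg, mul_smul_comm, smul_mul_assoc, smul_smul]
        push_cast
        rw [show (a : ℤ) - r - 1 = a - (r + 1) by ring, show (c : ℤ) + 1 - (r + 1) = c - r by ring]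
        congr 1
        rw [← mul_assoc, ← zpow_add₀ qq_ne, ← qz'_nat]
        push_cast
        congr 2
        ring
    rw [Finset.sum_congr rfl key, Finset.sum_add_distrib]
    have hF0 : F (c + 1) = 0 := by simp [hF, qz'_zero]
    have hG0 : G 0 = 0 := by simp [hG, qz'_zero]
    have sF : ∑ r ∈ Finset.range (c + 1), F r = ∑ r ∈ Finset.range (c + 1 + 1), F r := by
      rw [Finset.sum_range_succ _ (c + 1), hF0, add_zero]
    have sG : ∑ r ∈ Finset.range (c + 1), G (r + 1) = ∑ r ∈ Finset.range (c + 1 + 1), G r := by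
      rw [Finset.sum_range_succ' _ (c + 1), hG0, add_zero]
    rw [sF, sG, ← Finset.sum_add_distrib, Finset.smul_sum]
    refine Finset.sum_congr rfl fun r _ => ?_
    simp only [hF, hG]
    rw [← add_smul, ← mul_add, qz'_id, smul_smul]
    push_cast
    congr 1
    have : qz' ((c : ℤ) + 1) = qInt (c + 1) := by rw [← qz'_nat]; push_cast; rfl
    rw [this]
    field_simp

lemma dpg_mul_dpg (x : R) (m n : ℕ) : dpg x m * dpg x n = qbin m n • dpg x (m + n) := by
  simp only [dpg, smul_mul_assoc, mul_smul_comm, smul_smul, ← pow_add, qbin]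
  congr 1
  have := qFact_ne m; have := qFact_ne n; have := qFact_ne (m + n)
  field_simp

/-- span of divided powers -/
def Dp (x : R) : Submodule A R := Submodule.span A (Set.range (dpg x))

lemma dpg_mem (x : R) (n : ℕ) : dpg x n ∈ Dp x := Submodule.subset_span ⟨n, rfl⟩
lemma A_smul_mem {S : Submodule A R} {c : 𝕂} (hc : c ∈ A) {x : R} (hx : x ∈ S) : c • x ∈ S :=
  S.smul_mem ⟨c, hc⟩ hx
lemma one_mem_Dp (x : R) : (1 : R) ∈ Dp x := by rw [← dpg_zero x]; exact dpg_mem x 0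
lemma dz_mem (x : R) (n : ℤ) : dz x n ∈ Dp x := by
  unfold dz; split_ifs
  · exact zero_mem _
  · exact dpg_mem _ _
lemma Dp_mul (x : R) : Dp x * Dp x ≤ Dp x := by
  rw [Dp, Submodule.span_mul_span, Submodule.span_le]
  rintro _ ⟨_, ⟨m, rfl⟩, _, ⟨n, rfl⟩, rfl⟩
  simp only [dpg_mul_dpg]
  exact A_smul_mem (qbin_mem_A m n) (dpg_mem x _)
lemma Dp_qcomm {x z : R} {c : 𝕂} (hc : c ∈ A) (h : x * z = c • (z * x)) : Dp x * Dp z ≤ Dp z * Dp x := by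
  rw [Dp, Dp, Submodule.span_mul_span, Submodule.span_le]
  rintro _ ⟨_, ⟨m, rfl⟩, _, ⟨n, rfl⟩, rfl⟩
  simp only [qcomm_dpg h]
  exact A_smul_mem (pow_mem hc _) (Submodule.mul_mem_mul (dpg_mem _ _) (dpg_mem _ _))

/-- integral subalgebra generated by divided powers of a family -/
def UA {ι : Type*} (f : ι → R) : Subalgebra A R := Algebra.adjoin A {u | ∃ i n, u = dpg (f i) n}
lemma dpg_mem_UA {ι : Type*} (f : ι → R) (i : ι) (n : ℕ) : dpg (f i) n ∈ UA f :=
  Algebra.subset_adjoin ⟨i, n, rfl⟩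
lemma Dp_le_UA {ι : Type*} (f : ι → R) (i : ι) : Dp (f i) ≤ Subalgebra.toSubmodule (UA f) := by
  rw [Dp, Submodule.span_le]
  rintro _ ⟨n, rfl⟩; exact dpg_mem_UA f i n

/-- a submodule containing 1 and left stable by divided powers contains UA -/
lemma UA_le {ι : Type*} (f : ι → R) (S : Submodule A R) (h1 : (1 : R) ∈ S) (h : ∀ i, Dp (f i) * S ≤ S) :
    Subalgebra.toSubmodule (UA f) ≤ S := by
  have key : ∀ u ∈ UA f, ∀ s ∈ S, u * s ∈ S := by
    intro u hu
    induction hu using Algebra.adjoin_induction with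
    | mem u hu =>
      obtain ⟨i, n, rfl⟩ := hu
      intro s hs; exact h i (Submodule.mul_mem_mul (dpg_mem _ _) hs)
    | algebraMap r => intro s hs; rw [← Algebra.smul_def]; exact S.smul_mem r hs
    | add x y _ _ hx hy => intro s hs; rw [add_mul]; exact S.add_mem (hx s hs) (hy s hs)
    | mul x y _ _ hx hy => intro s hs; rw [mul_assoc]; exact hx _ (hy s hs)
  intro u hu
  have := key u hu 1 h1
  rwa [mul_one] at this

lemma R2.z_mem {x y z : R} (h : R2 x y z) (S : Subalgebra A R) (hx : ∀ n, dpg x n ∈ S) (hy : ∀ n, dpg y n ∈ S)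
    (n : ℕ) : dpg z n ∈ S := by
  have hdz : ∀ {u : R}, (∀ n, dpg u n ∈ S) → ∀ n : ℤ, dz u n ∈ S := by
    intro u hu n; unfold dz; split_ifs
    · exact zero_mem _
    · exact hu _
  induction n using Nat.strong_induction_on with
  | _ n ih =>
    have e := h.formula n n
    rw [Finset.sum_range_succ] at e
    simp only [sub_self, mul_zero, zpow_zero, one_smul] at e
    have d0 : ∀ u : R, dz u 0 = 1 := by intro u; simp [dz, dpg_zero]
    rw [d0, d0, one_mul, mul_one] at e
    have : dpg z n = dpg y n * dpg x n - ∑ r ∈ Finset.range n,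
      qq ^ (((n : ℤ) - r) * ((n : ℤ) - r)) • (dz x ((n : ℤ) - r) * dpg z r * dz y ((n : ℤ) - r)) := by
      rw [e]; abel
    rw [this]
    refine sub_mem (mul_mem (hy _) (hx _)) (sum_mem fun r hr => ?_)
    exact A_smul_mem (S := Subalgebra.toSubmodule S) (zpow_mem_A _)
      (S.mul_mem (S.mul_mem (hdz hx _) (ih r (Finset.mem_range.mp hr))) (hdz hy _))

lemma R2.DDD {x y z : R} (h : R2 x y z) :
    Dp x * Dp z * Dp y = Subalgebra.toSubmodule (UA (fun b : Bool => if b then x else y)) := by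
  apply le_antisymm
  · have hx := Dp_le_UA (fun b : Bool => if b then x else y) true
    have hy := Dp_le_UA (fun b : Bool => if b then x else y) false
    simp only [if_true, Bool.false_eq_true, if_false] at hx hy
    have hz : Dp z ≤ Subalgebra.toSubmodule (UA (fun b : Bool => if b then x else y)) := by
      rw [Dp, Submodule.span_le]
      rintro _ ⟨n, rfl⟩
      exact h.z_mem _ (fun n => hx (dpg_mem _ _)) (fun n => hy (dpg_mem _ _)) n
    rw [Submodule.mul_le]
    intro u hu v hv
    refine (UA (fun b : Bool => if b then x else y)).mul_mem ?_ (hy hv)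
    have : Dp x * Dp z ≤ Subalgebra.toSubmodule (UA (fun b : Bool => if b then x else y)) := by
      rw [Submodule.mul_le]; intro u hu v hv; exact (UA (fun b : Bool => if b then x else y)).mul_mem (hx hu) (hz hv)
    exact this hu
  · apply UA_le
    · have := Submodule.mul_mem_mul (Submodule.mul_mem_mul (one_mem_Dp x) (one_mem_Dp z)) (one_mem_Dp y)
      simpa using this
    · have yx : Dp y * Dp x ≤ Dp x * Dp z * Dp y := by
        rw [Dp, Dp, Submodule.span_mul_span, Submodule.span_le]
        rintro _ ⟨_, ⟨m, rfl⟩, _, ⟨n, rfl⟩, rfl⟩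
        simp only [h.formula]
        refine sum_mem fun r _ => A_smul_mem (zpow_mem_A _) ?_
        exact Submodule.mul_mem_mul (Submodule.mul_mem_mul (dz_mem _ _) (dpg_mem _ _)) (dz_mem _ _)
      intro b
      cases b
      · simp only [Bool.false_eq_true, if_false]
        calc Dp y * (Dp x * Dp z * Dp y) = (Dp y * Dp x) * (Dp z * Dp y) := by simp only [mul_assoc]
          _ ≤ (Dp x * Dp z * Dp y) * (Dp z * Dp y) := mul_le_mul' yx le_rfl
          _ = (Dp x * Dp z) * (Dp y * Dp z) * Dp y := by simp only [mul_assoc]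
          _ ≤ (Dp x * Dp z) * (Dp z * Dp y) * Dp y :=
            mul_le_mul' (mul_le_mul' le_rfl (Dp_qcomm qqinv_mem_A h.yz)) le_rfl
          _ = Dp x * (Dp z * Dp z) * (Dp y * Dp y) := by simp only [mul_assoc]
          _ ≤ Dp x * Dp z * Dp y :=
            mul_le_mul' (mul_le_mul' le_rfl (Dp_mul z)) (Dp_mul y)
      · simp only [if_true]
        calc Dp x * (Dp x * Dp z * Dp y) = (Dp x * Dp x) * (Dp z * Dp y) := by simp only [mul_assoc]
          _ ≤ Dp x * (Dp z * Dp y) := mul_le_mul' (Dp_mul x) le_rfl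
          _ = Dp x * Dp z * Dp y := by simp only [mul_assoc]

/-- image of an A-submodule under an algebra hom -/
def mapT (f : R →ₐ[𝕂] R) (S : Submodule A R) : Submodule A R := S.map (f.restrictScalars A).toLinearMap
lemma mapT_mul (f : R →ₐ[𝕂] R) (S S' : Submodule A R) : mapT f (S * S') = mapT f S * mapT f S' :=
  Submodule.map_mul _ _ _
lemma map_dpg (f : R →ₐ[𝕂] R) (x : R) (n : ℕ) : f (dpg x n) = dpg (f x) n := by
  simp [dpg]
lemma mapT_Dp (f : R →ₐ[𝕂] R) (x : R) : mapT f (Dp x) = Dp (f x) := by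
  rw [mapT, Dp, Submodule.map_span, Dp]
  congr 1
  ext u
  simp only [Set.mem_image, Set.mem_range, exists_exists_eq_and]
  constructor
  · rintro ⟨n, rfl⟩; exact ⟨n, (map_dpg f x n).symm⟩
  · rintro ⟨n, rfl⟩; exact ⟨n, map_dpg f x n⟩
lemma mem_mapT {f : R →ₐ[𝕂] R} {S : Submodule A R} {u : R} : u ∈ mapT f S ↔ ∃ s ∈ S, f s = u := Iff.rfl
end rk2
end CB
end

noncomputable section
open scoped BigOperators
set_option linter.all false
namespace CB
section LA
variable {I : Type} [Fintype I] [DecidableEq I] {D : ADEData I}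

instance algAU (D : ADEData I) : Algebra A (Uq D) := Algebra.ofSubsemiring A

variable {T : I → (Uq D ≃ₐ[𝕂] Uq D)}

lemma R2_gen {R : Type*} [Ring R] [Algebra 𝕂 R] (x y : R)
    (h1 : x ^ 2 * y + y * x ^ 2 = (qq + qq⁻¹) • (x * y * x))
    (h2 : y ^ 2 * x + x * y ^ 2 = (qq + qq⁻¹) • (y * x * y)) : R2 x y (y * x - qq • (x * y)) := by
  refine ⟨by abel, ?_, ?_⟩
  · have : y * x ^ 2 = (qq + qq⁻¹) • (x * y * x) - x ^ 2 * y := by rw [← h1]; abel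
    rw [pow_two, ← mul_assoc] at this
    rw [sub_mul, this, mul_sub, smul_sub, mul_smul_comm, smul_mul_assoc, smul_smul, inv_mul_cancel₀ qq_ne,
      add_smul, one_smul]
    simp only [mul_assoc]; abel
  · have : y ^ 2 * x = (qq + qq⁻¹) • (y * x * y) - x * y ^ 2 := by rw [← h2]; abel
    rw [pow_two, mul_assoc] at this
    rw [mul_sub, this, sub_mul, smul_sub, mul_smul_comm, smul_mul_assoc, smul_smul, inv_mul_cancel₀ qq_ne,
      add_smul, one_smul]
    simp only [mul_assoc]; abel

lemma R2_F (hT : IsLusztigAuts D T) {a b : I} (h : D.adj a b = true) :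
    R2 (FF D a) (FF D b) (T a (FF D b)) := by
  rw [TFa hT h]
  exact R2_gen _ _ (serreF D h) (serreF D (adj_symm h))

lemma R2.map {R S : Type*} [Ring R] [Algebra 𝕂 R] [Ring S] [Algebra 𝕂 S] {x y z : R} (h : R2 x y z)
    (f : R →ₐ[𝕂] S) : R2 (f x) (f y) (f z) :=
  ⟨by rw [← map_mul, h.yx, map_add, map_smul, map_mul], by rw [← map_mul, h.zx, map_smul, map_mul],
   by rw [← map_mul, h.yz, map_smul, map_mul]⟩

/-- LA -/
def LA (T : I → (Uq D ≃ₐ[𝕂] Uq D)) : List I → Submodule A (Uq D)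
  | [] => Submodule.span A {1}
  | i :: l => Dp (FF D i) * mapT (T i).toAlgHom (LA T l)

lemma mapT_comp {R : Type*} [Ring R] [Algebra 𝕂 R] (f g : R →ₐ[𝕂] R) (S : Submodule A R) :
    mapT f (mapT g S) = mapT (f.comp g) S := by
  ext u; simp only [mem_mapT]
  constructor
  · rintro ⟨_, ⟨s, hs, rfl⟩, rfl⟩; exact ⟨s, hs, rfl⟩
  · rintro ⟨s, hs, rfl⟩; exact ⟨_, ⟨s, hs, rfl⟩, rfl⟩
lemma mapT_id {R : Type*} [Ring R] [Algebra 𝕂 R] (S : Submodule A R) : mapT (AlgHom.id 𝕂 R) S = S := by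
  ext u; simp [mem_mapT]
lemma mapT_one {R : Type*} [Ring R] [Algebra 𝕂 R] (f : R →ₐ[𝕂] R) :
    mapT f (Submodule.span A {1}) = Submodule.span A {1} := by
  rw [mapT, Submodule.map_span]; simp
lemma span_one_mul {R : Type*} [Ring R] [Algebra 𝕂 R] (S : Submodule A R) : Submodule.span A {1} * S = S := by
  rw [← Submodule.one_eq_span, one_mul]
lemma mul_span_one {R : Type*} [Ring R] [Algebra 𝕂 R] (S : Submodule A R) : S * Submodule.span A {1} = S := by
  rw [← Submodule.one_eq_span, mul_one]

lemma LA_append (l m : List I) : LA T (l ++ m) = LA T l * mapT (TT T l) (LA T m) := by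
  induction l with
  | nil => change LA T m = Submodule.span A {1} * mapT (AlgHom.id 𝕂 _) (LA T m)
           rw [mapT_id, span_one_mul]
  | cons i l ih =>
    change Dp (FF D i) * mapT (T i).toAlgHom (LA T (l ++ m)) =
      Dp (FF D i) * mapT (T i).toAlgHom (LA T l) * mapT ((T i).toAlgHom.comp (TT T l)) (LA T m)
    rw [ih, mapT_mul, mapT_comp, mul_assoc]

lemma LA_snoc (l : List I) (j : I) : LA T (l ++ [j]) = LA T l * Dp (TT T l (FF D j)) := by
  rw [LA_append]
  change _ * mapT (TT T l) (Dp (FF D j) * mapT (T j).toAlgHom (Submodule.span A {1})) = _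
  rw [mapT_one, mul_span_one, mapT_Dp]

lemma LA_bm (hT : IsLusztigAuts D T) {w w' : List I} (h : BraidMove D w w') : LA T w = LA T w' := by
  rcases h with ⟨w₁, w₂, a, b, hn, hab, rfl, rfl⟩ | ⟨w₁, w₂, a, b, hab, rfl, rfl⟩
  · rw [LA_append, LA_append]
    congr 2
    change Dp (FF D a) * mapT (T a).toAlgHom (Dp (FF D b) * mapT (T b).toAlgHom (LA T w₂)) =
      Dp (FF D b) * mapT (T b).toAlgHom (Dp (FF D a) * mapT (T a).toAlgHom (LA T w₂))
    rw [mapT_mul, mapT_mul, mapT_Dp, mapT_Dp, mapT_comp, mapT_comp]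
    have e1 : (T a).toAlgHom (FF D b) = FF D b := TFf hT hn hab
    have e2 : (T b).toAlgHom (FF D a) = FF D a := TFf hT hn.symm (far_symm hab)
    have e3 : (T a).toAlgHom.comp (T b).toAlgHom = (T b).toAlgHom.comp (T a).toAlgHom := by
      exact AlgHom.ext (far_braid hT hn hab)
    have e4 : Dp (FF D a) * Dp (FF D b) = Dp (FF D b) * Dp (FF D a) := by
      have := FFf D hn hab
      apply le_antisymm
      · exact Dp_qcomm A.one_mem (by rw [one_smul, this])
      · exact Dp_qcomm A.one_mem (by rw [one_smul, this])
    rw [e1, e2, e3, ← mul_assoc, ← mul_assoc, e4]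
  · rw [LA_append, LA_append]
    congr 2
    change Dp (FF D a) * mapT (T a).toAlgHom (Dp (FF D b) * mapT (T b).toAlgHom (Dp (FF D a) * mapT (T a).toAlgHom (LA T w₂))) =
      Dp (FF D b) * mapT (T b).toAlgHom (Dp (FF D a) * mapT (T a).toAlgHom (Dp (FF D b) * mapT (T b).toAlgHom (LA T w₂)))
    simp only [mapT_mul, mapT_Dp, mapT_comp]
    have e1 : (T a).toAlgHom.comp (T b).toAlgHom (FF D a) = FF D b := TTF hT hab
    have e2 : (T b).toAlgHom.comp (T a).toAlgHom (FF D b) = FF D a := TTF hT (adj_symm hab)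
    have e3 : ((T a).toAlgHom.comp ((T b).toAlgHom.comp (T a).toAlgHom)) =
      ((T b).toAlgHom.comp ((T a).toAlgHom.comp (T b).toAlgHom)) := by
      exact AlgHom.ext (adj_braid hT hab)
    have e4 : Dp (FF D a) * Dp ((T a).toAlgHom (FF D b)) * Dp (FF D b) =
        Dp (FF D b) * Dp ((T b).toAlgHom (FF D a)) * Dp (FF D a) := by
      have h1 := (R2_F hT hab).DDD
      have h2 := (R2_F hT (adj_symm hab)).DDD
      refine h1.trans (Eq.trans ?_ h2.symm)
      unfold UA
      congr 2
      ext u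
      constructor
      · rintro ⟨i, n, rfl⟩; exact ⟨!i, n, by cases i <;> simp⟩
      · rintro ⟨i, n, rfl⟩; exact ⟨!i, n, by cases i <;> simp⟩
    rw [AlgHom.comp_apply] at e1 e2
    rw [e3, e1, e2, ← mul_assoc, ← mul_assoc, ← mul_assoc, ← mul_assoc, e4]
lemma LA_br (hT : IsLusztigAuts D T) {w w' : List I} (h : Br D w w') : LA T w = LA T w' := by
  induction h with
  | refl => rfl
  | tail _ h ih => rw [ih, LA_bm hT h]

lemma one_mem_LA (l : List I) : (1 : Uq D) ∈ LA T l := by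
  induction l with
  | nil => exact Submodule.subset_span rfl
  | cons i l ih =>
    have := Submodule.mul_mem_mul (one_mem_Dp (FF D i)) (show (1 : Uq D) ∈ mapT (T i).toAlgHom (LA T l) from ⟨1, ih, by simp⟩)
    rwa [one_mul] at this

lemma wa_snoc (v : List I) (k : I) (x : I → ℤ) : wordAct D (v ++ [k]) x = wordAct D v (sref D k x) :=
  wordAct_append D v [k] x

lemma red_ne {v : List I} {k j : I} (h : IsReducedWord D (v ++ [k] ++ [j])) : k ≠ j := by
  rintro rfl
  have h1 := red_snoc_pos D h
  have h2 := red_snoc_pos D (red_left D h)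
  rw [wa_snoc, sref_simple_self, wordAct_neg] at h1
  exact not_pos_both D (wordAct_rt D v k) h2 h1

lemma adj_descent (hT : IsLusztigAuts D T) {v : List I} {k j : I} (h : IsReducedWord D (v ++ [k] ++ [j]))
    (hadj : D.adj k j = true) (hp : ¬ Pos (wordAct D v (simpleRoot j))) :
    ∃ v', v'.length + 1 = v.length ∧ IsReducedWord D (v' ++ [k]) ∧
      wordAct D v' (simpleRoot k) = wordAct D (v ++ [k]) (simpleRoot j) ∧
      TT T (v ++ [k]) (FF D j) = TT T v' (FF D k) := by
  obtain ⟨v', hv'⟩ := descent D _ v j rfl (red_left D (red_left D h)) (neg_of_not_pos D hp)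
  have hlen := br_len D hv'
  have hr := br_red D hv' (red_left D (red_left D h))
  have e : wordAct D v' (simpleRoot k) = wordAct D (v ++ [k]) (simpleRoot j) := by
    rw [wa_snoc, br_act D hv', wa_snoc, sref_simple_adj D hadj, sref_add, sref_simple_self,
      sref_simple_adj D (adj_symm hadj)]
    congr 1; abel
  refine ⟨v', by simpa using hlen.symm, red_snoc D (red_left D hr) ?_, e, ?_⟩
  · rw [e]; exact red_snoc_pos D h
  · rw [TT_snoc, TT_br hT hv', TT_snoc, TTF hT (adj_symm hadj)]

lemma J1 (hT : IsLusztigAuts D T) (n : ℕ) : ∀ (l : List I) (j : I), l.length = n → IsReducedWord D (l ++ [j]) →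
    ∀ m, dpg (TT T l (FF D j)) m ∈ UA (FF D) := by
  induction n using Nat.strong_induction_on with
  | _ n IH =>
  intro l j hl hred m
  rcases List.eq_nil_or_concat l with rfl | ⟨v, k, rfl⟩
  · exact dpg_mem_UA _ _ _
  rw [List.concat_eq_append] at *
  have hlen : v.length + 1 = n := by simpa using hl
  have hkj := red_ne hred
  have hp := red_snoc_pos D hred
  have hv := red_left D (red_left D hred)
  rcases hadj : D.adj k j with _ | _
  · rw [TT_snoc, TFf hT hkj hadj]
    refine IH v.length (by omega) v j rfl (red_snoc D hv ?_) m
    rw [wa_snoc, sref_simple_far D hkj hadj] at hp; exact hp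
  · by_cases hpj : Pos (wordAct D v (simpleRoot j))
    · have h1 := IH v.length (by omega) v j rfl (red_snoc D hv hpj)
      have h2 := IH v.length (by omega) v k rfl (red_left D hred)
      rw [TT_snoc]
      exact ((R2_F hT hadj).map (TT T v)).z_mem _ h2 h1 m
    · obtain ⟨v', h1, h2, _, h3⟩ := adj_descent hT hred hadj hpj
      rw [h3]
      exact IH v'.length (by omega) v' k rfl h2 m

lemma pos_sum_ge {v : I → ℤ} (h : bil D v v = 2) (hp : Pos v) : 1 ≤ ∑ k, v k := by
  by_contra hc
  have hz : ∑ k, v k = 0 := le_antisymm (by omega) (Finset.sum_nonneg fun k _ => hp k)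
  rw [Finset.sum_eq_zero_iff_of_nonneg (fun k _ => hp k)] at hz
  exact rt_ne D h (by ext k; exact hz k (Finset.mem_univ k))

lemma J2 (hT : IsLusztigAuts D T) (n : ℕ) : ∀ (l : List I) (i j : I), l.length = n → IsReducedWord D (l ++ [j]) →
    wordAct D l (simpleRoot j) = simpleRoot i → TT T l (FF D j) = FF D i := by
  induction n using Nat.strong_induction_on with
  | _ n IH =>
  intro l i j hl hred hij
  rcases List.eq_nil_or_concat l with rfl | ⟨v, k, rfl⟩
  · have : j = i := by
      have := congrFun hij j
      simp [wordAct, simpleRoot] at this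
      exact this
    rw [this]; rfl
  rw [List.concat_eq_append] at *
  have hlen : v.length + 1 = n := by simpa using hl
  have hkj := red_ne hred
  have hp := red_snoc_pos D hred
  have hv := red_left D (red_left D hred)
  rcases hadj : D.adj k j with _ | _
  · rw [TT_snoc, TFf hT hkj hadj]
    rw [wa_snoc, sref_simple_far D hkj hadj] at hp hij
    exact IH v.length (by omega) v i j rfl (red_snoc D hv hp) hij
  · by_cases hpj : Pos (wordAct D v (simpleRoot j))
    · exfalso
      have hk := red_snoc_pos D (red_left D hred)
      rw [wa_snoc, sref_simple_adj D hadj, wordAct_add] at hij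
      have a1 := pos_sum_ge (wordAct_rt D v j) hpj
      have a2 := pos_sum_ge (wordAct_rt D v k) hk
      have : ∑ x, (wordAct D v (simpleRoot k) + wordAct D v (simpleRoot j)) x = 1 := by
        rw [hij]; simp [simpleRoot]
      simp only [Pi.add_apply, Finset.sum_add_distrib] at this
      omega
    · obtain ⟨v', h1, h2, h4, h3⟩ := adj_descent hT hred hadj hpj
      rw [h3]
      exact IH v'.length (by omega) v' i k rfl h2 (h4.trans hij)

lemma J2' (hT : IsLusztigAuts D T) {l : List I} {i j : I} (h : IsReducedWord D (l ++ [j]))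
    (e : wordAct D l (simpleRoot j) = simpleRoot i) : TT T l (FF D j) = FF D i := J2 hT _ l i j rfl h e

lemma LA_le (hT : IsLusztigAuts D T) (w : List I) (h : IsReducedWord D w) :
    LA T w ≤ Subalgebra.toSubmodule (UA (FF D)) := by
  induction w using List.reverseRecOn with
  | nil =>
    change Submodule.span A {1} ≤ _
    rw [Submodule.span_le]; rintro _ rfl; exact (UA (FF D)).one_mem
  | append_singleton l j ih =>
    rw [LA_snoc, Submodule.mul_le]
    intro u hu v hv
    refine (UA (FF D)).mul_mem (ih (red_left D h) hu) ?_
    have : Dp (TT T l (FF D j)) ≤ Subalgebra.toSubmodule (UA (FF D)) := by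
      rw [Dp, Submodule.span_le]
      rintro _ ⟨n, rfl⟩; exact J1 hT _ l j rfl h n
    exact this hv

lemma LA_eq (hT : IsLusztigAuts D T) {w : List I} (h : IsRedW0 D w) :
    LA T w = Subalgebra.toSubmodule (UA (FF D)) := by
  apply le_antisymm (LA_le hT w h.1)
  apply UA_le _ _ (one_mem_LA w)
  intro i
  obtain ⟨l, hl⟩ := w0_start h i
  rw [LA_br hT hl]
  change Dp (FF D i) * (Dp (FF D i) * _) ≤ Dp (FF D i) * _
  rw [← mul_assoc]
  exact mul_le_mul' (Dp_mul _) le_rfl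

lemma dpg_mem_sub (S : Subalgebra 𝕂 (Uq D)) {x : Uq D} (hx : x ∈ S) (n : ℕ) : dpg x n ∈ S :=
  S.smul_mem (pow_mem hx n) _

lemma UA_le_Uminus {x : Uq D} (h : x ∈ UA (FF D)) : x ∈ Uminus D := by
  induction h using Algebra.adjoin_induction with
  | mem u hu => obtain ⟨i, n, rfl⟩ := hu; exact dpg_mem_sub (Uminus D) (Algebra.subset_adjoin (Set.mem_range_self i)) n
  | algebraMap r => exact (Uminus D).algebraMap_mem (r : 𝕂)
  | add x y _ _ hx hy => exact add_mem hx hy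
  | mul x y _ _ hx hy => exact mul_mem hx hy

lemma Uminus_le_span (x : Uq D) (h : x ∈ Uminus D) : x ∈ Submodule.span 𝕂 (UA (FF D) : Set (Uq D)) := by
  induction h using Algebra.adjoin_induction with
  | mem u hu => obtain ⟨i, rfl⟩ := hu; rw [← dpg_one (FF D i)]; exact Submodule.subset_span (dpg_mem_UA _ _ _)
  | algebraMap r => rw [Algebra.algebraMap_eq_smul_one]
                    exact Submodule.smul_mem _ _ (Submodule.subset_span (UA (FF D)).one_mem)
  | add x y _ _ hx hy => exact add_mem hx hy
  | mul x y _ _ hx hy =>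
    have := Submodule.mul_mem_mul hx hy
    rw [Submodule.span_mul_span] at this
    refine Submodule.span_mono ?_ this
    rintro _ ⟨a, ha, b, hb, rfl⟩
    exact (UA (FF D)).mul_mem ha hb
end LA
end CB
end

noncomputable section
open scoped BigOperators
set_option linter.all false
namespace CB
section
variable {I : Type} [Fintype I] [DecidableEq I]

inductive SRel (D : ADEData I) : FreeAlgebra 𝕂 I → FreeAlgebra 𝕂 I → Prop
  | serre (i j : I) (h : D.adj i j = true) :
      SRel D (FreeAlgebra.ι 𝕂 i ^ 2 * FreeAlgebra.ι 𝕂 j + FreeAlgebra.ι 𝕂 j * FreeAlgebra.ι 𝕂 i ^ 2)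
       ((qq + qq⁻¹) • (FreeAlgebra.ι 𝕂 i * FreeAlgebra.ι 𝕂 j * FreeAlgebra.ι 𝕂 i))
  | far (i j : I) (h : i ≠ j) (h' : D.adj i j = false) :
      SRel D (FreeAlgebra.ι 𝕂 i * FreeAlgebra.ι 𝕂 j) (FreeAlgebra.ι 𝕂 j * FreeAlgebra.ι 𝕂 i)

def Fm (D : ADEData I) : Type := RingQuot (SRel D)
instance (D : ADEData I) : Ring (Fm D) := inferInstanceAs (Ring (RingQuot (SRel D)))
instance (D : ADEData I) : Algebra 𝕂 (Fm D) := inferInstanceAs (Algebra 𝕂 (RingQuot (SRel D)))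

def fmk (D : ADEData I) : FreeAlgebra 𝕂 I →ₐ[𝕂] Fm D := RingQuot.mkAlgHom 𝕂 (SRel D)
def fF (D : ADEData I) (i : I) : Fm D := fmk D (FreeAlgebra.ι 𝕂 i)

variable (D : ADEData I)

lemma fserre {i j : I} (h : D.adj i j = true) :
    fF D i ^ 2 * fF D j + fF D j * fF D i ^ 2 = (qq + qq⁻¹) • (fF D i * fF D j * fF D i) := by
  have : fmk D _ = fmk D _ := RingQuot.mkAlgHom_rel 𝕂 (SRel.serre (D := D) i j h)
  simp only [map_mul, map_add, map_smul, map_pow] at this; exact this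
lemma ffar {i j : I} (hn : i ≠ j) (h : D.adj i j = false) : fF D i * fF D j = fF D j * fF D i := by
  have : fmk D _ = fmk D _ := RingQuot.mkAlgHom_rel 𝕂 (SRel.far (D := D) i j hn h)
  simp only [map_mul] at this; exact this

lemma fmk_surj : Function.Surjective (fmk D) := RingQuot.mkAlgHom_surjective 𝕂 (SRel D)

def SerreOK (D : ADEData I) {S : Type*} [Ring S] [Algebra 𝕂 S] (g : I → S) : Prop :=
  (∀ i j, D.adj i j = true → g i ^ 2 * g j + g j * g i ^ 2 = (qq + qq⁻¹) • (g i * g j * g i)) ∧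
  (∀ i j, i ≠ j → D.adj i j = false → g i * g j = g j * g i)

def liftF {S : Type*} [Ring S] [Algebra 𝕂 S] (g : I → S) (hg : SerreOK D g) : Fm D →ₐ[𝕂] S :=
  RingQuot.liftAlgHom 𝕂 ⟨FreeAlgebra.lift 𝕂 g, by
    intro x y h
    cases h with
    | serre i j h => simpa using hg.1 i j h
    | far i j h h' => simpa using hg.2 i j h h'⟩

lemma liftF_F {S : Type*} [Ring S] [Algebra 𝕂 S] (g : I → S) (hg : SerreOK D g) (i : I) :
    liftF D g hg (fF D i) = g i := by
  change RingQuot.liftAlgHom 𝕂 _ (RingQuot.mkAlgHom 𝕂 (SRel D) _) = _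
  rw [RingQuot.liftAlgHom_mkAlgHom_apply]; simp

lemma fm_adjoin : Algebra.adjoin 𝕂 (Set.range (fF D)) = ⊤ := by
  have h : Set.range (fF D) = fmk D '' Set.range (FreeAlgebra.ι 𝕂) := by
    rw [← Set.range_comp]; rfl
  rw [h, ← AlgHom.map_adjoin, FreeAlgebra.adjoin_range_ι, Algebra.map_top, AlgHom.range_eq_top]
  exact fmk_surj D

/-- left induction -/
lemma adj_ind {R : Type*} [Ring R] [Algebra 𝕂 R] {s : I → R} {P : R → Prop}
    (h1 : P 1) (ha : ∀ x y, P x → P y → P (x + y)) (hs : ∀ (c : 𝕂) x, P x → P (c • x))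
    (hF : ∀ i x, P x → P (s i * x)) (x : R) (hx : x ∈ Algebra.adjoin 𝕂 (Set.range s)) : P x := by
  have key : ∀ y, P y → P (x * y) := by
    induction hx using Algebra.adjoin_induction with
    | mem x hx => obtain ⟨i, rfl⟩ := hx; exact hF i
    | algebraMap r => intro y hy; rw [← Algebra.smul_def]; exact hs r y hy
    | add a b _ _ iha ihb => intro y hy; rw [add_mul]; exact ha _ _ (iha y hy) (ihb y hy)
    | mul a b _ _ iha ihb => intro y hy; rw [mul_assoc]; exact iha _ (ihb y hy)
  simpa using key 1 h1

lemma fm_ind {P : Fm D → Prop}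
    (h1 : P 1) (ha : ∀ x y, P x → P y → P (x + y)) (hs : ∀ (c : 𝕂) x, P x → P (c • x))
    (hF : ∀ i x, P x → P (fF D i * x)) (x : Fm D) : P x :=
  adj_ind h1 ha hs hF x (by rw [fm_adjoin]; trivial)

lemma fm_lin_ext {M : Type*} [AddCommGroup M] [Module 𝕂 M] {f g : Fm D →ₗ[𝕂] M} (h1 : f 1 = g 1)
    (hF : ∀ i x, f x = g x → f (fF D i * x) = g (fF D i * x)) : f = g := by
  ext x
  refine fm_ind D (P := fun x => f x = g x) h1 ?_ ?_ hF x
  · intro x y hx hy; rw [map_add, map_add, hx, hy]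
  · intro c x hx; rw [map_smul, map_smul, hx]

lemma fm_hom_ext {S : Type*} [Ring S] [Algebra 𝕂 S] {f g : Fm D →ₐ[𝕂] S}
    (hF : ∀ i, f (fF D i) = g (fF D i)) : f = g := by
  have : f.toLinearMap = g.toLinearMap := by
    apply fm_lin_ext
    · simp
    · intro i x hx
      simp only [AlgHom.toLinearMap_apply, map_mul] at hx ⊢
      rw [hx, hF]
  ext x; exact LinearMap.congr_fun this x

section generic
variable {k : Type*} [Field k] {R : Type*} [Ring R] [Algebra k R]
lemma gen_r1 (q t : k) (hq : q ≠ 0) (ht : t = q ∨ t = q⁻¹) (A B x y : R)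
   (h : A ^ 2 * B + B * A ^ 2 = (q + q⁻¹) • (A * B * A)) :
   A * (A * (B * y) + t^(-1:ℤ) • (B * x)) + t ^ (2:ℤ) • (A * (t^(-1:ℤ) • (B * x))) + (B * (A * (A * y + x) + t ^ (2:ℤ) • (A * x)))
     = (q + q⁻¹) • (A * (B * (A * y + x)) + t^(-1:ℤ) • (B * (t ^ (2:ℤ) • (A * x)))) := by
  have h' : ∀ z, A * (A * (B * z)) + B * (A * (A * z)) = (q + q⁻¹) • (A * (B * (A * z))) := by
    intro z
    have := congrArg (· * z) h
    simpa only [add_mul, mul_assoc, sq, smul_mul_assoc] using this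
  have := h' y
  simp only [mul_add, mul_smul_comm, smul_add, smul_smul]
  rw [← this]
  rcases ht with rfl | rfl
  · match_scalars <;> field_simp <;> ring
  · match_scalars <;> field_simp <;> ring
lemma gen_r2 (q t : k) (hq : q ≠ 0) (ht : t = q ∨ t = q⁻¹) (A B x y : R)
   (h : A ^ 2 * B + B * A ^ 2 = (q + q⁻¹) • (A * B * A)) :
   A * (A * (B * y + x)) + (B * (A * (A * y)) + t^(-1:ℤ) • (A * (t^(-1:ℤ) • (A * x))))
     = (q + q⁻¹) • (A * (B * (A * y) + t^(-1:ℤ) • (A * x))) := by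
  have h' : ∀ z, A * (A * (B * z)) + B * (A * (A * z)) = (q + q⁻¹) • (A * (B * (A * z))) := by
    intro z
    have := congrArg (· * z) h
    simpa only [add_mul, mul_assoc, sq, smul_mul_assoc] using this
  have := h' y
  simp only [mul_add, mul_smul_comm, smul_add, smul_smul]
  rw [← this]
  rcases ht with rfl | rfl
  · match_scalars <;> field_simp <;> ring
  · match_scalars <;> field_simp <;> ring
end generic

/-- `κ i t`: F_j ↦ t^{a_ij} F_j -/
def kap (i : I) (t : 𝕂) : Fm D →ₐ[𝕂] Fm D :=
  liftF D (fun j => t ^ cartan D i j • fF D j) ⟨by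
    intro a b h
    have := fserre D h
    simp only [smul_mul_assoc, mul_smul_comm, smul_smul, sq, mul_assoc] at this ⊢
    have e : t ^ cartan D i b * (t ^ cartan D i a * t ^ cartan D i a) = t ^ cartan D i a * (t ^ cartan D i a * t ^ cartan D i b) := by ring
    rw [e, ← smul_add, this, smul_smul]
    congr 1; ring, by
    intro a b h h'
    simp only [smul_mul_assoc, mul_smul_comm, smul_smul]
    rw [ffar D h h', mul_comm]⟩

lemma kap_F (i : I) (t : 𝕂) (j : I) : kap D i t (fF D j) = t ^ cartan D i j • fF D j := liftF_F D _ _ j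
lemma kap_Fm (i : I) (t : 𝕂) (j : I) (x : Fm D) : kap D i t (fF D j * x) = t ^ cartan D i j • (fF D j * kap D i t x) := by
  rw [map_mul, kap_F, smul_mul_assoc]
lemma kap_inv (i : I) {t : 𝕂} (ht : t ≠ 0) (x : Fm D) : kap D i t (kap D i t⁻¹ x) = x := by
  have : (kap D i t).comp (kap D i t⁻¹) = AlgHom.id 𝕂 _ := by
    apply fm_hom_ext
    intro j
    simp only [AlgHom.comp_apply, kap_F, map_smul, smul_smul, AlgHom.id_apply]
    rw [← mul_zpow, inv_mul_cancel₀ ht, one_zpow, one_smul]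
  exact DFunLike.congr_fun this x
lemma kap_inv' (i : I) {t : 𝕂} (ht : t ≠ 0) (x : Fm D) : kap D i t⁻¹ (kap D i t x) = x := by
  have := kap_inv D i (inv_ne_zero ht) x
  rwa [inv_inv] at this
lemma kap_comm (i j : I) (t s : 𝕂) (x : Fm D) : kap D i t (kap D j s x) = kap D j s (kap D i t x) := by
  have : (kap D i t).comp (kap D j s) = (kap D j s).comp (kap D i t) := by
    apply fm_hom_ext
    intro l
    simp only [AlgHom.comp_apply, kap_F, map_smul, smul_smul]
    rw [mul_comm]
  exact DFunLike.congr_fun this x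

/-- auxiliary operator on pairs -/
def rop (i : I) (t : 𝕂) (j : I) : Module.End 𝕂 (Fm D × Fm D) where
  toFun p := (fF D j * p.1, fF D j * p.2 + if i = j then kap D i t p.1 else 0)
  map_add' p r := by
    by_cases h : i = j
    · simp only [h, if_true, Prod.fst_add, Prod.snd_add, mul_add, map_add, Prod.mk_add_mk, Prod.mk.injEq, true_and]; abel
    · simp [h, mul_add]
  map_smul' c p := by
    by_cases h : i = j
    · simp [h]
    · simp [h]

lemma rop_ok (i : I) (t : 𝕂) (ht : t = qq ∨ t = qq⁻¹) : SerreOK D (rop D i t) := by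
  constructor
  · intro a b h
    have hn := adj_ne D h
    have hs := fserre D h
    have h' : ∀ z, fF D a * (fF D a * (fF D b * z)) + fF D b * (fF D a * (fF D a * z)) =
        (qq + qq⁻¹) • (fF D a * (fF D b * (fF D a * z))) := by
      intro z
      have := congrArg (· * z) hs
      simpa only [add_mul, mul_assoc, sq, smul_mul_assoc] using this
    apply LinearMap.ext
    rintro ⟨x, y⟩
    apply Prod.ext
    · simpa [rop, sq] using h' x
    · by_cases ia : i = a
      · subst ia
        have := gen_r1 qq t qq_ne ht (fF D i) (fF D b) (kap D i t x) y hs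
        simp only [rop, sq, hn, hn.symm, if_true, if_false, Module.End.mul_apply, LinearMap.coe_mk, AddHom.coe_mk,
          LinearMap.add_apply, LinearMap.smul_apply, Prod.snd_add, Prod.smul_snd, add_zero, kap_Fm, cartan_self, cartan_adj D h]
        exact this
      by_cases ib : i = b
      · subst ib
        have := gen_r2 qq t qq_ne ht (fF D a) (fF D i) (kap D i t x) y hs
        simp only [rop, sq, hn, hn.symm, if_true, if_false, Module.End.mul_apply, LinearMap.coe_mk, AddHom.coe_mk,
          LinearMap.add_apply, LinearMap.smul_apply, Prod.snd_add, Prod.smul_snd, add_zero, kap_Fm, cartan_self, cartan_adj D (adj_symm h)]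
        exact this
      · simpa [rop, sq, ia, ib] using h' y
  · intro a b hn h
    have h' : ∀ z, fF D a * (fF D b * z) = fF D b * (fF D a * z) := by
      intro z; rw [← mul_assoc, ffar D hn h, mul_assoc]
    apply LinearMap.ext
    rintro ⟨x, y⟩
    apply Prod.ext
    · simpa [rop, sq] using h' x
    · by_cases ia : i = a
      · subst ia
        simp [rop, hn, hn.symm, kap_Fm, cartan_far D hn h, mul_add, h']
      by_cases ib : i = b
      · subst ib
        simp [rop, hn, hn.symm, kap_Fm, cartan_far D hn.symm (far_symm h), mul_add, h']
      · simpa [rop, sq, ia, ib] using h' y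

/-- twisted derivation -/
def rr (i : I) (t : 𝕂) (ht : t = qq ∨ t = qq⁻¹) : Fm D →ₗ[𝕂] Fm D :=
  (LinearMap.snd 𝕂 _ _).comp ((LinearMap.applyₗ ((1 : Fm D), (0 : Fm D))).comp (liftF D _ (rop_ok D i t ht)).toLinearMap)

lemma rr_aux (i : I) (t : 𝕂) (ht : t = qq ∨ t = qq⁻¹) (x : Fm D) :
    liftF D _ (rop_ok D i t ht) x (1, 0) = (x, rr D i t ht x) := by
  apply Prod.ext
  · refine fm_ind D (P := fun x => (liftF D _ (rop_ok D i t ht) x (1, 0)).1 = x) ?_ ?_ ?_ ?_ x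
    · simp
    · intro x y hx hy; rw [map_add, LinearMap.add_apply, Prod.fst_add, hx, hy]
    · intro c x hx; rw [map_smul, LinearMap.smul_apply, Prod.smul_fst, hx]
    · intro j x hx; rw [map_mul, liftF_F, Module.End.mul_apply]
      change fF D j * _ = _
      rw [hx]
  · rfl
lemma rr_one (i : I) (t : 𝕂) (ht : t = qq ∨ t = qq⁻¹) : rr D i t ht 1 = 0 := by
  have := rr_aux D i t ht 1
  rw [map_one] at this
  exact (congrArg Prod.snd this).symm
lemma rr_F (i : I) (t : 𝕂) (ht : t = qq ∨ t = qq⁻¹) (j : I) (x : Fm D) :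
    rr D i t ht (fF D j * x) = fF D j * rr D i t ht x + if i = j then kap D i t x else 0 := by
  have := rr_aux D i t ht (fF D j * x)
  rw [map_mul, liftF_F, Module.End.mul_apply, rr_aux] at this
  exact (congrArg Prod.snd this).symm

lemma rr_kap (i j : I) (t : 𝕂) (ht : t = qq ∨ t = qq⁻¹) (s : 𝕂) (x : Fm D) :
    rr D j t ht (kap D i s x) = s ^ cartan D i j • kap D i s (rr D j t ht x) := by
  refine fm_ind D (P := fun x => rr D j t ht (kap D i s x) = s ^ cartan D i j • kap D i s (rr D j t ht x)) ?_ ?_ ?_ ?_ x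
  · rw [map_one, rr_one, map_zero, smul_zero]
  · intro x y hx hy; simp only [map_add, hx, hy, smul_add]
  · intro c x hx; simp only [map_smul, hx]; rw [smul_comm]
  · intro l x hx
    rw [kap_Fm, map_smul, rr_F, rr_F, hx, map_add, kap_Fm, smul_add, smul_add, mul_smul_comm, smul_comm]
    congr 1
    by_cases h : j = l
    · subst h; simp only [if_true]; rw [kap_comm]
    · simp [h]
end
end CB
end

noncomputable section
open scoped BigOperators
set_option linter.all false
namespace CB
section generic
variable {k : Type*} [Field k] {R : Type*} [Ring R] [Algebra k R]
lemma gen_SE1 (q d : k) (hq : q ≠ 0) (e e' f K K' : R) (ef : e * f = f * e + d • (K - K')) (e'f : e' * f = f * e')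
   (Ke : K * e = q ^ 2 • (e * K)) (Ke' : K * e' = q⁻¹ • (e' * K)) (ke : K' * e = (q ^ 2)⁻¹ • (e * K'))
   (ke' : K' * e' = q • (e' * K')) :
   (e ^ 2 * e' + e' * e ^ 2 - (q + q⁻¹) • (e * e' * e)) * f = f * (e ^ 2 * e' + e' * e ^ 2 - (q + q⁻¹) • (e * e' * e)) := by
  simp only [sq e, mul_add, add_mul, mul_sub, sub_mul, smul_mul_assoc, mul_smul_comm, mul_assoc,
    ef, asc ef, e'f, asc e'f, Ke, asc Ke, Ke', asc Ke', ke, asc ke, ke', asc ke', smul_add, smul_sub]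
  match_scalars <;> field_simp <;> ring
lemma gen_SE2 (q d : k) (hq : q ≠ 0) (e e' f K K' : R) (e'f : e' * f = f * e' + d • (K - K')) (ef : e * f = f * e)
   (Ke : K * e = q⁻¹ • (e * K)) (ke : K' * e = q • (e * K')) :
   (e ^ 2 * e' + e' * e ^ 2 - (q + q⁻¹) • (e * e' * e)) * f = f * (e ^ 2 * e' + e' * e ^ 2 - (q + q⁻¹) • (e * e' * e)) := by
  simp only [sq e, mul_add, add_mul, mul_sub, sub_mul, smul_mul_assoc, mul_smul_comm, mul_assoc,
    ef, asc ef, e'f, asc e'f, Ke, asc Ke, ke, asc ke, smul_add, smul_sub]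
  match_scalars <;> field_simp <;> ring
lemma gen_SE3 (c : k) (e e' f : R) (e'f : e' * f = f * e') (ef : e * f = f * e) :
   (e ^ 2 * e' + e' * e ^ 2 - c • (e * e' * e)) * f = f * (e ^ 2 * e' + e' * e ^ 2 - c • (e * e' * e)) := by
  simp only [sq e, mul_add, add_mul, mul_sub, sub_mul, smul_mul_assoc, mul_smul_comm, mul_assoc,
    ef, asc ef, e'f, asc e'f]
lemma gen_EE1 (d : k) (e e' f K K' : R) (ef : e * f = f * e + d • (K - K')) (e'f : e' * f = f * e')
   (Ke : K * e' = e' * K) (ke : K' * e' = e' * K') :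
   (e * e' - e' * e) * f = f * (e * e' - e' * e) := by
  simp only [mul_add, add_mul, mul_sub, sub_mul, smul_mul_assoc, mul_smul_comm, mul_assoc,
    ef, asc ef, e'f, asc e'f, Ke, asc Ke, ke, asc ke]
  match_scalars <;> ring
lemma gen_EE3 (e e' f : R) (e'f : e' * f = f * e') (ef : e * f = f * e) :
   (e * e' - e' * e) * f = f * (e * e' - e' * e) := by
  simp only [mul_sub, sub_mul, mul_assoc, ef, asc ef, e'f, asc e'f]
end generic
section
variable {I : Type} [Fintype I] [DecidableEq I] (D : ADEData I)

abbrev EndF (D : ADEData I) := Module.End 𝕂 (Fm D)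

def rp (i : I) : Fm D →ₗ[𝕂] Fm D := rr D i qq⁻¹ (Or.inr rfl)
def rm (i : I) : Fm D →ₗ[𝕂] Fm D := rr D i qq (Or.inl rfl)

def vF (j : I) : EndF D := LinearMap.mulLeft 𝕂 (fF D j)
def vK (c : I → 𝕂) (i : I) : EndF D := c i • (kap D i qq⁻¹).toLinearMap
def vk (c : I → 𝕂) (i : I) : EndF D := (c i)⁻¹ • (kap D i qq).toLinearMap
def vE (c : I → 𝕂) (i : I) : EndF D := (qq - qq⁻¹)⁻¹ • (c i • rp D i - (c i)⁻¹ • rm D i)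

lemma vF_ap (j : I) (x : Fm D) : vF D j x = fF D j * x := rfl
lemma vK_ap (c : I → 𝕂) (j : I) (x : Fm D) : vK D c j x = c j • kap D j qq⁻¹ x := rfl
lemma vk_ap (c : I → 𝕂) (j : I) (x : Fm D) : vk D c j x = (c j)⁻¹ • kap D j qq x := rfl
lemma vE_ap (c : I → 𝕂) (j : I) (x : Fm D) : vE D c j x = (qq - qq⁻¹)⁻¹ • (c j • rp D j x - (c j)⁻¹ • rm D j x) := rfl

variable (c : I → 𝕂) (hc : ∀ i, c i ≠ 0)
section
variable {c}

lemma vKk (hc : ∀ i, c i ≠ 0) (i : I) : vK D c i * vk D c i = 1 := by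
  apply LinearMap.ext; intro x
  rw [Module.End.mul_apply, vK_ap, vk_ap, map_smul, smul_smul, mul_inv_cancel₀ (hc i), one_smul, kap_inv' D i qq_ne]; rfl
lemma vkK (hc : ∀ i, c i ≠ 0) (i : I) : vk D c i * vK D c i = 1 := by
  apply LinearMap.ext; intro x
  rw [Module.End.mul_apply, vK_ap, vk_ap, map_smul, smul_smul, inv_mul_cancel₀ (hc i), one_smul, kap_inv D i qq_ne]; rfl
lemma vKK (i j : I) : vK D c i * vK D c j = vK D c j * vK D c i := by
  apply LinearMap.ext; intro x
  simp only [Module.End.mul_apply, vK_ap, map_smul, smul_smul]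
  rw [kap_comm, mul_comm]
lemma vKF (i j : I) : vK D c i * vF D j = qq ^ (- cartan D i j) • (vF D j * vK D c i) := by
  apply LinearMap.ext; intro x
  simp only [Module.End.mul_apply, vK_ap, vF_ap, LinearMap.smul_apply, mul_smul_comm]
  rw [kap_Fm, smul_comm, zpow_neg, inv_zpow]
lemma kap_rr (i j : I) (t : 𝕂) (ht : t = qq ∨ t = qq⁻¹) {s : 𝕂} (hs : s ≠ 0) (x : Fm D) :
    kap D i s (rr D j t ht x) = s ^ (-cartan D i j) • rr D j t ht (kap D i s x) := by
  rw [rr_kap, smul_smul, ← zpow_add₀ hs, neg_add_cancel, zpow_zero, one_smul]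
lemma vKE (i j : I) : vK D c i * vE D c j = qq ^ (cartan D i j) • (vE D c j * vK D c i) := by
  apply LinearMap.ext; intro x
  simp only [Module.End.mul_apply, vK_ap, vE_ap, LinearMap.smul_apply, map_smul, map_sub, rp, rm, kap_rr D i j _ _ (inv_ne_zero qq_ne),
   smul_smul, smul_sub]
  rw [zpow_neg, inv_zpow, inv_inv]
  congr 2 <;> ring
lemma vkE (i j : I) : vk D c i * vE D c j = qq ^ (-cartan D i j) • (vE D c j * vk D c i) := by
  apply LinearMap.ext; intro x
  simp only [Module.End.mul_apply, vk_ap, vE_ap, LinearMap.smul_apply, map_smul, map_sub, rp, rm, kap_rr D i j _ _ (qq_ne),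
   smul_smul, smul_sub]
  congr 2 <;> ring
lemma vEF_ne {i j : I} (h : i ≠ j) : vE D c i * vF D j = vF D j * vE D c i := by
  apply LinearMap.ext; intro x
  simp only [Module.End.mul_apply, vF_ap, vE_ap, rp, rm, rr_F, h, if_false, add_zero, mul_smul_comm, mul_sub]
lemma vEF (i : I) : vE D c i * vF D i = vF D i * vE D c i + (qq - qq⁻¹)⁻¹ • (vK D c i - vk D c i) := by
  apply LinearMap.ext; intro x
  simp only [Module.End.mul_apply, vF_ap, vE_ap, vK_ap, vk_ap, rp, rm, rr_F, if_true, mul_smul_comm, mul_sub, LinearMap.smul_apply,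
    LinearMap.sub_apply, LinearMap.add_apply, smul_add, smul_sub]
  abel
lemma vE_one (i : I) : vE D c i 1 = 0 := by
  rw [vE_ap, rp, rm, rr_one, rr_one]; simp

lemma comm_zero (S : EndF D) (h1 : S 1 = 0) (h : ∀ j, S * vF D j = vF D j * S) : S = 0 := by
  apply fm_lin_ext D h1
  intro j x hx
  have := LinearMap.congr_fun (h j) x
  simp only [Module.End.mul_apply, vF_ap] at this
  rw [this, hx]; simp

lemma vKEs (i : I) : vK D c i * vE D c i = qq ^ 2 • (vE D c i * vK D c i) := by
  have := vKE D (c := c) i i; rw [cartan_self, zpow_ofNat] at this; exact this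
lemma vkEs (i : I) : vk D c i * vE D c i = (qq ^ 2)⁻¹ • (vE D c i * vk D c i) := by
  have := vkE D (c := c) i i; rw [cartan_self, zpow_neg, zpow_ofNat] at this; exact this
lemma vKEa {i j : I} (h : D.adj i j = true) : vK D c i * vE D c j = qq⁻¹ • (vE D c j * vK D c i) := by
  have := vKE D (c := c) i j; rw [cartan_adj D h, zpow_neg, zpow_one] at this; exact this
lemma vkEa {i j : I} (h : D.adj i j = true) : vk D c i * vE D c j = qq • (vE D c j * vk D c i) := by
  have := vkE D (c := c) i j; rw [cartan_adj D h, neg_neg, zpow_one] at this; exact this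
lemma vKEf {i j : I} (hn : i ≠ j) (h : D.adj i j = false) : vK D c i * vE D c j = (vE D c j * vK D c i) := by
  have := vKE D (c := c) i j; rw [cartan_far D hn h, zpow_zero, one_smul] at this; exact this
lemma vkEf {i j : I} (hn : i ≠ j) (h : D.adj i j = false) : vk D c i * vE D c j = (vE D c j * vk D c i) := by
  have := vkE D (c := c) i j; rw [cartan_far D hn h, neg_zero, zpow_zero, one_smul] at this; exact this

lemma vserreE {i j : I} (h : D.adj i j = true) :
    vE D c i ^ 2 * vE D c j + vE D c j * vE D c i ^ 2 = (qq + qq⁻¹) • (vE D c i * vE D c j * vE D c i) := by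
  rw [← sub_eq_zero]
  apply comm_zero
  · have e1 := vE_one D (c := c) i
    have e2 := vE_one D (c := c) j
    simp only [sq, LinearMap.sub_apply, LinearMap.add_apply, LinearMap.smul_apply, Module.End.mul_apply, e1, e2, map_zero,
      smul_zero, sub_zero, add_zero]
  · intro l
    have hn := adj_ne D h
    by_cases il : i = l
    · rw [← il]
      exact gen_SE1 qq (qq - qq⁻¹)⁻¹ qq_ne (vE D c i) (vE D c j) (vF D i) (vK D c i) (vk D c i) (vEF D i) (vEF_ne D hn.symm)
        (vKEs D i) (vKEa D h) (vkEs D i) (vkEa D h)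
    by_cases jl : j = l
    · rw [← jl]
      exact gen_SE2 qq (qq - qq⁻¹)⁻¹ qq_ne (vE D c i) (vE D c j) (vF D j) (vK D c j) (vk D c j) (vEF D j) (vEF_ne D hn)
        (vKEa D (adj_symm h)) (vkEa D (adj_symm h))
    exact gen_SE3 (qq + qq⁻¹) (vE D c i) (vE D c j) (vF D l) (vEF_ne D jl) (vEF_ne D il)
lemma vEE {i j : I} (hn : i ≠ j) (h : D.adj i j = false) :
    vE D c i * vE D c j = vE D c j * vE D c i := by
  rw [← sub_eq_zero]
  apply comm_zero
  · have e1 := vE_one D (c := c) i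
    have e2 := vE_one D (c := c) j
    simp only [LinearMap.sub_apply, Module.End.mul_apply, e1, e2, map_zero, sub_zero]
  · intro l
    by_cases il : i = l
    · rw [← il]
      exact gen_EE1 (qq - qq⁻¹)⁻¹ (vE D c i) (vE D c j) (vF D i) (vK D c i) (vk D c i) (vEF D i) (vEF_ne D hn.symm) 
        (vKEf D hn h) (vkEf D hn h)
    by_cases jl : j = l
    · rw [← jl]
      have := gen_EE1 (qq - qq⁻¹)⁻¹ (vE D c j) (vE D c i) (vF D j) (vK D c j) (vk D c j) (vEF D j) (vEF_ne D hn) 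
        (vKEf D hn.symm (far_symm h)) (vkEf D hn.symm (far_symm h))
      rw [← neg_inj, ← neg_mul, ← mul_neg, neg_sub]
      exact this
    exact gen_EE3 (vE D c i) (vE D c j) (vF D l) (vEF_ne D jl) (vEF_ne D il)

lemma vF_ok : SerreOK D (vF D) := by
  constructor
  · intro i j h
    apply LinearMap.ext; intro x
    have := congrArg (· * x) (fserre D h)
    simp only [add_mul, mul_assoc, sq, smul_mul_assoc] at this
    simp only [sq]
    exact this
  · intro i j hn h
    apply LinearMap.ext; intro x
    have := congrArg (· * x) (ffar D hn h)
    simp only [mul_assoc] at this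
    exact this

lemma unmv {R : Type*} [Ring R] [Algebra 𝕂 R] {K k x : R} {c : 𝕂} (kK : K * k = 1) (h : K * x = c • (x * K)) :
    K * x * k = c • x := by
  rw [h, smul_mul_assoc, mul_assoc, kK, mul_one]
end

def vgen (c : I → 𝕂) : Gen I → EndF D
  | Gen.E i => vE D c i
  | Gen.F i => vF D i
  | Gen.K i => vK D c i
  | Gen.Kinv i => vk D c i

lemma vgen_ok (hc : ∀ i, c i ≠ 0) (x y : FA I) (h : QRel D x y) : FreeAlgebra.lift 𝕂 (vgen D c) x = FreeAlgebra.lift 𝕂 (vgen D c) y := by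
  have hE : ∀ i, FreeAlgebra.lift 𝕂 (vgen D c) (gE i) = vE D c i := fun i => FreeAlgebra.lift_ι_apply _ _
  have hF : ∀ i, FreeAlgebra.lift 𝕂 (vgen D c) (gF i) = vF D i := fun i => FreeAlgebra.lift_ι_apply _ _
  have hK : ∀ i, FreeAlgebra.lift 𝕂 (vgen D c) (gK i) = vK D c i := fun i => FreeAlgebra.lift_ι_apply _ _
  have hk : ∀ i, FreeAlgebra.lift 𝕂 (vgen D c) (gKinv i) = vk D c i := fun i => FreeAlgebra.lift_ι_apply _ _
  cases h <;> simp only [map_mul, map_add, map_sub, map_smul, map_pow, map_one, map_zero, hE, hF, hK, hk]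
  case KKinv i => exact vKk D hc i
  case KinvK i => exact vkK D hc i
  case KcommK i j => exact vKK D i j
  case KEself i => 
    have := unmv (vKk D hc i) (vKE D (c := c) i i); rw [cartan_self] at this; exact this
  case KFself i =>
    have := unmv (vKk D hc i) (vKF D (c := c) i i); rw [cartan_self, zpow_neg] at this; exact this
  case EFdiff i j h => rw [vEF_ne D h, sub_self]
  case EFself i => rw [vEF D i, add_sub_cancel_left]
  case serreE i j h => exact vserreE D h
  case serreF i j h => exact (vF_ok D).1 i j h
  case KEadj i j h => 
    have := unmv (vKk D hc i) (vKE D (c := c) i j); rwa [cartan_adj D h, zpow_neg, zpow_one] at this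
  case KFadj i j h =>
    have := unmv (vKk D hc i) (vKF D (c := c) i j); rwa [cartan_adj D h, neg_neg, zpow_one] at this
  case EEfar i j h h' => exact vEE D h h'
  case FFfar i j h h' => exact (vF_ok D).2 i j h h'
  case KEfar i j h h' => 
    have := unmv (vKk D hc i) (vKE D (c := c) i j); rwa [cartan_far D h h', zpow_zero, one_smul] at this
  case KFfar i j h h' => 
    have := unmv (vKk D hc i) (vKF D (c := c) i j); rwa [cartan_far D h h', neg_zero, zpow_zero, one_smul] at this

def verma (hc : ∀ i, c i ≠ 0) : Uq D →ₐ[𝕂] EndF D :=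
  RingQuot.liftAlgHom 𝕂 ⟨FreeAlgebra.lift 𝕂 (vgen D c), fun {x y} h => vgen_ok D c hc x y h⟩

lemma verma_E (i : I) : verma D c hc (EE D i) = vE D c i := by
  rw [verma, EE, RingQuot.liftAlgHom_mkAlgHom_apply]; exact FreeAlgebra.lift_ι_apply _ _
lemma verma_F (i : I) : verma D c hc (FF D i) = vF D i := by
  rw [verma, FF, RingQuot.liftAlgHom_mkAlgHom_apply]; exact FreeAlgebra.lift_ι_apply _ _
lemma verma_K (i : I) : verma D c hc (KK D i) = vK D c i := by
  rw [verma, KK, RingQuot.liftAlgHom_mkAlgHom_apply]; exact FreeAlgebra.lift_ι_apply _ _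
lemma verma_k (i : I) : verma D c hc (KKinv D i) = vk D c i := by
  rw [verma, KKinv, RingQuot.liftAlgHom_mkAlgHom_apply]; exact FreeAlgebra.lift_ι_apply _ _

def psi : Fm D →ₐ[𝕂] Uq D := liftF D (FF D) ⟨fun i j h => serreF D h, fun i j h h' => FFf D h h'⟩
lemma psi_F (i : I) : psi D (fF D i) = FF D i := liftF_F D _ _ i

lemma verma_psi' (x : Fm D) : verma D c hc (psi D x) = LinearMap.mulLeft 𝕂 x := by
  have : (verma D c hc).comp (psi D) = Algebra.lmul 𝕂 (Fm D) := by
    apply fm_hom_ext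
    intro i
    rw [AlgHom.comp_apply, psi_F, verma_F]; rfl
  exact DFunLike.congr_fun this x
lemma verma_psi (x y : Fm D) : verma D c hc (psi D x) y = x * y := by
  rw [verma_psi']; rfl
lemma psi_inj : Function.Injective (psi D) := by
  intro x y h
  have := congrArg (fun u => verma D (fun _ => 1) (fun _ => one_ne_zero) u 1) h
  simpa [verma_psi] using this
lemma psi_mem (x : Fm D) : psi D x ∈ Uminus D := by
  refine fm_ind D (P := fun x => psi D x ∈ Uminus D) ?_ ?_ ?_ ?_ x
  · rw [map_one]; exact one_mem _
  · intro x y hx hy; rw [map_add]; exact add_mem hx hy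
  · intro c x hx; rw [map_smul]; exact (Uminus D).smul_mem hx c
  · intro i x hx; rw [map_mul, psi_F]; exact mul_mem (Algebra.subset_adjoin ⟨i, rfl⟩) hx
lemma psi_surj (y : Uq D) (hy : y ∈ Uminus D) : ∃ x, psi D x = y := by
  refine adj_ind (P := fun y => ∃ x, psi D x = y) ?_ ?_ ?_ ?_ y hy
  · exact ⟨1, map_one _⟩
  · rintro _ _ ⟨x, rfl⟩ ⟨y, rfl⟩; exact ⟨x + y, map_add _ _ _⟩
  · rintro c _ ⟨x, rfl⟩; exact ⟨c • x, map_smul _ _ _⟩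
  · rintro i _ ⟨x, rfl⟩; exact ⟨fF D i * x, by rw [map_mul, psi_F]⟩
end
end CB
end

noncomputable section
open scoped BigOperators
set_option linter.all false
namespace CB
section
variable {I : Type} [Fintype I] [DecidableEq I] (D : ADEData I)

def cm : I → 𝕂 := fun _ => qq⁻¹
lemma cm_ne (i : I) : cm i ≠ 0 := inv_ne_zero qq_ne

lemma kap_pow (i : I) (t : 𝕂) (m : ℕ) : kap D i t (fF D i ^ m) = t ^ (2 * (m : ℤ)) • fF D i ^ m := by
  rw [map_pow, kap_F, cartan_self, smul_pow, zpow_mul, zpow_natCast]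

lemma gen_sqq {k : Type*} [Field k] (q : k) (hq : q ≠ 0) (hd : q - q⁻¹ ≠ 0) (m : ℤ) :
    -(((q ^ m - q ^ (-m)) / (q - q⁻¹)) ^ 2) + (q - q⁻¹)⁻¹ * (q⁻¹ * (q⁻¹) ^ (2 * m) - (q⁻¹)⁻¹ * q ^ (2 * m)) =
    -(((q ^ (m + 1) - q ^ (-(m + 1))) / (q - q⁻¹)) ^ 2) := by
  have hm : q ^ m ≠ 0 := zpow_ne_zero _ hq
  have e : (q⁻¹) ^ (2 * m) = ((q ^ m) ^ 2)⁻¹ := by rw [inv_zpow, mul_comm, zpow_mul, zpow_ofNat]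
  have e2 : q ^ (2 * m) = (q ^ m) ^ 2 := by rw [mul_comm, zpow_mul, zpow_ofNat]
  rw [e, e2, neg_add, zpow_add₀ hq, zpow_add₀ hq, zpow_neg, zpow_neg, zpow_one]
  generalize q ^ m = u at *
  have hd2 : q ^ 2 - 1 ≠ 0 := by
    intro h; apply hd; field_simp; simpa using h
  field_simp
  ring

lemma vE_pow (i : I) (m : ℕ) : vE D cm i (fF D i ^ (m + 1)) = (-(qInt (m + 1)) ^ 2) • fF D i ^ m := by
  have key : ∀ m : ℕ, vE D cm i (fF D i ^ (m + 1)) = fF D i * vE D cm i (fF D i ^ m) + ((qq - qq⁻¹)⁻¹ * (qq⁻¹ * (qq⁻¹) ^ (2 * (m : ℤ)) - (qq⁻¹)⁻¹ * qq ^ (2 * (m : ℤ)))) • fF D i ^ m := by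
    intro m
    have := LinearMap.congr_fun (vEF D (c := cm) i) (fF D i ^ m)
    rw [LinearMap.add_apply, LinearMap.smul_apply, LinearMap.sub_apply] at this
    simp only [Module.End.mul_apply, vF_ap, ← pow_succ', vK_ap, vk_ap, kap_pow, smul_smul, ← sub_smul] at this
    exact this
  induction m with
  | zero =>
    rw [key, pow_zero, vE_one, mul_zero, zero_add]
    have := gen_sqq qq qq_ne qd_ne 0
    have e := qInt_eq 1
    congr 1
    rw [qInt_eq]
    simpa using this
  | succ m ih =>
    rw [key, ih, mul_smul_comm, ← pow_succ', ← add_smul]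
    congr 1
    rw [qInt_eq, qInt_eq]
    have := gen_sqq qq qq_ne qd_ne (m + 1)
    push_cast
    exact this

lemma kE_pow (i : I) (m : ℕ) : ∃ g : 𝕂, g ≠ 0 ∧ (vk D cm i * vE D cm i) (fF D i ^ (m + 1)) = g • fF D i ^ m := by
  rw [Module.End.mul_apply, vE_pow, map_smul, vk_ap, kap_pow, smul_smul, smul_smul]
  refine ⟨_, ?_, rfl⟩
  refine mul_ne_zero (mul_ne_zero ?_ (inv_ne_zero (cm_ne i))) (zpow_ne_zero _ qq_ne)
  exact neg_ne_zero.mpr (pow_ne_zero _ (qInt_ne (Nat.succ_ne_zero m)))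
lemma kE_one (i : I) : (vk D cm i * vE D cm i) 1 = 0 := by
  rw [Module.End.mul_apply, vE_one, map_zero]
lemma kE_gt (i : I) (m n : ℕ) (h : m < n) : ((vk D cm i * vE D cm i) ^ n) (fF D i ^ m) = 0 := by
  induction m generalizing n with
  | zero =>
    obtain ⟨n, rfl⟩ : ∃ k, n = k + 1 := ⟨n - 1, by omega⟩
    rw [pow_zero, pow_succ, Module.End.mul_apply, kE_one, map_zero]
  | succ m ih =>
    obtain ⟨n, rfl⟩ : ∃ k, n = k + 1 := ⟨n - 1, by omega⟩
    obtain ⟨g, _, hg⟩ := kE_pow D i m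
    rw [pow_succ, Module.End.mul_apply, hg, map_smul, ih n (by omega), smul_zero]
lemma kE_eq (i : I) (m : ℕ) : ∃ g : 𝕂, g ≠ 0 ∧ ((vk D cm i * vE D cm i) ^ m) (fF D i ^ m) = g • 1 := by
  induction m with
  | zero => exact ⟨1, one_ne_zero, by simp⟩
  | succ m ih =>
    obtain ⟨g, h0, hg⟩ := kE_pow D i m
    obtain ⟨g', h0', hg'⟩ := ih
    refine ⟨g * g', mul_ne_zero h0 h0', ?_⟩
    rw [pow_succ, Module.End.mul_apply, hg, map_smul, hg', smul_smul]

lemma Vind' (i : I) (y : ℕ → Fm D) (N : ℕ)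
    (h : ∑ n ∈ Finset.range N, psi D (y n) * (KKinv D i * EE D i) ^ n = 0) : ∀ n < N, y n = 0 := by
  intro m
  induction m using Nat.strong_induction_on with
  | _ m ih =>
    intro hm
    have h1 := congrArg (fun u => verma D cm cm_ne u (fF D i ^ m)) h
    simp only [map_sum, map_mul, map_pow, verma_k, verma_E, map_zero, LinearMap.zero_apply, LinearMap.sum_apply,
      Module.End.mul_apply _ _ (fF D i ^ m), verma_psi] at h1
    rw [Finset.sum_eq_single m] at h1
    · obtain ⟨g, h0, hg⟩ := kE_eq D i m
      rw [hg, mul_smul_comm, mul_one] at h1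
      exact (smul_eq_zero.mp h1).resolve_left h0
    · intro n hn hnm
      rcases lt_or_gt_of_ne hnm with h2 | h2
      · rw [ih n h2 (Finset.mem_range.mp hn), zero_mul]
      · rw [kE_gt D i m n h2, mul_zero]
    · intro h2; exact absurd (Finset.mem_range.mpr hm) h2

variable {D}
lemma Vind (i : I) (z : ℕ → Uq D) (hz : ∀ n, z n ∈ Uminus D) (N : ℕ)
    (h : ∑ n ∈ Finset.range N, z n * (KKinv D i * EE D i) ^ n = 0) : ∀ n < N, z n = 0 := by
  choose y hy using fun n => psi_surj D (z n) (hz n)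
  intro n hn
  rw [← hy n, Vind' D i y N (by simpa only [hy] using h) n hn, map_zero]

lemma li_pow {R ι : Type*} [Ring R] [Algebra 𝕂 R] (M : Submodule 𝕂 R) (x : ι → R) (hx : ∀ a, x a ∈ M) (hi : LinearIndependent 𝕂 x)
    (y : R) (hy : ∀ (z : ℕ → R) (hz : ∀ n, z n ∈ M) (N : ℕ), ∑ n ∈ Finset.range N, z n * y ^ n = 0 → ∀ n < N, z n = 0) :
    LinearIndependent 𝕂 (fun p : ι × ℕ => x p.1 * y ^ p.2) := by
  classical
  rw [linearIndependent_iff']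
  intro s g hg
  set s1 := s.image Prod.fst
  set N := (s.image Prod.snd).sup id + 1
  have hs : s ⊆ s1 ×ˢ Finset.range N := by
    intro p hp
    rw [Finset.mem_product]
    refine ⟨Finset.mem_image_of_mem _ hp, Finset.mem_range.mpr (Nat.lt_succ_of_le ?_)⟩
    exact Finset.le_sup (f := id) (Finset.mem_image_of_mem Prod.snd hp)
  set g' : ι × ℕ → 𝕂 := fun p => if p ∈ s then g p else 0
  have h1 : ∑ p ∈ s1 ×ˢ Finset.range N, g' p • (x p.1 * y ^ p.2) = 0 := by
    rw [← Finset.sum_subset hs, ← hg]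
    · refine Finset.sum_congr rfl fun p hp => ?_
      simp only [g', if_pos hp]
    · intro p _ hp
      simp only [g', if_neg hp, zero_smul]
  rw [Finset.sum_product_right] at h1
  have h2 : ∀ n < N, ∑ a ∈ s1, g' (a, n) • x a = 0 := by
    apply hy (fun n => ∑ a ∈ s1, g' (a, n) • x a) (fun n => Submodule.sum_mem _ fun a _ => M.smul_mem _ (hx a)) N
    rw [← h1]
    refine Finset.sum_congr rfl fun n _ => ?_
    rw [Finset.sum_mul]
    refine Finset.sum_congr rfl fun a _ => ?_
    rw [smul_mul_assoc]
  intro p hp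
  have hp' := Finset.mem_product.mp (hs hp)
  have := linearIndependent_iff'.mp hi s1 (fun a => g' (a, p.2)) (h2 p.2 (Finset.mem_range.mp hp'.2)) p.1 hp'.1
  simpa only [g', Prod.mk.eta, if_pos hp] using this

instance : Nontrivial (Fm D) := by
  refine ⟨⟨1, 0, fun h => ?_⟩⟩
  have := congrArg (liftF D (fun _ : I => (0 : 𝕂)) ⟨by intros; simp, by intros; simp⟩) h
  simp at this
lemma one_ne : (1 : Uq D) ≠ 0 := by
  intro h
  rw [← map_one (psi D), ← map_zero (psi D)] at h
  exact one_ne_zero (psi_inj D h)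

/-- PBW monomials indexed by coloured lists -/
def P (T : I → (Uq D ≃ₐ[𝕂] Uq D)) : List (I × ℕ) → Uq D
  | [] => 1
  | p :: l => dpg (FF D p.1) p.2 * T p.1 (P T l)

abbrev fs (l : List (I × ℕ)) : List I := l.map Prod.fst

variable {T : I → (Uq D ≃ₐ[𝕂] Uq D)}
lemma P_nil : P T [] = 1 := rfl
lemma P_cons (p : I × ℕ) (l) : P T (p :: l) = dpg (FF D p.1) p.2 * T p.1 (P T l) := rfl
lemma P_append (l m : List (I × ℕ)) : P T (l ++ m) = P T l * TT T (fs l) (P T m) := by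
  induction l with
  | nil => simp [P_nil, TT_nil]
  | cons p l ih => rw [List.cons_append, P_cons, ih, P_cons, map_mul, mul_assoc]; rfl
lemma P_single (p : I × ℕ) : P T [p] = dpg (FF D p.1) p.2 := by rw [P_cons, P_nil, map_one, mul_one]
lemma P_snoc (l : List (I × ℕ)) (p : I × ℕ) : P T (l ++ [p]) = P T l * dpg (TT T (fs l) (FF D p.1)) p.2 := by
  rw [P_append, P_single, map_dpg]
def zer (u : List I) : List (I × ℕ) := u.map fun i => (i, 0)
lemma fs_zer (u : List I) : fs (zer u) = u := by
  simp only [zer, fs, List.map_map]; exact List.map_id u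
lemma P_zer (u : List I) : P T (zer u) = 1 := by
  induction u with
  | nil => rfl
  | cons i u ih => 
    change dpg (FF D i) 0 * T i (P T (zer u)) = 1
    rw [ih, map_one, dpg_zero, mul_one]
lemma TT_P (u : List I) (l : List (I × ℕ)) : TT T u (P T l) = P T (zer u ++ l) := by
  rw [P_append, P_zer, fs_zer, one_mul]
lemma P_zer_right (u : List I) (l : List (I × ℕ)) : P T (l ++ zer u) = P T l := by
  rw [P_append, P_zer, map_one, mul_one]
lemma P_mem_LA (l : List (I × ℕ)) : P T l ∈ LA T (fs l) := by
  induction l with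
  | nil => exact Submodule.subset_span rfl
  | cons p l ih => exact Submodule.mul_mem_mul (dpg_mem _ _) ⟨_, ih, rfl⟩
lemma P_mem (hT : IsLusztigAuts D T) (l : List (I × ℕ)) (h : IsReducedWord D (fs l)) : P T l ∈ Uminus D :=
  UA_le_Uminus (LA_le hT _ h (P_mem_LA l))

/-- fibre -/
abbrev Fib (v : List I) := {l : List (I × ℕ) // fs l = v}

lemma fib_snoc {v : List I} {j : I} (l : Fib (v ++ [j])) : ∃ (m : Fib v) (n : ℕ), l.1 = m.1 ++ [(j, n)] := by
  obtain ⟨l, hl⟩ := l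
  obtain ⟨l1, l2, h1, h2, h3⟩ := List.map_eq_append_iff.mp hl
  obtain ⟨⟨j', n⟩, rfl, h4⟩ := List.map_eq_singleton_iff.mp h3
  simp at h4
  subst h4
  exact ⟨⟨l1, h2⟩, n, h1⟩

def fibE (v : List I) (j : I) : Fib v × ℕ ≃ Fib (v ++ [j]) := Equiv.ofBijective
  (fun p => ⟨p.1.1 ++ [(j, p.2)], by simp [fs, ← p.1.2]⟩) ⟨by
    rintro ⟨⟨a, ha⟩, n⟩ ⟨⟨b, hb⟩, m⟩ h
    simp only [Subtype.mk.injEq] at h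
    have := List.append_inj' h (by simp)
    simp at this
    simp [this.1, this.2], by
    intro l
    obtain ⟨m, n, h⟩ := fib_snoc l
    exact ⟨(m, n), Subtype.ext h.symm⟩⟩
lemma fibE_ap (v : List I) (j : I) (p) : (fibE v j p).1 = p.1.1 ++ [(j, p.2)] := rfl

lemma gen_neg {R : Type*} [Ring R] [Algebra 𝕂 R] (c : 𝕂) (a b : R) (n : ℕ) :
    (c * (-1) ^ n) • (a * b ^ n) = a * (c • (-b) ^ n) := by
  rw [mul_smul_comm, ← smul_smul]
  congr 1
  rcases Nat.even_or_odd n with hn | hn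
  · simp only [hn.neg_pow, one_pow, one_smul]
  · simp only [hn.neg_pow, one_pow, one_smul, mul_neg, neg_smul]

lemma P_li (hT : IsLusztigAuts D T) (v : List I) : ∀ u, IsRedW0 D (u ++ v) → LinearIndependent 𝕂 (fun l : Fib v => P T l.1) := by
  induction v using List.reverseRecOn with
  | nil =>
    intro u _
    haveI : Unique (Fib ([] : List I)) := ⟨⟨⟨[], rfl⟩⟩, fun l => Subtype.ext (List.map_eq_nil_iff.mp l.2)⟩
    refine linearIndependent_unique_iff.mpr ?_
    have e : (default : Fib ([] : List I)).1 = [] := List.map_eq_nil_iff.mp (default : Fib ([] : List I)).2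
    rw [e]; exact one_ne (D := D)
  | append_singleton v j ih =>
    intro u h
    rw [← List.append_assoc] at h
    obtain ⟨i, h1, h2⟩ := rotate' h
    have hF := J2' hT h.1 h2
    have hli := ih (i :: u) h1
    have hli' : LinearIndependent 𝕂 (fun l : Fib v => TT T (i :: u) (P T l.1)) :=
      hli.map' (TT T (i :: u)).toLinearMap (LinearMap.ker_eq_bot.mpr (TT_inj _))
    have hm : ∀ l : Fib v, TT T (i :: u) (P T l.1) ∈ Subalgebra.toSubmodule (Uminus D) := by
      intro l
      rw [TT_P]
      refine P_mem hT _ ?_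
      rw [fs, List.map_append]
      change IsReducedWord D (fs (zer (i :: u)) ++ fs l.1)
      rw [fs_zer, l.2]; exact h1.1
    have key := li_pow _ _ hm hli' (KKinv D i * EE D i) (fun z hz N hN => Vind i z hz N hN)
    have key2 : LinearIndependent 𝕂 (fun p : Fib v × ℕ => ((qFact p.2)⁻¹ * (-1) ^ p.2) • (TT T (i :: u) (P T p.1.1) * (KKinv D i * EE D i) ^ p.2)) := by
      refine (key.units_smul (fun p => Units.mk0 ((qFact p.2)⁻¹ * (-1) ^ p.2) ?_))
      exact mul_ne_zero (inv_ne_zero (qFact_ne _)) (pow_ne_zero _ (by norm_num))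
    have e : (fun p : Fib v × ℕ => ((qFact p.2)⁻¹ * (-1) ^ p.2) • (TT T (i :: u) (P T p.1.1) * (KKinv D i * EE D i) ^ p.2)) = 
      (TT T (i :: u)).toLinearMap ∘ (fun l : Fib (v ++ [j]) => P T l.1) ∘ (fibE v j) := by
      funext p
      obtain ⟨⟨l, hl⟩, n⟩ := p
      simp only [Function.comp_apply, AlgHom.toLinearMap_apply, fibE_ap]
      rw [P_snoc, hl, map_mul, map_dpg, ← TT_append, List.cons_append, TT_cons i (u ++ v)]
      dsimp only
      rw [hF, TFs hT]
      exact gen_neg _ _ _ n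
    rw [e] at key2
    have := LinearIndependent.of_comp _ key2
    exact (linearIndependent_equiv (fibE v j)).mp this
end
end CB
end

noncomputable section
open scoped BigOperators
set_option linter.all false
namespace CB
section
variable {I : Type} [Fintype I] [DecidableEq I] {D : ADEData I}
variable {T : I → (Uq D ≃ₐ[𝕂] Uq D)}

lemma LA_span (w : List I) : LA T w = Submodule.span A (Set.range (fun l : Fib w => P T l.1)) := by
  induction w with
  | nil =>
    change Submodule.span A {1} = _
    congr 1
    ext u
    simp only [Set.mem_singleton_iff, Set.mem_range]
    constructor
    · rintro rfl; exact ⟨⟨[], rfl⟩, rfl⟩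
    · rintro ⟨⟨l, hl⟩, rfl⟩
      have := List.map_eq_nil_iff.mp hl
      subst this; rfl
  | cons i w ih =>
    change Dp (FF D i) * mapT (T i).toAlgHom (LA T w) = _
    rw [ih, mapT, Submodule.map_span, Dp, Submodule.span_mul_span]
    congr 1
    ext u
    simp only [Set.mem_mul, Set.mem_range, Set.mem_image]
    constructor
    · rintro ⟨_, ⟨n, rfl⟩, _, ⟨_, ⟨m, rfl⟩, rfl⟩, rfl⟩
      exact ⟨⟨(i, n) :: m.1, by simp [fs, m.2]⟩, rfl⟩
    · rintro ⟨⟨l, hl⟩, rfl⟩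
      obtain ⟨⟨j, n⟩, m, rfl, h1, h2⟩ := List.map_eq_cons_iff.mp hl
      simp only at h1; subst h1
      exact ⟨_, ⟨n, rfl⟩, _, ⟨_, ⟨⟨m, h2⟩, rfl⟩, rfl⟩, rfl⟩

/-- span of PBW -/
def Ms (T : I → (Uq D ≃ₐ[𝕂] Uq D)) (w : List I) : Submodule 𝕂 (Uq D) :=
  Submodule.span 𝕂 (Set.range (fun l : Fib w => P T l.1))

lemma P_Ms (l : List (I × ℕ)) : P T l ∈ Ms T (fs l) := Submodule.subset_span ⟨⟨l, rfl⟩, rfl⟩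

lemma Ms_le (hT : IsLusztigAuts D T) {w : List I} (h : IsReducedWord D w) : Ms T w ≤ Subalgebra.toSubmodule (Uminus D) := by
  rw [Ms, Submodule.span_le]
  rintro _ ⟨l, rfl⟩
  exact P_mem hT l.1 (by rw [l.2]; exact h)

lemma Ms_eq (hT : IsLusztigAuts D T) {w : List I} (h : IsRedW0 D w) : Ms T w = Subalgebra.toSubmodule (Uminus D) := by
  apply le_antisymm (Ms_le hT h.1)
  intro x hx
  have h1 := Uminus_le_span x hx
  refine (Submodule.span_le.mpr ?_) h1
  intro y hy
  have h2 : y ∈ LA T w := by rw [LA_eq hT h]; exact hy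
  rw [LA_span] at h2
  exact Submodule.span_le_restrictScalars A 𝕂 _ h2

lemma F_mem (i : I) : FF D i ∈ Uminus D := Algebra.subset_adjoin ⟨i, rfl⟩

section KL
variable (hT : IsLusztigAuts D T) {i : I} {l : List I} (h : IsRedW0 D (i :: l))

lemma decR (hT : IsLusztigAuts D T) {i : I} {l : List I} (h : IsRedW0 D (i :: l)) (x : Uq D) (hx : x ∈ Uminus D) : ∃ x0 ∈ Ms T l, ∃ y ∈ Uminus D, x = x0 + y * FF D i := by
  obtain ⟨j, h1, h2⟩ := rotate h
  have hF := J2' hT h1.1 h2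
  have hx' : x ∈ Ms T (l ++ [j]) := by rw [Ms_eq hT h1]; exact hx
  clear hx
  induction hx' using Submodule.span_induction with
  | zero => exact ⟨0, zero_mem _, 0, zero_mem _, by simp⟩
  | add x y hx hy ihx ihy =>
    obtain ⟨x0, h0, y0, h0', rfl⟩ := ihx
    obtain ⟨x1, h1, y1, h1', rfl⟩ := ihy
    exact ⟨x0 + x1, add_mem h0 h1, y0 + y1, add_mem h0' h1', by rw [add_mul]; abel⟩
  | smul c x hx ihx =>
    obtain ⟨x0, h0, y0, h0', rfl⟩ := ihx
    exact ⟨c • x0, Submodule.smul_mem _ _ h0, c • y0, (Uminus D).smul_mem h0' c, by rw [smul_add, smul_mul_assoc]⟩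
  | mem x hx' =>
    obtain ⟨m, rfl⟩ := hx'
    obtain ⟨m', n, hm⟩ := fib_snoc m
    simp only [hm, P_snoc, m'.2, hF]
    have hP : P T m'.1 ∈ Ms T l := Submodule.subset_span ⟨m', rfl⟩
    cases n with
    | zero => exact ⟨_, hP, 0, zero_mem _, by rw [dpg_zero]; simp⟩
    | succ n =>
      refine ⟨0, zero_mem _, (qInt (n + 1))⁻¹ • (P T m'.1 * dpg (FF D i) n), ?_, ?_⟩
      · exact (Uminus D).smul_mem (mul_mem (Ms_le hT (red_left D h1.1) hP) (dpg_mem_sub _ (F_mem i) n)) _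
      · rw [zero_add, smul_mul_assoc, mul_assoc, dpg_mul, mul_smul_comm, smul_smul, inv_mul_cancel₀ (qInt_ne (Nat.succ_ne_zero n)), one_smul]

lemma TM (hT : IsLusztigAuts D T) {i : I} {l : List I} (h : IsRedW0 D (i :: l)) {x : Uq D} (hx : x ∈ Ms T l) : T i x ∈ Uminus D := by
  induction hx using Submodule.span_induction with
  | zero => rw [map_zero]; exact zero_mem _
  | add x y hx hy ihx ihy => rw [map_add]; exact add_mem ihx ihy
  | smul c x hx ihx => rw [map_smul]; exact (Uminus D).smul_mem ihx c
  | mem x hx =>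
    obtain ⟨m, rfl⟩ := hx
    have : T i (P T m.1) = P T ((i, 0) :: m.1) := by rw [P_cons, dpg_zero, one_mul]
    simp only [this]
    refine P_mem hT _ ?_
    have : fs ((i, 0) :: m.1) = i :: l := by simp [fs, ← m.2]
    rw [this]; exact h.1

lemma Tker (hT : IsLusztigAuts D T) {i : I} {y : Uq D} (hy : T i (y * FF D i) ∈ Uminus D) : y * FF D i = 0 := by
  obtain ⟨ζ, hζ⟩ := psi_surj D _ hy
  have h1 := congrArg (fun u => verma D cm cm_ne u 1) hζ
  rw [map_mul, TFs hT] at h1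
  simp only [verma_psi, map_mul, map_neg, verma_k, verma_E, Module.End.mul_apply, LinearMap.neg_apply, vE_one, map_zero, neg_zero, mul_one] at h1
  rw [h1, map_zero] at hζ
  exact (T i).injective (by rw [← hζ, map_zero])

lemma MA (hT : IsLusztigAuts D T) {i : I} {l : List I} (h : IsRedW0 D (i :: l)) {x : Uq D} (hx : x ∈ Uminus D) (hx' : T i x ∈ Uminus D) : x ∈ Ms T l := by
  obtain ⟨x0, h0, y, hy, rfl⟩ := decR hT h x hx
  rw [Tker hT (y := y), add_zero]
  · exact h0
  · have := sub_mem hx' (TM hT h h0)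
    rwa [← map_sub, add_sub_cancel_left] at this

def Rel (T : I → (Uq D ≃ₐ[𝕂] Uq D)) (i : I) (l : List I) (x : Uq D) (z : Fm D) : Prop :=
  ∃ x0 ∈ Ms T l, ∃ y ∈ Uminus D, ∃ z0 w : Fm D, x = x0 + y * FF D i ∧ psi D z0 = T i x0 ∧ z = z0 + fF D i * w

lemma Rel.add {x x' : Uq D} {z z' : Fm D} (h : Rel T i l x z) (h' : Rel T i l x' z') : Rel T i l (x + x') (z + z') := by
  obtain ⟨x0, h0, y, hy, z0, w, rfl, h3, rfl⟩ := h
  obtain ⟨x1, h1, y', hy', z1, w', rfl, h4, rfl⟩ := h'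
  exact ⟨x0 + x1, add_mem h0 h1, y + y', add_mem hy hy', z0 + z1, w + w', by rw [add_mul]; abel, by rw [map_add, map_add, h3, h4], by rw [mul_add]; abel⟩
lemma Rel.smul {x : Uq D} {z : Fm D} (c : 𝕂) (h : Rel T i l x z) : Rel T i l (c • x) (c • z) := by
  obtain ⟨x0, h0, y, hy, z0, w, rfl, h3, rfl⟩ := h
  exact ⟨c • x0, Submodule.smul_mem _ _ h0, c • y, (Uminus D).smul_mem hy c, c • z0, c • w, by rw [smul_add, smul_mul_assoc], by rw [map_smul, map_smul, h3], by rw [smul_add, mul_smul_comm]⟩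
lemma Rel.uniq (hT : IsLusztigAuts D T) {i : I} {l : List I} (hw : IsRedW0 D (i :: l)) {x : Uq D} {z z' : Fm D} (h : Rel T i l x z) (h' : Rel T i l x z') : ∃ w, z' = z + fF D i * w := by
  obtain ⟨x0, h0, y, hy, z0, w, rfl, h3, rfl⟩ := h
  obtain ⟨x1, h1, y', hy', z1, w', e, h4, rfl⟩ := h'
  have e1 : x0 - x1 = (y' - y) * FF D i := by
    rw [sub_mul, sub_eq_sub_iff_add_eq_add, e]; abel
  have e2 := Tker hT (i := i) (y := y' - y) (by rw [← e1]; exact TM hT hw (sub_mem h0 h1))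
  rw [e2, sub_eq_zero] at e1
  subst e1
  have : z0 = z1 := psi_inj D (by rw [h3, h4])
  subst this
  exact ⟨w' - w, by rw [mul_sub]; abel⟩
lemma Rel.far (hT : IsLusztigAuts D T) {i : I} {l : List I} (hw : IsRedW0 D (i :: l)) {x : Uq D} {z : Fm D} (h : Rel T i l x z) {j : I} (hn : i ≠ j) (hj : D.adj i j = false) :
    Rel T i l (FF D j * x) (fF D j * z) := by
  obtain ⟨x0, h0, y, hy, z0, w, rfl, h3, rfl⟩ := h
  have e : psi D (fF D j * z0) = T i (FF D j * x0) := by rw [map_mul, map_mul, TFf hT hn hj, h3, psi_F]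
  refine ⟨FF D j * x0, ?_, FF D j * y, mul_mem (F_mem j) hy, fF D j * z0, fF D j * w, by rw [mul_add, mul_assoc], e, ?_⟩
  · refine MA hT hw (mul_mem (F_mem j) (Ms_le hT (red_tail hw.1) h0)) ?_
    rw [← e]; exact psi_mem D _
  · rw [mul_add, ← mul_assoc (fF D i), ffar D hn hj, mul_assoc]
lemma Rel.adj (hT : IsLusztigAuts D T) {i : I} {l : List I} (hw : IsRedW0 D (i :: l)) {x : Uq D} {z : Fm D} (h : Rel T i l x z) {j : I} (hj : D.adj i j = true) :
    Rel T i l (FF D j * x) (fF D j * (fF D i * z)) := by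
  obtain ⟨x0, h0, y, hy, z0, w, rfl, h3, rfl⟩ := h
  have e : psi D ((fF D j * fF D i - qq • (fF D i * fF D j)) * z0) = T i (FF D j * x0) := by
    rw [map_mul, map_mul, TFa hT hj, h3, map_sub, map_smul, map_mul, map_mul, psi_F, psi_F]
  refine ⟨FF D j * x0, ?_, FF D j * y, mul_mem (F_mem j) hy, _, qq • (fF D j * z0) + ((qq + qq⁻¹) • (fF D j * (fF D i * w)) - fF D i * (fF D j * w)), by rw [mul_add, mul_assoc], e, ?_⟩
  · refine MA hT hw (mul_mem (F_mem j) (Ms_le hT (red_tail hw.1) h0)) ?_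
    rw [← e]; exact psi_mem D _
  · have := congrArg (· * w) (fserre D hj)
    simp only [add_mul, sq, mul_assoc, smul_mul_assoc] at this
    rw [← eq_sub_iff_add_eq'] at this
    simp only [mul_add, sub_mul, smul_mul_assoc, mul_assoc, this, mul_smul_comm, mul_sub]
    abel

def ee (i : I) (z : Fm D) : Fm D := (qq - qq⁻¹)⁻¹ • (kap D i qq (rp D i z) - kap D i qq⁻¹ (rm D i z))
lemma ee_add (i : I) (x y : Fm D) : ee i (x + y) = ee i x + ee i y := by
  simp only [ee, map_add, smul_sub, smul_add]; abel
lemma ee_F (i : I) (x : Fm D) : ∃ w, ee i (fF D i * x) = fF D i * w := by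
  refine ⟨(qq - qq⁻¹)⁻¹ • (qq ^ (2:ℤ) • kap D i qq (rp D i x) - (qq⁻¹) ^ (2:ℤ) • kap D i qq⁻¹ (rm D i x)), ?_⟩
  simp only [ee, rp, rm, rr_F, if_true, map_add, kap_Fm, cartan_self, kap_inv D i qq_ne, kap_inv' D i qq_ne, mul_smul_comm, mul_sub]
  congr 1; abel
lemma ee_vE (i : I) (z e : Fm D) (h : ∀ c : I → 𝕂, (∀ i, c i ≠ 0) → - vk D c i (vE D c i z) = e) : e = - ee i z := by
  have h1 := h (fun _ => 1) (fun _ => one_ne_zero)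
  have h2 := h (fun _ => qq) (fun _ => qq_ne)
  simp only [vk_ap, vE_ap, inv_one, one_smul, map_smul, map_sub, smul_sub, smul_smul] at h1 h2
  have e1 : (qq - qq⁻¹)⁻¹ * qq * qq⁻¹ = (qq - qq⁻¹)⁻¹ := by rw [mul_assoc, mul_inv_cancel₀ qq_ne, mul_one]
  rw [e1, ← h1, neg_inj] at h2
  have h3 := sub_eq_sub_iff_sub_eq_sub.mp h2
  rw [sub_self] at h3
  have h4 := h3.symm
  rw [← sub_smul] at h4
  have h5 : (qq - qq⁻¹)⁻¹ * qq⁻¹ * qq⁻¹ - (qq - qq⁻¹)⁻¹ ≠ 0 := by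
    intro hh
    have : (qq - qq⁻¹)⁻¹ * qq⁻¹ * (qq⁻¹ - qq) = 0 := by
      rw [← hh]; have := qq_ne; field_simp
    have hq := qd_ne
    have hq' : qq⁻¹ - qq ≠ 0 := by rw [← neg_sub]; exact neg_ne_zero.mpr hq
    exact mul_ne_zero (mul_ne_zero (inv_ne_zero hq) (inv_ne_zero qq_ne)) hq' this
  have h6 := (smul_eq_zero.mp h4).resolve_left h5
  have h7 : rm D i z = 0 := by
    rw [← kap_inv' D i qq_ne (rm D i z), h6, map_zero]
  rw [← h1, ee, h7, map_zero, map_zero, smul_zero, sub_zero, sub_zero]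

lemma Rel.self (hT : IsLusztigAuts D T) {i : I} {l : List I} (hw : IsRedW0 D (i :: l)) {x : Uq D} {z : Fm D} (h : Rel T i l x z) :
    Rel T i l (FF D i * x) (- ee i z) := by
  obtain ⟨x0, h0, y, hy, z0, w, rfl, h3, rfl⟩ := h
  obtain ⟨y0, g0, y1, g1, e⟩ := decR hT hw (FF D i * x0) (mul_mem (F_mem i) (Ms_le hT (red_tail hw.1) h0))
  obtain ⟨η, hη⟩ := psi_surj D _ (TM hT hw g0)
  have key : η = - ee i z0 := by
    apply ee_vE
    intro c hc
    have e1 := congrArg (T i) e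
    rw [map_mul, map_add, map_mul, TFs hT, ← h3, ← hη] at e1
    have e2 := congrArg (fun u => verma D c hc u 1) e1
    simp only [map_mul, map_neg, map_add, verma_k, verma_E, Module.End.mul_apply, LinearMap.add_apply, LinearMap.neg_apply, verma_psi, vE_one, map_zero, neg_zero, mul_one, add_zero] at e2
    exact e2
  obtain ⟨w', hw'⟩ := ee_F i w
  refine ⟨y0, g0, y1 + FF D i * y, add_mem g1 (mul_mem (F_mem i) hy), η, -w', ?_, hη, ?_⟩
  · rw [mul_add, e, add_mul, mul_assoc, add_assoc]
  · rw [ee_add, hw', key, mul_neg]; abel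
end KL
end
end CB
end

noncomputable section
open scoped BigOperators
set_option linter.all false
namespace CB
section
variable {I : Type} [Fintype I] [DecidableEq I] {D : ADEData I}
variable {T : I → (Uq D ≃ₐ[𝕂] Uq D)} {bar : Uq D →+* Uq D}

lemma ringhom_rat {S : Type*} [Ring S] (f g : 𝕂 →+* S) (h : f qq = g qq) : f = g := by
  have hp : ∀ p : Polynomial ℚ, f (algebraMap _ 𝕂 p) = g (algebraMap _ 𝕂 p) := by
    have : f.comp (algebraMap (Polynomial ℚ) 𝕂) = g.comp (algebraMap (Polynomial ℚ) 𝕂) := by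
      apply Polynomial.ringHom_ext
      · intro a
        exact congrArg (fun h => h a) (RingHom.ext_rat ((f.comp (algebraMap (Polynomial ℚ) 𝕂)).comp Polynomial.C) ((g.comp (algebraMap (Polynomial ℚ) 𝕂)).comp Polynomial.C))
      · have : (algebraMap (Polynomial ℚ) 𝕂 Polynomial.X) = qq := by simp [qq]
        simp [this, h]
    intro p
    exact congrArg (fun h => h p) this
  ext x
  induction x using RatFunc.induction_on with
  | f p r hr =>
    have hr' : algebraMap (Polynomial ℚ) 𝕂 r ≠ 0 := by
      simpa using hr
    have hu : IsUnit (f (algebraMap (Polynomial ℚ) 𝕂 r)) := (IsUnit.mk0 _ hr').map f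
    apply hu.mul_right_cancel
    conv_rhs => rw [hp]
    rw [← map_mul, ← map_mul, div_mul_cancel₀ _ hr', hp]

lemma bar_alg (hbar : IsBar D bar) (c : 𝕂) : bar (algebraMap 𝕂 (Uq D) c) = algebraMap 𝕂 (Uq D) (sg c) := by
  have := ringhom_rat (bar.comp (algebraMap 𝕂 (Uq D))) ((algebraMap 𝕂 (Uq D)).comp sg) (by
    simp only [RingHom.comp_apply, sg_qq]; exact hbar.2.2.2.1)
  exact congrArg (fun h => h c) this

lemma bar_smul (hbar : IsBar D bar) (c : 𝕂) (x : Uq D) : bar (c • x) = sg c • bar x := by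
  rw [Algebra.smul_def, map_mul, bar_alg hbar, ← Algebra.smul_def]

lemma bar_mem (hbar : IsBar D bar) {x : Uq D} (hx : x ∈ Uminus D) : bar x ∈ Uminus D := by
  refine adj_ind (s := FF D) (P := fun x => bar x ∈ Uminus D) ?_ ?_ ?_ ?_ x hx
  · rw [map_one]; exact one_mem _
  · intro x y hx hy; rw [map_add]; exact add_mem hx hy
  · intro c x hx; rw [bar_smul hbar]; exact (Uminus D).smul_mem hx _
  · intro i x hx; rw [map_mul, hbar.2.1]; exact mul_mem (F_mem i) hx

lemma bar_dpg (hbar : IsBar D bar) (x : Uq D) (n : ℕ) : bar (dpg x n) = dpg (bar x) n := by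
  rw [dpg, bar_smul hbar, map_inv₀, sg_qFact, map_pow]; rfl

def barf (hbar : IsBar D bar) (z : Fm D) : Fm D := (psi_surj D _ (bar_mem hbar (psi_mem D z))).choose
lemma psi_barf (hbar : IsBar D bar) (z : Fm D) : psi D (barf hbar z) = bar (psi D z) := (psi_surj D _ (bar_mem hbar (psi_mem D z))).choose_spec
lemma barf_add (hbar : IsBar D bar) (x y : Fm D) : barf hbar (x + y) = barf hbar x + barf hbar y :=
  psi_inj D (by simp only [map_add, psi_barf])
lemma barf_smul (hbar : IsBar D bar) (c : 𝕂) (y : Fm D) : barf hbar (c • y) = sg c • barf hbar y :=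
  psi_inj D (by simp only [map_smul, psi_barf, bar_smul hbar])
lemma barf_one (hbar : IsBar D bar) : barf hbar (1 : Fm D) = 1 :=
  psi_inj D (by simp only [map_one, psi_barf])
lemma barf_zero (hbar : IsBar D bar) : barf hbar (0 : Fm D) = 0 :=
  psi_inj D (by simp only [map_zero, psi_barf])
lemma barf_neg (hbar : IsBar D bar) (x : Fm D) : barf hbar (-x) = - barf hbar x :=
  psi_inj D (by simp only [map_neg, psi_barf])
lemma barf_sub (hbar : IsBar D bar) (x y : Fm D) : barf hbar (x - y) = barf hbar x - barf hbar y := by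
  rw [sub_eq_add_neg, barf_add, barf_neg, sub_eq_add_neg]
lemma barf_F (hbar : IsBar D bar) (i : I) (x : Fm D) : barf hbar (fF D i * x) = fF D i * barf hbar x :=
  psi_inj D (by simp only [map_mul, psi_barf, psi_F, hbar.2.1])

lemma barf_kap (hbar : IsBar D bar) (i : I) (t : 𝕂) (x : Fm D) : barf hbar (kap D i t x) = kap D i (sg t) (barf hbar x) := by
  refine fm_ind D (P := fun x => barf hbar (kap D i t x) = kap D i (sg t) (barf hbar x)) ?_ ?_ ?_ ?_ x
  · simp only [map_one, barf_one]
  · intro x y hx hy; simp only [map_add, barf_add, hx, hy]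
  · intro c x hx; simp only [map_smul, barf_smul, hx]
  · intro j x hx; rw [kap_Fm, barf_smul, barf_F, barf_F, kap_Fm, hx, map_zpow₀]

lemma barf_rp (hbar : IsBar D bar) (i : I) (x : Fm D) : barf hbar (rp D i x) = rm D i (barf hbar x) := by
  refine fm_ind D (P := fun x => barf hbar (rp D i x) = rm D i (barf hbar x)) ?_ ?_ ?_ ?_ x
  · rw [barf_one, rp, rm, rr_one, rr_one, barf_zero]
  · intro x y hx hy; simp only [map_add, barf_add, hx, hy]
  · intro c x hx; simp only [map_smul, barf_smul, hx]
  · intro j x hx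
    rw [rp] at hx ⊢
    rw [rm] at hx ⊢
    rw [rr_F, barf_add, barf_F, barf_F, rr_F, hx]
    congr 1
    split_ifs
    · rw [barf_kap, map_inv₀, sg_qq, inv_inv]
    · rw [barf_zero]
lemma barf_barf (hbar : IsBar D bar) (x : Fm D) : barf hbar (barf hbar x) = x :=
  psi_inj D (by simp only [psi_barf, hbar.2.2.2.2])
lemma barf_rm (hbar : IsBar D bar) (i : I) (x : Fm D) : barf hbar (rm D i x) = rp D i (barf hbar x) := by
  have := barf_rp hbar i (barf hbar x)
  rw [barf_barf] at this
  rw [← this, barf_barf]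
lemma barf_ee (hbar : IsBar D bar) (i : I) (x : Fm D) : barf hbar (ee i x) = ee i (barf hbar x) := by
  have h1 : sg (qq - qq⁻¹)⁻¹ = - (qq - qq⁻¹)⁻¹ := by
    rw [map_inv₀, map_sub, map_inv₀, sg_qq, inv_inv, ← neg_sub, inv_neg]
  rw [ee, ee, barf_smul, barf_sub, barf_kap, barf_kap, barf_rp, barf_rm, map_inv₀ sg qq, sg_qq, inv_inv, h1, neg_smul, ← smul_neg, neg_sub]

lemma one_Ms (l : List I) : (1 : Uq D) ∈ Ms T l := by
  have := P_Ms (T := T) (zer l)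
  rwa [P_zer, fs_zer] at this

lemma RelBar (hT : IsLusztigAuts D T) (hbar : IsBar D bar) {i : I} {l : List I} (hw : IsRedW0 D (i :: l)) (x : Uq D) (hx : x ∈ Uminus D) :
    ∃ z, Rel T i l x z ∧ Rel T i l (bar x) (barf hbar z) := by
  refine adj_ind (s := FF D) (P := fun x => ∃ z, Rel T i l x z ∧ Rel T i l (bar x) (barf hbar z)) ?_ ?_ ?_ ?_ x hx
  · have : Rel T i l (1 : Uq D) 1 := ⟨1, one_Ms l, 0, zero_mem _, 1, 0, by simp, by simp, by simp⟩
    exact ⟨1, this, by rw [map_one, barf_one]; exact this⟩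
  · rintro x y ⟨z, h1, h2⟩ ⟨z', h3, h4⟩
    exact ⟨z + z', h1.add h3, by rw [map_add, barf_add]; exact h2.add h4⟩
  · rintro c x ⟨z, h1, h2⟩
    exact ⟨c • z, h1.smul c, by rw [bar_smul hbar, barf_smul]; exact h2.smul _⟩
  · rintro j x ⟨z, h1, h2⟩
    rw [map_mul, hbar.2.1]
    by_cases hj : i = j
    · subst hj
      exact ⟨_, h1.self hT hw, by rw [barf_neg, barf_ee]; exact h2.self hT hw⟩
    · cases ha : D.adj i j with
      | true => exact ⟨_, h1.adj hT hw ha, by rw [barf_F, barf_F]; exact h2.adj hT hw ha⟩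
      | false => exact ⟨_, h1.far hT hw hj ha, by rw [barf_F]; exact h2.far hT hw hj ha⟩

lemma KL (hT : IsLusztigAuts D T) (hbar : IsBar D bar) {i : I} {l : List I} (hw : IsRedW0 D (i :: l)) {x y u : Uq D}
    (hx : x ∈ Ms T l) (hy : y ∈ Ms T l) (hu : u ∈ Uminus D) (h : bar x = y + u * FF D i) :
    ∃ v ∈ Uminus D, bar (T i x) = T i y + FF D i * v := by
  obtain ⟨z, h1, h2⟩ := RelBar hT hbar hw x (Ms_le hT (red_tail hw.1) hx)
  obtain ⟨z0, hz0⟩ := psi_surj D _ (TM hT hw hx)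
  obtain ⟨z1, hz1⟩ := psi_surj D _ (TM hT hw hy)
  have g1 : Rel T i l x z0 := ⟨x, hx, 0, zero_mem _, z0, 0, by simp, hz0, by simp⟩
  have g2 : Rel T i l (bar x) z1 := ⟨y, hy, u, hu, z1, 0, h, hz1, by simp⟩
  obtain ⟨w, hw1⟩ := Rel.uniq hT hw h1 g1
  obtain ⟨w', hw2⟩ := Rel.uniq hT hw g2 h2
  refine ⟨psi D (w' + barf hbar w), psi_mem D _, ?_⟩
  rw [← hz0, ← hz1, ← psi_barf hbar, hw1, barf_add, barf_F, hw2, ← psi_F, ← map_mul, ← map_add, mul_add, add_assoc]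

def Sp (T : I → (Uq D ≃ₐ[𝕂] Uq D)) (w : List I) (p : List (I × ℕ) → Prop) : Submodule 𝕂 (Uq D) :=
  Submodule.span 𝕂 ((fun l : Fib w => P T l.1) '' {l | p l.1})

lemma Sp_mem {w : List I} {p : List (I × ℕ) → Prop} {l : List (I × ℕ)} (h : fs l = w) (hp : p l) : P T l ∈ Sp T w p :=
  Submodule.subset_span ⟨⟨l, h⟩, hp, rfl⟩

lemma Sp_le {w : List I} {p : List (I × ℕ) → Prop} : Sp T w p ≤ Ms T w :=
  Submodule.span_mono (by rintro _ ⟨l, _, rfl⟩; exact ⟨l, rfl⟩)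

lemma FU_head (hT : IsLusztigAuts D T) {i : I} {l : List I} (hw : IsRedW0 D (i :: l)) (n : ℕ) {v : Uq D} (hv : v ∈ Uminus D) :
    dpg (FF D i) n * v ∈ Sp T (i :: l) (fun b => ∃ m c, b = (i, m) :: c ∧ n ≤ m) := by
  have hv' : v ∈ Ms T (i :: l) := by rw [Ms_eq hT hw]; exact hv
  clear hv
  induction hv' using Submodule.span_induction with
  | zero => rw [mul_zero]; exact zero_mem _
  | add x y _ _ hx hy => rw [mul_add]; exact add_mem hx hy
  | smul c x _ hx => rw [mul_smul_comm]; exact Submodule.smul_mem _ _ hx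
  | mem x hx =>
    obtain ⟨⟨b, hb⟩, rfl⟩ := hx
    obtain ⟨⟨j, m⟩, c, rfl, h1, h2⟩ := List.map_eq_cons_iff.mp hb
    simp only at h1; subst h1
    simp only [P_cons]
    rw [← mul_assoc, dpg_mul_dpg, smul_mul_assoc]
    refine Submodule.smul_mem _ _ ?_
    rw [← P_cons (j, n + m)]
    exact Sp_mem (by rw [← hb]; rfl) ⟨_, _, rfl, Nat.le_add_right _ _⟩

lemma FU_last (hT : IsLusztigAuts D T) {i j : I} {l : List I} (hw : IsRedW0 D (l ++ [j])) (hl : wordAct D l (simpleRoot j) = simpleRoot i) (n : ℕ) {v : Uq D} (hv : v ∈ Uminus D) :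
    v * dpg (FF D i) n ∈ Sp T (l ++ [j]) (fun b => ∃ m c, b = c ++ [(j, m)] ∧ n ≤ m) := by
  have hF := J2' hT hw.1 hl
  have hv' : v ∈ Ms T (l ++ [j]) := by rw [Ms_eq hT hw]; exact hv
  clear hv
  induction hv' using Submodule.span_induction with
  | zero => rw [zero_mul]; exact zero_mem _
  | add x y _ _ hx hy => rw [add_mul]; exact add_mem hx hy
  | smul c x _ hx => rw [smul_mul_assoc]; exact Submodule.smul_mem _ _ hx
  | mem x hx =>
    obtain ⟨m, rfl⟩ := hx
    obtain ⟨m', k, hm⟩ := fib_snoc m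
    simp only [hm, P_snoc, m'.2, hF]
    rw [mul_assoc, dpg_mul_dpg, mul_smul_comm]
    refine Submodule.smul_mem _ _ ?_
    have : P T m'.1 * dpg (FF D i) (k + n) = P T (m'.1 ++ [(j, k + n)]) := by
      rw [P_snoc, m'.2, hF]
    rw [this]
    refine Sp_mem ?_ ⟨_, _, rfl, Nat.le_add_left _ _⟩
    simp [fs, ← m'.2]

lemma KLc (hT : IsLusztigAuts D T) (hbar : IsBar D bar) {i : I} {l : List I} (hw : IsRedW0 D (i :: l)) {x y u : Uq D}
    (hx : x ∈ Ms T l) (hy : y ∈ Ms T l) (hu : u ∈ Uminus D) (h : bar (T i x) = T i y + FF D i * u) :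
    ∃ v ∈ Uminus D, bar x = y + v * FF D i := by
  obtain ⟨y', hy', v, hv, e⟩ := decR hT hw (bar x) (bar_mem hbar (Ms_le hT (red_tail hw.1) hx))
  obtain ⟨u', hu', e'⟩ := KL hT hbar hw hx hy' hv e
  refine ⟨v, hv, ?_⟩
  rw [e]
  suffices y - y' = 0 by rw [sub_eq_zero.mp this]
  have h1 : T i (y - y') = dpg (FF D i) 1 * (u' - u) := by
    rw [dpg_one, map_sub, mul_sub, sub_eq_sub_iff_add_eq_add, ← h, e', add_comm]
  have h2 := FU_head hT hw 1 (sub_mem hu' hu)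
  rw [← h1] at h2
  have h3 : T i (y - y') ∈ Sp T (i :: l) (fun b => ∃ c, b = (i, 0) :: c) := by
    have : y - y' ∈ Ms T l := sub_mem hy hy'
    generalize y - y' = z at this
    induction this using Submodule.span_induction with
    | zero => rw [map_zero]; exact zero_mem _
    | add x y _ _ hx hy => rw [map_add]; exact add_mem hx hy
    | smul c x _ hx => rw [map_smul]; exact Submodule.smul_mem _ _ hx
    | mem x hx =>
      obtain ⟨m, rfl⟩ := hx
      have : T i (P T m.1) = P T ((i, 0) :: m.1) := by rw [P_cons, dpg_zero, one_mul]
      simp only [this]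
      exact Sp_mem (by simp [fs, ← m.2]) ⟨_, rfl⟩
  have hd := (P_li hT (i :: l) [] hw).disjoint_span_image (s := {l | ∃ m c, l.1 = (i, m) :: c ∧ 1 ≤ m}) (t := {l | ∃ c, l.1 = (i, 0) :: c}) (by
    rw [Set.disjoint_left]
    rintro a ⟨m, c, h, hm⟩ ⟨c', h'⟩
    rw [h] at h'
    simp at h'
    omega)
  have h4 := Submodule.disjoint_def.mp hd _ h2 h3
  exact (T i).injective (by rw [h4, map_zero])
end
end CB
end

noncomputable section
open scoped BigOperators
set_option linter.all false
namespace CB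
section
variable {I : Type} [Fintype I] [DecidableEq I] {D : ADEData I}
variable {T : I → (Uq D ≃ₐ[𝕂] Uq D)} {bar : Uq D →+* Uq D}

def ltL : List (I × ℕ) → List (I × ℕ) → Prop
  | p :: l, p' :: l' => p'.2 < p.2 ∨ (p = p' ∧ ltL l l')
  | _, _ => False
def ltR : List (I × ℕ) → List (I × ℕ) → Prop
  | p :: l, p' :: l' => ltR l l' ∨ (l = l' ∧ p'.2 < p.2)
  | _, _ => False

lemma ltL_snoc (p : I × ℕ) : ∀ (l l' : List (I × ℕ)), fs l = fs l' → ltL (l ++ [p]) (l' ++ [p]) → ltL l l'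
  | [], [], _, h => by simp [ltL] at h
  | [], _ :: _, h, _ => by simp [fs] at h
  | _ :: _, [], h, _ => by simp [fs] at h
  | a :: l, b :: l', hl, h => by
    simp only [List.cons_append, ltL] at h ⊢
    simp only [fs, List.map_cons, List.cons.injEq] at hl
    exact h.imp id (fun h => ⟨h.1, ltL_snoc p l l' hl.2 h.2⟩)

lemma ltR_snoc_lt (p p' : I × ℕ) (hp : p'.2 < p.2) : ∀ (l l' : List (I × ℕ)), fs l = fs l' → ltR (l ++ [p]) (l' ++ [p'])
  | [], [], _ => by simp [ltR, hp]
  | [], _ :: _, h => by simp [fs] at h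
  | _ :: _, [], h => by simp [fs] at h
  | a :: l, b :: l', hl => by
    simp only [fs, List.map_cons, List.cons.injEq] at hl
    exact Or.inl (ltR_snoc_lt p p' hp l l' hl.2)

lemma ltR_snoc (p : I × ℕ) : ∀ (l l' : List (I × ℕ)), ltR l l' → ltR (l ++ [p]) (l' ++ [p])
  | [], [], h => by simp [ltR] at h
  | [], _ :: _, h => by simp [ltR] at h
  | _ :: _, [], h => by simp [ltR] at h
  | a :: l, b :: l', h => by
    simp only [List.cons_append, ltR] at h ⊢
    exact h.imp (ltR_snoc p l l') (fun h => ⟨by rw [h.1], h.2⟩)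

lemma leftT (hT : IsLusztigAuts D T) (hbar : IsBar D bar) (u : List I) : ∀ (v : List I), IsRedW0 D (u ++ v) → ∀ a, fs a = u →
    bar (P T a) - P T a ∈ Sp T (u ++ v) (fun b => ltL b (a ++ zer v)) := by
  induction u with
  | nil =>
    intro v _ a ha
    have := List.map_eq_nil_iff.mp ha
    subst this
    rw [P_nil, map_one, sub_self]; exact zero_mem _
  | cons i u ih =>
    intro v hw a ha
    obtain ⟨⟨i', n⟩, a, rfl, h1, h2⟩ := List.map_eq_cons_iff.mp ha
    simp only at h1; subst h1
    obtain ⟨j, hr, hj⟩ := rotate (D := D) (i := i') (l := u ++ v) hw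
    have hF := J2' hT hr.1 hj
    have IH := ih (v ++ [j]) (by rw [← List.append_assoc]; exact hr) a h2
    have key : ∀ x ∈ Sp T (u ++ (v ++ [j])) (fun b => ltL b (a ++ zer (v ++ [j]))),
        ∃ y ∈ Sp T (u ++ v) (fun b => ltL b (a ++ zer v)), ∃ t ∈ Uminus D, x = y + t * FF D i' := by
      intro x hx
      induction hx using Submodule.span_induction with
      | zero => exact ⟨0, zero_mem _, 0, zero_mem _, by simp⟩
      | add x y _ _ ihx ihy =>
        obtain ⟨x0, h0, y0, h0', rfl⟩ := ihx
        obtain ⟨x1, h1, y1, h1', rfl⟩ := ihy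
        exact ⟨x0 + x1, add_mem h0 h1, y0 + y1, add_mem h0' h1', by rw [add_mul]; abel⟩
      | smul c x _ ihx =>
        obtain ⟨x0, h0, y0, h0', rfl⟩ := ihx
        exact ⟨c • x0, Submodule.smul_mem _ _ h0, c • y0, (Uminus D).smul_mem h0' c, by rw [smul_add, smul_mul_assoc]⟩
      | mem x hx =>
        obtain ⟨⟨b, hb⟩, hb', rfl⟩ := hx
        rw [← List.append_assoc] at hb
        obtain ⟨m', n, hm⟩ := fib_snoc ⟨b, hb⟩
        simp only at hm
        subst hm
        simp only [P_snoc, m'.2, hF]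
        cases n with
        | zero =>
          refine ⟨P T m'.1, Sp_mem m'.2 ?_, 0, zero_mem _, by rw [dpg_zero]; simp⟩
          have e : a ++ zer (v ++ [j]) = (a ++ zer v) ++ [(j, 0)] := by simp [zer]
          simp only [Set.mem_setOf_eq, e] at hb'
          refine ltL_snoc _ _ _ ?_ hb'
          rw [m'.2]
          have := fs_zer v
          simp only [fs] at this
          simp [fs, h2, this]
        | succ n =>
          refine ⟨0, zero_mem _, (qInt (n + 1))⁻¹ • (P T m'.1 * dpg (FF D i') n), ?_, ?_⟩
          · exact (Uminus D).smul_mem (mul_mem (P_mem hT _ (by rw [m'.2]; exact red_left D hr.1)) (dpg_mem_sub _ (F_mem _) n)) _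
          · rw [zero_add, smul_mul_assoc, mul_assoc, dpg_mul, mul_smul_comm, smul_smul, inv_mul_cancel₀ (qInt_ne (Nat.succ_ne_zero n)), one_smul]
    obtain ⟨y, hy, t, ht, e⟩ := key _ IH
    have haM : P T a ∈ Ms T (u ++ v) := by
      have := P_Ms (T := T) (a ++ zer v)
      rw [P_zer_right] at this
      have e2 : fs (a ++ zer v) = u ++ v := by
        have := fs_zer v
        simp only [fs] at this
        simp [fs, h2, this]
      rwa [e2] at this
    obtain ⟨s, hs, e'⟩ := KL hT hbar (i := i') (l := u ++ v) hw haM (add_mem haM (Sp_le hy)) ht (by rw [add_assoc, ← e]; abel)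
    have e3 : bar (P T ((i', n) :: a)) - P T ((i', n) :: a) = dpg (FF D i') n * T i' y + qInt (n + 1) • (dpg (FF D i') (n + 1) * s) := by
      rw [P_cons, map_mul, bar_dpg hbar, hbar.2.1, e', map_add, ← smul_mul_assoc, ← dpg_mul]
      simp only [mul_add, mul_assoc]
      abel
    rw [e3]
    refine add_mem ?_ (Submodule.smul_mem _ _ ?_)
    · clear e e' e3
      induction hy using Submodule.span_induction with
      | zero => rw [map_zero, mul_zero]; exact zero_mem _
      | add x y _ _ hx hy => rw [map_add, mul_add]; exact add_mem hx hy
      | smul c x _ hx => rw [map_smul, mul_smul_comm]; exact Submodule.smul_mem _ _ hx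
      | mem x hx =>
        obtain ⟨⟨b, hb⟩, hb', rfl⟩ := hx
        change dpg (FF D (i', n).1) (i', n).2 * _ ∈ _
        rw [← P_cons]
        exact Sp_mem (by simp [fs, ← hb]) (Or.inr ⟨rfl, hb'⟩)
    · refine Submodule.span_mono ?_ (FU_head hT hw (n + 1) hs)
      rintro _ ⟨b, ⟨m, c, hb, hm⟩, rfl⟩
      refine ⟨b, ?_, rfl⟩
      simp only [Set.mem_setOf_eq, hb, List.cons_append]
      exact Or.inl hm

lemma rightT (hT : IsLusztigAuts D T) (hbar : IsBar D bar) (v : List I) : ∀ (u : List I), IsRedW0 D (u ++ v) → ∀ b, fs b = v →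
    bar (P T (zer u ++ b)) - P T (zer u ++ b) ∈ Sp T (u ++ v) (fun c => ltR c (zer u ++ b)) := by
  induction v using List.reverseRecOn with
  | nil =>
    intro v _ a ha
    have := List.map_eq_nil_iff.mp ha
    subst this
    rw [List.append_nil, List.append_nil, P_zer, map_one, sub_self]; exact zero_mem _
  | append_singleton v j ih =>
    intro u hw b hb
    obtain ⟨b', n, hm⟩ := fib_snoc ⟨b, hb⟩
    simp only at hm
    subst hm
    obtain ⟨b, rfl⟩ := b'
    rw [← List.append_assoc] at hw
    obtain ⟨i, hr, hj⟩ := rotate' (D := D) (l := u ++ fs b) hw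
    have hF := J2' hT hw.1 hj
    have hfs : fs (zer u ++ b) = u ++ fs b := by
      have := fs_zer u
      simp only [fs] at this
      simp [fs, this]
    have IH := ih (i :: u) hr b rfl
    have hz : zer (i :: u) = (i, 0) :: zer u := rfl
    have hTP : ∀ c, P T ((i, 0) :: c) = T i (P T c) := by intro c; rw [P_cons, dpg_zero, one_mul]
    have key : ∀ x ∈ Sp T (i :: u ++ fs b) (fun c => ltR c (zer (i :: u) ++ b)),
        ∃ y ∈ Sp T (u ++ fs b) (fun c => ltR c (zer u ++ b)), ∃ t ∈ Uminus D, x = T i y + FF D i * t := by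
      intro x hx
      induction hx using Submodule.span_induction with
      | zero => exact ⟨0, zero_mem _, 0, zero_mem _, by simp⟩
      | add x y _ _ ihx ihy =>
        obtain ⟨x0, h0, y0, h0', rfl⟩ := ihx
        obtain ⟨x1, h1, y1, h1', rfl⟩ := ihy
        exact ⟨x0 + x1, add_mem h0 h1, y0 + y1, add_mem h0' h1', by rw [mul_add, map_add]; abel⟩
      | smul c x _ ihx =>
        obtain ⟨x0, h0, y0, h0', rfl⟩ := ihx
        exact ⟨c • x0, Submodule.smul_mem _ _ h0, c • y0, (Uminus D).smul_mem h0' c, by rw [smul_add, mul_smul_comm, map_smul]⟩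
      | mem x hx =>
        obtain ⟨⟨c, hc⟩, hc', rfl⟩ := hx
        obtain ⟨⟨i', m⟩, c, rfl, h1, h2⟩ := List.map_eq_cons_iff.mp hc
        simp only at h1; subst h1
        cases m with
        | zero =>
          refine ⟨P T c, Sp_mem h2 ?_, 0, zero_mem _, by simp only [hTP]; simp⟩
          simp only [Set.mem_setOf_eq, hz, List.cons_append, ltR, lt_irrefl, and_false, or_false] at hc'
          exact hc'
        | succ m =>
          refine ⟨0, zero_mem _, (qInt (m + 1))⁻¹ • (dpg (FF D i') m * T i' (P T c)), ?_, ?_⟩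
          · refine (Uminus D).smul_mem (mul_mem (dpg_mem_sub _ (F_mem _) m) (TM hT hr ?_)) _
            exact Submodule.subset_span ⟨⟨c, h2⟩, rfl⟩
          · simp only [P_cons]
            rw [map_zero, zero_add, mul_smul_comm, ← mul_assoc, mul_dpg, smul_mul_assoc, smul_smul, inv_mul_cancel₀ (qInt_ne (Nat.succ_ne_zero m)), one_smul]
    obtain ⟨y, hy, t, ht, e⟩ := key _ IH
    have haM : P T (zer u ++ b) ∈ Ms T (u ++ fs b) := by
      have := P_Ms (T := T) (zer u ++ b)
      rwa [hfs] at this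
    rw [hz, List.cons_append, hTP] at e
    obtain ⟨s, hs, e'⟩ := KLc hT hbar (i := i) (l := u ++ fs b) hr haM (add_mem haM (Sp_le hy)) ht (by rw [map_add, add_assoc, ← e]; abel)
    have hsn : ∀ c m, fs c = u ++ fs b → P T (c ++ [(j, m)]) = P T c * dpg (FF D i) m := by
      intro c m hc
      rw [P_snoc, hc, hF]
    have e3 : bar (P T ((zer u ++ b) ++ [(j, n)])) - P T ((zer u ++ b) ++ [(j, n)]) = y * dpg (FF D i) n + qInt (n + 1) • (s * dpg (FF D i) (n + 1)) := by
      rw [hsn _ _ hfs, map_mul, bar_dpg hbar, hbar.2.1, e', ← mul_smul_comm, ← mul_dpg]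
      simp only [add_mul, mul_assoc]
      abel
    simp only [← List.append_assoc]
    rw [e3]
    refine add_mem ?_ (Submodule.smul_mem _ _ ?_)
    · clear e e' e3
      induction hy using Submodule.span_induction with
      | zero => rw [zero_mul]; exact zero_mem _
      | add x y _ _ hx hy => rw [add_mul]; exact add_mem hx hy
      | smul c x _ hx => rw [smul_mul_assoc]; exact Submodule.smul_mem _ _ hx
      | mem x hx =>
        obtain ⟨⟨c, hc⟩, hc', rfl⟩ := hx
        simp only [← hsn c n hc]
        exact Sp_mem (by rw [← hc]; simp [fs]) (ltR_snoc _ _ _ hc')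
    · refine Submodule.span_mono ?_ (FU_last hT hw hj (n + 1) hs)
      rintro _ ⟨⟨c, hc⟩, ⟨m, c', hb, hm⟩, rfl⟩
      refine ⟨⟨c, hc⟩, ?_, rfl⟩
      simp only at hb
      subst hb
      refine ltR_snoc_lt (j, m) (j, n) hm _ _ ?_
      rw [hfs]
      have : List.map Prod.fst c' ++ [j] = (u ++ fs b) ++ [j] := by rw [← hc]; simp [fs]
      exact List.append_cancel_right this
end
end CB
end

noncomputable section
open scoped BigOperators
set_option linter.all false
namespace CB
section
variable {I : Type} [Fintype I] [DecidableEq I] {D : ADEData I}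
variable {T : I → (Uq D ≃ₐ[𝕂] Uq D)} {bar : Uq D →+* Uq D}

def Wt (x : Uq D) (μ : I → ℤ) : Prop := ∀ i, KK D i * x = qq ^ pairing D μ i • (x * KK D i)

lemma sub_smul_g {R : Type*} [Ring R] [Algebra 𝕂 R] (a b : 𝕂) (x : R) : (a - b) • x = a • x - b • x := sub_smul _ _ _
lemma wt_flip {R : Type*} [Ring R] [Algebra 𝕂 R] {K k x : R} {c : 𝕂} (hc : c ≠ 0) (h1 : K * k = 1) (h2 : k * K = 1)
    (h : k * x = c⁻¹ • (x * k)) : K * x = c • (x * K) := by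
  have e : x * K = c⁻¹ • (K * x) := by
    calc x * K = K * (k * x) * K := by rw [← mul_assoc K k, h1, one_mul]
      _ = c⁻¹ • (K * x) := by rw [h, mul_smul_comm, smul_mul_assoc, mul_assoc, mul_assoc, h2, mul_one]
  rw [e, smul_smul, mul_inv_cancel₀ hc, one_smul]
lemma wt_comm2 {R : Type*} [Ring R] [Algebra 𝕂 R] {K L x : R} {c d : 𝕂} (h1 : K * x = c • (x * K)) (h2 : L * x = d • (x * L)) :
    (K * L) * x = (c * d) • (x * (K * L)) := by
  rw [mul_assoc, h2, mul_smul_comm, ← mul_assoc, h1, smul_mul_assoc, smul_smul, mul_assoc, mul_comm c d]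
lemma wt_mul {R : Type*} [Ring R] [Algebra 𝕂 R] {K x y : R} {c d : 𝕂} (h1 : K * x = c • (x * K)) (h2 : K * y = d • (y * K)) :
    K * (x * y) = (c * d) • (x * y * K) := by
  rw [← mul_assoc, h1, smul_mul_assoc, mul_assoc, h2, mul_smul_comm, smul_smul, mul_assoc]

lemma Wt.mul {x y : Uq D} {μ ν : I → ℤ} (h : Wt x μ) (h' : Wt y ν) : Wt (x * y) (μ + ν) := by
  intro i
  rw [pairing_add, zpow_add₀ qq_ne]
  exact wt_mul (h i) (h' i)
lemma Wt.one : Wt (1 : Uq D) 0 := by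
  intro i; simp [pairing]
lemma Wt.smul {x : Uq D} {μ : I → ℤ} (c : 𝕂) (h : Wt x μ) : Wt (c • x) μ := by
  intro i
  rw [mul_smul_comm, h i, smul_mul_assoc, smul_comm]
lemma Wt.sub {x y : Uq D} {μ : I → ℤ} (h : Wt x μ) (h' : Wt y μ) : Wt (x - y) μ := by
  intro i
  rw [mul_sub, h i, h' i, sub_mul, smul_sub]
lemma Wt.pow {x : Uq D} {μ : I → ℤ} (h : Wt x μ) (n : ℕ) : Wt (x ^ n) ((n : ℤ) • μ) := by
  induction n with
  | zero => rw [pow_zero, Nat.cast_zero, zero_smul]; exact Wt.one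
  | succ n ih => rw [pow_succ, Nat.cast_succ, add_smul, one_smul]; exact ih.mul h
lemma Wt.dpg {x : Uq D} {μ : I → ℤ} (h : Wt x μ) (n : ℕ) : Wt (dpg x n) ((n : ℤ) • μ) := (h.pow n).smul _
lemma Wt.F (i : I) : Wt (FF D i) (-simpleRoot i) := by
  intro j
  rw [pairing_neg, pairing_simple, KF, cartan_symm]

lemma Tk (hT : IsLusztigAuts D T) (i : I) : T i (KKinv D i) = KK D i := by
  have h1 : T i (KKinv D i) * KKinv D i = 1 := by
    rw [show T i (KKinv D i) * KKinv D i = T i (KKinv D i) * T i (KK D i) by rw [TKs hT], ← map_mul, kKK, map_one]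
  calc T i (KKinv D i) = T i (KKinv D i) * (KKinv D i * KK D i) := by rw [kKK, mul_one]
    _ = KK D i := by rw [← mul_assoc, h1, one_mul]

lemma Wt.TT (hT : IsLusztigAuts D T) {x : Uq D} {μ : I → ℤ} (h : Wt x μ) (i : I) : Wt (T i x) (sref D i μ) := by
  intro j
  have hmap : ∀ {K : Uq D} {c : 𝕂}, K * x = c • (x * K) → T i K * T i x = c • (T i x * T i K) := by
    intro K c h
    rw [← map_mul, h, map_smul, map_mul]
  rw [sref_eq, pairing_sub, pairing_smul, pairing_simple]
  by_cases hj : i = j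
  · subst hj
    rw [cartan_self]
    have e : KKinv D i * x = qq ^ (-pairing D μ i) • (x * KKinv D i) := by
      apply wt_flip (qz _) (kKK D i) (KKk D i)
      rw [zpow_neg, inv_inv]; exact h i
    have := hmap e
    rw [Tk hT] at this
    rw [this]; congr 2; ring
  · cases ha : D.adj i j with
    | true =>
      have := hmap (wt_comm2 (h i) (h j))
      rw [map_mul, TKs hT, TKa hT ha, ← mul_assoc, kKK, one_mul] at this
      rw [this, cartan_adj D ha, ← zpow_add₀ qq_ne]; congr 2; ring
    | false =>
      have := hmap (h j)
      rw [TKf hT hj ha] at this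
      rw [this, cartan_far D hj ha]; congr 2; ring

lemma Wt.br (hbar : IsBar D bar) {x : Uq D} {μ : I → ℤ} (h : Wt x μ) : Wt (bar x) μ := by
  intro i
  apply wt_flip (qz _) (KKk D i) (kKK D i)
  have := congrArg bar (h i)
  rw [map_mul, bar_smul hbar, map_mul, hbar.2.2.1, sg_zpow, zpow_neg] at this
  exact this

def wtL (D : ADEData I) : List (I × ℕ) → (I → ℤ)
  | [] => 0
  | p :: l => (p.2 : ℤ) • simpleRoot p.1 + sref D p.1 (wtL D l)

lemma Wt.P (hT : IsLusztigAuts D T) (l : List (I × ℕ)) : Wt (P T l) (-wtL D l) := by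
  induction l with
  | nil => rw [wtL, neg_zero]; exact Wt.one
  | cons p l ih =>
    rw [P_cons, wtL, neg_add, ← smul_neg, ← sref_neg]
    exact ((Wt.F p.1).dpg p.2).mul (ih.TT hT p.1)

lemma wt_inj {u v : I → ℤ} (h : ∀ i, pairing D u i = pairing D v i) : u = v := by
  by_contra hne
  have := bil_pos D (u - v) (sub_ne_zero.mpr hne)
  have h2 : bil D (u - v) (u - v) = 0 := by
    simp only [bil, pairing_sub, h, sub_self, mul_zero, Finset.sum_const_zero]
  omega

lemma wt_coef (hT : IsLusztigAuts D T) {w : List I} (hw : IsRedW0 D w) (c : Fib w →₀ 𝕂) (μ : I → ℤ)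
    (h : Wt (Finsupp.linearCombination 𝕂 (fun l : Fib w => P T l.1) c) (-μ)) (b : Fib w) (hb : c b ≠ 0) : wtL D b.1 = μ := by
  have key : ∀ i, pairing D (-wtL D b.1) i = pairing D (-μ) i := by
    intro i
    have h1 := h i
    rw [Finsupp.linearCombination_apply, Finsupp.sum, Finset.mul_sum, Finset.sum_mul, Finset.smul_sum, ← sub_eq_zero, ← Finset.sum_sub_distrib] at h1
    have h2 : ∀ l ∈ c.support, KK D i * c l • P T l.1 - qq ^ pairing D (-μ) i • (c l • P T l.1 * KK D i) = (((qq ^ pairing D (-wtL D l.1) i - qq ^ pairing D (-μ) i) * c l) • P T l.1) * KK D i := by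
      intro l _
      rw [mul_smul_comm, Wt.P hT l.1 i, smul_mul_assoc, smul_mul_assoc, smul_smul, smul_smul, sub_mul, mul_comm (c l)]
      exact (sub_smul_g _ _ _).symm
    rw [Finset.sum_congr rfl h2, ← Finset.sum_mul] at h1
    have h3 := congrArg (· * KKinv D i) h1
    simp only [mul_assoc, KKk, mul_one, zero_mul] at h3
    have h4 := linearIndependent_iff'.mp (P_li hT w [] hw) c.support _ h3 b (Finsupp.mem_support_iff.mpr hb)
    exact qq_zpow_inj (sub_eq_zero.mp ((mul_eq_zero.mp h4).resolve_right hb))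
  have := wt_inj key
  exact neg_injective this

lemma bar_UA (hbar : IsBar D bar) {x : Uq D} (hx : x ∈ UA (FF D)) : bar x ∈ UA (FF D) := by
  induction hx using Algebra.adjoin_induction with
  | mem x hx =>
    obtain ⟨i, n, rfl⟩ := hx
    rw [bar_dpg hbar, hbar.2.1]; exact dpg_mem_UA _ i n
  | algebraMap r =>
    have : bar (algebraMap A (Uq D) r) = algebraMap A (Uq D) ⟨sg r.1, sg_mem_A r.2⟩ := bar_alg hbar r.1
    rw [this]
    exact Subalgebra.algebraMap_mem _ _
  | add x y _ _ hx hy => rw [map_add]; exact add_mem hx hy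
  | mul x y _ _ hx hy => rw [map_mul]; exact mul_mem hx hy

lemma tri (hT : IsLusztigAuts D T) (hbar : IsBar D bar) {w : List I} (hw : IsRedW0 D w) (a : Fib w) :
    ∃ c : Fib w →₀ 𝕂, bar (P T a.1) = P T a.1 + Finsupp.linearCombination 𝕂 (fun l : Fib w => P T l.1) c ∧
      (∀ b, c b ≠ 0 → wtL D b.1 = wtL D a.1 ∧ ltL b.1 a.1 ∧ ltR b.1 a.1) ∧ ∀ b, c b ∈ A := by
  have li : Function.Injective (Finsupp.linearCombination 𝕂 (fun l : Fib w => P T l.1)) := P_li hT w [] hw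
  have h1 := leftT hT hbar w [] (by simpa using hw) a.1 a.2
  have h2 := rightT hT hbar w [] hw a.1 a.2
  simp only [zer, List.map_nil, List.append_nil, List.nil_append] at h1 h2
  obtain ⟨c, hc, e⟩ := (Finsupp.mem_span_image_iff_linearCombination 𝕂).mp h1
  obtain ⟨c', hc', e'⟩ := (Finsupp.mem_span_image_iff_linearCombination 𝕂).mp h2
  have : c = c' := li (e.trans e'.symm)
  subst this
  refine ⟨c, by rw [e]; abel, ?_, ?_⟩
  · intro b hb
    refine ⟨?_, (Finsupp.mem_supported _ _).mp hc (Finsupp.mem_support_iff.mpr hb), (Finsupp.mem_supported _ _).mp hc' (Finsupp.mem_support_iff.mpr hb)⟩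
    refine wt_coef hT hw c _ ?_ b hb
    rw [e]
    exact ((Wt.P hT a.1).br hbar).sub (Wt.P hT a.1)
  · have h3 : P T a.1 ∈ UA (FF D) := by
      have : P T a.1 ∈ LA T w := by have := P_mem_LA (T := T) a.1; rwa [a.2] at this
      rw [LA_eq hT hw] at this; exact this
    have h4 : bar (P T a.1) - P T a.1 ∈ LA T w := by
      rw [LA_eq hT hw]; exact sub_mem (bar_UA hbar h3) h3
    rw [LA_span] at h4
    obtain ⟨d, hd⟩ := (Finsupp.mem_span_range_iff_exists_finsupp).mp h4
    have : c = d.mapRange Subtype.val rfl := by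
      apply li
      rw [e, ← hd, Finsupp.linearCombination_apply, Finsupp.sum_mapRange_index (by simp)]
      rfl
    intro b
    rw [this]
    exact (d b).2

def toL : (w : List I) → (Fin w.length → ℕ) → List (I × ℕ)
  | [], _ => []
  | i :: w, a => (i, a 0) :: toL w (fun k => a k.succ)

lemma fs_toL : ∀ (w : List I) (a : Fin w.length → ℕ), fs (toL w a) = w
  | [], _ => rfl
  | i :: w, a => by
    have := fs_toL w (fun k => a k.succ)
    simp only [fs] at this
    simp only [toL, fs, List.map_cons, this]

lemma toL_inj : ∀ (w : List I), Function.Injective (toL w)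
  | [], a, b, h => by ext k; exact k.elim0
  | i :: w, a, b, h => by
    simp only [toL, List.cons.injEq, Prod.mk.injEq, true_and] at h
    have := toL_inj w h.2
    ext k
    refine Fin.cases h.1 (fun k => congrFun this k) k

lemma toL_surj : ∀ (w : List I) (l : List (I × ℕ)), fs l = w → ∃ a, toL w a = l
  | [], l, h => ⟨fun _ => 0, by have := List.map_eq_nil_iff.mp h; subst this; rfl⟩
  | i :: w, l, h => by
    obtain ⟨⟨j, m⟩, c, rfl, h1, h2⟩ := List.map_eq_cons_iff.mp h
    simp only at h1; subst h1
    obtain ⟨a, ha⟩ := toL_surj w c h2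
    refine ⟨Fin.cons (α := fun _ => ℕ) m a, ?_⟩
    simp only [toL, ← ha]
    congr 1

def toF (w : List I) : (Fin w.length → ℕ) ≃ Fib w :=
  Equiv.ofBijective (fun a => ⟨toL w a, fs_toL w a⟩)
    ⟨fun a b h => toL_inj w (congrArg Subtype.val h), fun ⟨l, h⟩ => by obtain ⟨a, ha⟩ := toL_surj w l h; exact ⟨a, Subtype.ext ha⟩⟩
lemma toF_val (w : List I) (a) : (toF w a).1 = toL w a := rfl

lemma ltL_toL : ∀ (w : List I) (a b : Fin w.length → ℕ), ltL (toL w a) (toL w b) → LtLeft a b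
  | [], a, b, h => by simp [toL, ltL] at h
  | i :: w, a, b, h => by
    simp only [toL, ltL, Prod.mk.injEq, true_and] at h
    rcases h with h | ⟨h0, h⟩
    · exact ⟨0, h, fun l hl => absurd hl (Fin.not_lt_zero l)⟩
    · obtain ⟨k, hk, hk'⟩ := ltL_toL w _ _ h
      refine ⟨k.succ, hk, fun l => ?_⟩
      refine Fin.cases (fun _ => h0) (fun l hl => hk' l (Fin.succ_lt_succ_iff.mp hl)) l

lemma ltR_toL : ∀ (w : List I) (a b : Fin w.length → ℕ), ltR (toL w a) (toL w b) → LtRight a b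
  | [], a, b, h => by simp [toL, ltR] at h
  | i :: w, a, b, h => by
    simp only [toL, ltR] at h
    rcases h with h | ⟨h0, h⟩
    · obtain ⟨k, hk, hk'⟩ := ltR_toL w _ _ h
      refine ⟨k.succ, hk, fun l => ?_⟩
      refine Fin.cases (fun h => absurd h (Fin.not_lt_zero _)) (fun l hl => hk' l (Fin.succ_lt_succ_iff.mp hl)) l
    · refine ⟨0, h, fun l => ?_⟩
      have := toL_inj w h0
      refine Fin.cases (fun h => absurd h (lt_irrefl _)) (fun l _ => congrFun this l) l

lemma sref_sum {ι : Type*} (s : Finset ι) (f : ι → I → ℤ) (i : I) : sref D i (∑ k ∈ s, f k) = ∑ k ∈ s, sref D i (f k) := by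
  classical
  induction s using Finset.induction_on with
  | empty => ext j; simp [sref, pairing]
  | insert a s ha ih => rw [Finset.sum_insert ha, Finset.sum_insert ha, sref_add, ih]

lemma wtL_toL : ∀ (w : List I) (a : Fin w.length → ℕ), wtL D (toL w a) = wtData D w a
  | [], a => by simp [toL, wtL, wtData]
  | i :: w, a => by
    have ih := wtL_toL w (fun k => a k.succ)
    rw [toL, wtL, ih, wtData, wtData, sref_sum]
    refine Eq.trans ?_ (Fin.sum_univ_succ _).symm
    congr 1
    refine Finset.sum_congr rfl fun k _ => ?_
    rw [sref_smul]; rfl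

lemma P_toL : ∀ (w : List I) (a : Fin w.length → ℕ), P T (toL w a) = pbw T w a
  | [], a => by simp [toL, P, pbw]
  | i :: w, a => by
    have ih := P_toL w (fun k => a k.succ)
    rw [toL, P_cons, ih, pbw, pbw]
    have : List.finRange (i :: w).length = (0 : Fin (w.length + 1)) :: (List.finRange w.length).map Fin.succ := List.finRange_succ
    rw [this, List.map_cons, List.prod_cons, List.map_map, map_list_prod, List.map_map]
    congr 2
    refine List.map_congr_left fun k _ => ?_
    simp only [Function.comp]
    exact map_dpg (T i).toAlgHom _ _
end
end CB
end

noncomputable section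
open scoped BigOperators
set_option linter.all false
namespace CB
section
open Polynomial

def QQ (x : 𝕂) : Prop := ∃ p : ℤ[X], x = algebraMap ℤ[X] 𝕂 (X * p)
def ZZ (x : 𝕂) : Prop := ∃ p : ℤ[X], x = algebraMap ℤ[X] 𝕂 p
lemma QQ.zero : QQ 0 := ⟨0, by simp⟩
lemma QQ.add {x y : 𝕂} : QQ x → QQ y → QQ (x + y) := by
  rintro ⟨p, rfl⟩ ⟨r, rfl⟩; exact ⟨p + r, by rw [mul_add, map_add]⟩
lemma QQ.mul {x y : 𝕂} : QQ x → ZZ y → QQ (x * y) := by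
  rintro ⟨p, rfl⟩ ⟨r, rfl⟩; exact ⟨p * r, by rw [← map_mul, mul_assoc]⟩
lemma QQ.zz {x : 𝕂} : QQ x → ZZ x := by
  rintro ⟨p, rfl⟩; exact ⟨_, rfl⟩
lemma ZZ.zero : ZZ 0 := ⟨0, by simp⟩
lemma ZZ.one : ZZ 1 := ⟨1, by simp⟩
lemma ZZ.add {x y : 𝕂} : ZZ x → ZZ y → ZZ (x + y) := by
  rintro ⟨p, rfl⟩ ⟨r, rfl⟩; exact ⟨p + r, by rw [map_add]⟩
lemma ZZ.mul {x y : 𝕂} : ZZ x → ZZ y → ZZ (x * y) := by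
  rintro ⟨p, rfl⟩ ⟨r, rfl⟩; exact ⟨p * r, by rw [← map_mul]⟩
lemma ZZ.mem {x : 𝕂} : ZZ x → x ∈ A := by
  rintro ⟨p, rfl⟩; exact poly_mem_A p

variable {ι : Type*} {r : ι → ι → Prop}

def Uni (r : ι → ι → Prop) (a : ι) (x : ι →₀ 𝕂) : Prop := x a = 1 ∧ ∀ b, b ≠ a → x b ≠ 0 → r b a

lemma exists_max (tr : ∀ a b c, r a b → r b c → r a c) (ir : ∀ a, ¬ r a a) (s : Finset ι) (hs : s.Nonempty) : ∃ m ∈ s, ∀ x ∈ s, ¬ r m x := by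
  classical
  induction hs using Finset.Nonempty.cons_induction with
  | singleton a => exact ⟨a, by simp, by simpa using ir a⟩
  | cons a s ha hs ih =>
    obtain ⟨m, hm, h⟩ := ih
    by_cases hr : r m a
    · refine ⟨a, by simp, ?_⟩
      intro x hx
      rcases Finset.mem_cons.mp hx with rfl | hx
      · exact ir x
      · exact fun h' => h x hx (tr _ _ _ hr h')
    · refine ⟨m, by simp [hm], ?_⟩
      intro x hx
      rcases Finset.mem_cons.mp hx with rfl | hx
      · exact hr
      · exact h x hx

lemma coef_max {s : Finset ι} {m : ι} (hm : m ∈ s) (h : ∀ x ∈ s, ¬ r m x) (g : ι → 𝕂) (y : ι → ι →₀ 𝕂) (hy : ∀ a ∈ s, Uni r a (y a)) :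
    (∑ a ∈ s, g a • y a) m = g m := by
  rw [Finsupp.finset_sum_apply, Finset.sum_eq_single m]
  · rw [Finsupp.smul_apply, (hy m hm).1, smul_eq_mul, mul_one]
  · intro a ha hne
    have : y a m = 0 := by
      by_contra h0
      exact h a ha ((hy a ha).2 m hne.symm h0)
    rw [Finsupp.smul_apply, this, smul_zero]
  · intro h; exact absurd hm h

lemma uni_indep (tr : ∀ a b c, r a b → r b c → r a c) (ir : ∀ a, ¬ r a a) {s : Finset ι} (g : ι → 𝕂) (y : ι → ι →₀ 𝕂) (hy : ∀ a ∈ s, Uni r a (y a))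
    (h : ∑ a ∈ s, g a • y a = 0) : ∀ a ∈ s, g a = 0 := by
  classical
  by_contra! hc
  obtain ⟨a, ha, hg⟩ := hc
  obtain ⟨m, hm, hmax⟩ := exists_max tr ir (s.filter (fun a => g a ≠ 0)) ⟨a, by simp [ha, hg]⟩
  have h2 : ∑ a ∈ s.filter (fun a => g a ≠ 0), g a • y a = 0 := by
    rw [← h]
    refine Finset.sum_subset (Finset.filter_subset _ _) ?_
    intro x hx hx'
    have : g x = 0 := by
      by_contra h0; exact hx' (by simp [hx, h0])
    rw [this, zero_smul]
  have h3 := coef_max hm hmax g y (fun a ha => hy a (Finset.mem_filter.mp ha).1)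
  rw [h2] at h3
  exact (Finset.mem_filter.mp hm).2 h3.symm

structure BarOp (r : ι → ι → Prop) (β : (ι →₀ 𝕂) → (ι →₀ 𝕂)) : Prop where
  add : ∀ x y, β (x + y) = β x + β y
  smul : ∀ (c : 𝕂) x, β (c • x) = sg c • β x
  inv : ∀ x, β (β x) = x
  uni : ∀ a, Uni r a (β (Finsupp.single a 1))
  mem : ∀ a b, β (Finsupp.single a 1) b ∈ A

variable {β : (ι →₀ 𝕂) → (ι →₀ 𝕂)}
lemma BarOp.zero (h : BarOp r β) : β 0 = 0 := by
  have := h.smul 0 0; simpa using this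
lemma BarOp.sum (h : BarOp r β) {κ : Type*} (s : Finset κ) (f : κ → ι →₀ 𝕂) : β (∑ a ∈ s, f a) = ∑ a ∈ s, β (f a) := by
  classical
  induction s using Finset.induction_on with
  | empty => simp [h.zero]
  | insert a s ha ih => rw [Finset.sum_insert ha, Finset.sum_insert ha, h.add, ih]

lemma vsum (x : ι →₀ 𝕂) : x = ∑ a ∈ x.support, x a • Finsupp.single a (1 : 𝕂) := by
  conv_lhs => rw [← Finsupp.sum_single x]
  exact Finset.sum_congr rfl fun a _ => by rw [Finsupp.smul_single_one]

lemma can_unique (h : BarOp r β) (tr : ∀ a b c, r a b → r b c → r a c) (ir : ∀ a, ¬ r a a) (z : ι →₀ 𝕂) (hz : β z = z) (hq : ∀ a, QQ (z a)) : z = 0 := by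
  by_contra hne
  obtain ⟨m, hm, hmax⟩ := exists_max tr ir z.support (Finsupp.support_nonempty_iff.mpr hne)
  have e : β z = ∑ a ∈ z.support, sg (z a) • β (Finsupp.single a 1) := by
    conv_lhs => rw [vsum z, h.sum]
    exact Finset.sum_congr rfl fun a _ => h.smul _ _
  have e2 := coef_max hm hmax (fun a => sg (z a)) (fun a => β (Finsupp.single a 1)) (fun a _ => h.uni a)
  rw [← e, hz] at e2
  obtain ⟨p, hp⟩ := hq m
  have := inv_zero p (by rw [← hp]; exact e2.symm)
  exact Finsupp.mem_support_iff.mp hm (hp.trans this)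

lemma single_mem (wf : WellFounded r) (M : AddSubgroup (ι →₀ 𝕂)) (Pr : ι → Prop) (low : ∀ b c, Pr b → r c b → Pr c) (B : ι → ι →₀ 𝕂)
    (hB : ∀ b, Pr b → B b ∈ M) (hu : ∀ b, Pr b → Uni r b (B b)) (hs : ∀ b c, Pr b → Finsupp.single c (1 : 𝕂) ∈ M → B b c • Finsupp.single c (1 : 𝕂) ∈ M) (b : ι) :
    Pr b → Finsupp.single b (1 : 𝕂) ∈ M := by
  classical
  induction b using wf.induction with
  | _ b ih =>
    intro hb
    have hbs : b ∈ (B b).support := by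
      rw [Finsupp.mem_support_iff, (hu b hb).1]; exact one_ne_zero
    have e := vsum (B b)
    rw [← Finset.add_sum_erase _ _ hbs, (hu b hb).1, one_smul] at e
    rw [← sub_eq_iff_eq_add] at e
    rw [← e]
    refine sub_mem (hB b hb) (sum_mem ?_)
    intro c hc
    rw [Finset.mem_erase, Finsupp.mem_support_iff] at hc
    have hr := (hu b hb).2 c hc.1 hc.2
    exact hs b c hb (ih c hr (low b c hb hr))

def IsC (r : ι → ι → Prop) (β : (ι →₀ 𝕂) → (ι →₀ 𝕂)) (a : ι) (x : ι →₀ 𝕂) : Prop :=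
  β x = x ∧ Uni r a x ∧ ∀ b, b ≠ a → QQ (x b)

lemma IsC.zz {a : ι} {x : ι →₀ 𝕂} (h : IsC r β a x) (b : ι) : ZZ (x b) := by
  by_cases hb : b = a
  · subst hb; rw [h.2.1.1]; exact ZZ.one
  · exact (h.2.2 b hb).zz

lemma can_exists (h : BarOp r β) (wf : WellFounded r) (tr : ∀ a b c, r a b → r b c → r a c) (ir : ∀ a, ¬ r a a) (a : ι) : ∃ x, IsC r β a x := by
  classical
  induction a using wf.induction with
  | _ a ih =>
    choose! B hB using ih
    have key : ∀ b, r b a → Finsupp.single b (1 : 𝕂) ∈ (Submodule.span A (B '' {b | r b a})).toAddSubgroup := by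
      refine fun b => single_mem wf _ (fun b => r b a) (fun b c hb hc => tr _ _ _ hc hb) B ?_ (fun b hb => (hB b hb).2.1) ?_ b
      · intro b hb; exact Submodule.subset_span ⟨b, hb, rfl⟩
      · intro b c hb hc
        exact Submodule.smul_mem _ (⟨B b c, ((hB b hb).zz c).mem⟩ : A) hc
    have hx : β (Finsupp.single a 1) - Finsupp.single a 1 ∈ Submodule.span A (B '' {b | r b a}) := by
      have hxa := (h.uni a).1
      have has : a ∈ (β (Finsupp.single a 1)).support := by
        rw [Finsupp.mem_support_iff, hxa]; exact one_ne_zero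
      have e := vsum (β (Finsupp.single a 1))
      rw [← Finset.add_sum_erase _ _ has, hxa, one_smul, ← sub_eq_iff_eq_add'] at e
      rw [e]
      refine sum_mem ?_
      intro c hc
      rw [Finset.mem_erase, Finsupp.mem_support_iff] at hc
      exact Submodule.smul_mem _ (⟨_, h.mem a c⟩ : A) (key c ((h.uni a).2 c hc.1 hc.2))
    obtain ⟨l, hl, e⟩ := (Finsupp.mem_span_image_iff_linearCombination A).mp hx
    have hla : ∀ b ∈ l.support, r b a := fun b hb => (Finsupp.mem_supported _ _).mp hl hb
    rw [Finsupp.linearCombination_apply, Finsupp.sum] at e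
    have e1 : ∑ b ∈ l.support, (l b : 𝕂) • B b = β (Finsupp.single a 1) - Finsupp.single a 1 := e
    have e2 : ∑ b ∈ l.support, (sg (l b)) • B b = Finsupp.single a 1 - β (Finsupp.single a 1) := by
      have h1 := congrArg β (sub_eq_iff_eq_add.mp e1.symm)
      rw [h.inv, h.add, h.sum] at h1
      have h2 : ∑ b ∈ l.support, β ((l b : 𝕂) • B b) = ∑ b ∈ l.support, (sg (l b)) • B b := Finset.sum_congr rfl fun b hb => by rw [h.smul, (hB b (hla b hb)).1]
      rw [h2] at h1
      exact eq_sub_of_add_eq h1.symm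
    have e3 : ∀ b ∈ l.support, sg (l b) + l b = 0 := by
      refine uni_indep tr ir (fun b => sg (l b) + l b) B (fun b hb => (hB b (hla b hb)).2.1) ?_
      simp only [add_smul, Finset.sum_add_distrib]
      rw [e1, e2]; abel
    have e4 : ∀ b, ∃ f : 𝕂, b ∈ l.support → QQ f ∧ (l b : 𝕂) = f - sg f := by
      intro b
      by_cases hb : b ∈ l.support
      · obtain ⟨p, hp⟩ := anti_split (l b).2 (eq_neg_of_add_eq_zero_left (e3 b hb))
        exact ⟨_, fun _ => ⟨⟨p, rfl⟩, hp⟩⟩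
      · exact ⟨0, fun h => absurd h hb⟩
    choose f hf using e4
    refine ⟨Finsupp.single a 1 + ∑ b ∈ l.support, f b • B b, ?_, ⟨?_, ?_⟩, ?_⟩
    · rw [h.add, h.sum, ← sub_eq_zero]
      have : ∑ b ∈ l.support, β (f b • B b) = ∑ b ∈ l.support, f b • B b - ∑ b ∈ l.support, (l b : 𝕂) • B b := by
        rw [← Finset.sum_sub_distrib]
        refine Finset.sum_congr rfl fun b hb => ?_
        rw [h.smul, (hB b (hla b hb)).1, (hf b hb).2, ← sub_smul, sub_sub_cancel]
      rw [this, e1]; abel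
    · rw [Finsupp.add_apply, Finsupp.single_eq_same, Finsupp.finset_sum_apply, Finset.sum_eq_zero, add_zero]
      intro b hb
      have hba := hla b hb
      have : B b a = 0 := by
        by_contra h0
        have hne : a ≠ b := by rintro rfl; exact ir _ hba
        exact ir _ (tr _ _ _ hba ((hB b hba).2.1.2 a hne h0))
      rw [Finsupp.smul_apply, this, smul_zero]
    · intro c hc h0
      rw [Finsupp.add_apply, Finsupp.single_eq_of_ne hc, zero_add, Finsupp.finset_sum_apply] at h0
      obtain ⟨b, hb, h1⟩ := Finset.exists_ne_zero_of_sum_ne_zero h0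
      have hba := hla b hb
      rw [Finsupp.smul_apply, smul_eq_mul] at h1
      have h2 := right_ne_zero_of_mul h1
      by_cases hcb : c = b
      · rw [hcb]; exact hba
      · exact tr _ _ _ ((hB b hba).2.1.2 c hcb h2) hba
    · intro c hc
      rw [Finsupp.add_apply, Finsupp.single_eq_of_ne hc, zero_add, Finsupp.finset_sum_apply]
      refine Finset.sum_induction _ QQ (fun _ _ => QQ.add) QQ.zero ?_
      intro b hb
      rw [Finsupp.smul_apply, smul_eq_mul]
      exact (hf b hb).1.mul ((hB b (hla b hb)).zz c)
end
end CB
end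

noncomputable section
open scoped BigOperators
set_option linter.all false
namespace CB
section
open Polynomial

variable {V : Type*} [AddCommGroup V] [Module 𝕂 V] [Module ℤ[X] V]
variable {ι : Type*} {r : ι → ι → Prop} (f : ι → V)

lemma lat_of (hc : ∀ (p : ℤ[X]) (x : V), p • x = algebraMap ℤ[X] 𝕂 p • x) (x : ι →₀ 𝕂) (h : ∀ b, ZZ (x b)) :
    Finsupp.linearCombination 𝕂 f x ∈ Submodule.span ℤ[X] (Set.range f) := by
  rw [Finsupp.linearCombination_apply, Finsupp.sum]
  refine sum_mem fun b _ => ?_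
  obtain ⟨p, hp⟩ := h b
  rw [hp, ← hc]
  exact Submodule.smul_mem _ _ (Submodule.subset_span ⟨b, rfl⟩)

lemma qlat_of (hc : ∀ (p : ℤ[X]) (x : V), p • x = algebraMap ℤ[X] 𝕂 p • x) (x : ι →₀ 𝕂) (h : ∀ b, QQ (x b)) :
    Finsupp.linearCombination 𝕂 f x ∈ Submodule.span ℤ[X] ((fun x => qq • x) '' (Submodule.span ℤ[X] (Set.range f) : Set V)) := by
  rw [Finsupp.linearCombination_apply, Finsupp.sum]
  refine sum_mem fun b _ => ?_
  obtain ⟨p, hp⟩ := h b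
  rw [hp, map_mul, mul_smul, ← hc p, algMap_X]
  exact Submodule.subset_span ⟨_, Submodule.smul_mem _ _ (Submodule.subset_span ⟨b, rfl⟩), rfl⟩

lemma of_lat (hc : ∀ (p : ℤ[X]) (x : V), p • x = algebraMap ℤ[X] 𝕂 p • x) (z : V) (hz : z ∈ Submodule.span ℤ[X] (Set.range f)) :
    ∃ x : ι →₀ 𝕂, z = Finsupp.linearCombination 𝕂 f x ∧ ∀ b, ZZ (x b) := by
  classical
  induction hz using Submodule.span_induction with
  | mem x h =>
    obtain ⟨a, rfl⟩ := h
    refine ⟨Finsupp.single a 1, by simp, fun b => ?_⟩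
    rw [Finsupp.single_apply]; split_ifs
    · exact ZZ.one
    · exact ZZ.zero
  | zero => exact ⟨0, by simp, fun b => ZZ.zero⟩
  | add x y _ _ hx hy =>
    obtain ⟨x', rfl, hx⟩ := hx
    obtain ⟨y', rfl, hy⟩ := hy
    exact ⟨x' + y', by rw [map_add], fun b => (hx b).add (hy b)⟩
  | smul p x _ hx =>
    obtain ⟨x', rfl, hx⟩ := hx
    exact ⟨algebraMap ℤ[X] 𝕂 p • x', by rw [map_smul, hc], fun b => ZZ.mul ⟨p, rfl⟩ (hx b)⟩

lemma of_qlat (hc : ∀ (p : ℤ[X]) (x : V), p • x = algebraMap ℤ[X] 𝕂 p • x) (z : V)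
    (hz : z ∈ Submodule.span ℤ[X] ((fun x => qq • x) '' (Submodule.span ℤ[X] (Set.range f) : Set V))) :
    ∃ x : ι →₀ 𝕂, z = Finsupp.linearCombination 𝕂 f x ∧ ∀ b, QQ (x b) := by
  classical
  induction hz using Submodule.span_induction with
  | mem x h =>
    obtain ⟨a, ha, rfl⟩ := h
    obtain ⟨x, rfl, hx⟩ := of_lat f hc a ha
    refine ⟨qq • x, by rw [map_smul], fun b => ?_⟩
    exact QQ.mul ⟨1, by rw [mul_one, algMap_X]⟩ (hx b)
  | zero => exact ⟨0, by simp, fun b => QQ.zero⟩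
  | add x y _ _ hx hy =>
    obtain ⟨x', rfl, hx⟩ := hx
    obtain ⟨y', rfl, hy⟩ := hy
    exact ⟨x' + y', by rw [map_add], fun b => (hx b).add (hy b)⟩
  | smul p x _ hx =>
    obtain ⟨x', rfl, hx⟩ := hx
    refine ⟨algebraMap ℤ[X] 𝕂 p • x', by rw [map_smul, hc], fun b => ?_⟩
    rw [Finsupp.smul_apply, smul_eq_mul, mul_comm]
    exact (hx b).mul ⟨p, rfl⟩

theorem abs_can (hc : ∀ (p : ℤ[X]) (x : V), p • x = algebraMap ℤ[X] 𝕂 p • x)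
    (wf : WellFounded r) (tr : ∀ a b c, r a b → r b c → r a c) (ir : ∀ a, ¬ r a a)
    (li : LinearIndependent 𝕂 f) (bar : V → V) (badd : ∀ x y, bar (x + y) = bar x + bar y)
    (bsmul : ∀ (c : 𝕂) x, bar (c • x) = sg c • bar x) (binv : ∀ x, bar (bar x) = x)
    (bsp : ∀ x ∈ Submodule.span 𝕂 (Set.range f), bar x ∈ Submodule.span 𝕂 (Set.range f))
    (btri : ∀ a, ∃ c : ι →₀ 𝕂, bar (f a) = f a + Finsupp.linearCombination 𝕂 f c ∧ (∀ b, c b ≠ 0 → r b a) ∧ ∀ b, c b ∈ A) :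
    ∃ b : ι → V,
      ((∀ a, b a ∈ Submodule.span ℤ[X] (Set.range f)) ∧
      (∀ a, b a - f a ∈ Submodule.span ℤ[X] ((fun x => qq • x) '' (Submodule.span ℤ[X] (Set.range f) : Set V))) ∧
      (∀ a, bar (b a) = b a)) ∧
      (∀ b' : ι → V, ((∀ a, b' a ∈ Submodule.span ℤ[X] (Set.range f)) ∧
      (∀ a, b' a - f a ∈ Submodule.span ℤ[X] ((fun x => qq • x) '' (Submodule.span ℤ[X] (Set.range f) : Set V))) ∧
      (∀ a, bar (b' a) = b' a)) → b' = b) ∧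
      LinearIndependent 𝕂 b ∧
      Submodule.span 𝕂 (Set.range b) = Submodule.span 𝕂 (Set.range f) ∧
      (∀ a, ∃ c : ι →₀ 𝕂, b a = f a + c.sum (fun a' x => x • f a') ∧ ∀ a' ∈ c.support, r a' a) := by
  classical
  set φ := Finsupp.linearCombination 𝕂 f with hφ
  have inj : Function.Injective φ := li
  have rg : LinearMap.range φ = Submodule.span 𝕂 (Set.range f) := Finsupp.range_linearCombination 𝕂
  have ex : ∀ x : ι →₀ 𝕂, ∃ y, φ y = bar (φ x) := fun x => by
    have h1 : φ x ∈ LinearMap.range φ := ⟨x, rfl⟩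
    rw [rg] at h1
    have h2 := bsp _ h1
    rw [← rg] at h2
    exact h2
  choose β hβ using ex
  have φs : ∀ a, φ (Finsupp.single a 1) = f a := fun a => by simp [hφ]
  have bs : ∀ a, ∃ c : ι →₀ 𝕂, β (Finsupp.single a 1) = Finsupp.single a 1 + c ∧ (∀ b, c b ≠ 0 → r b a) ∧ ∀ b, c b ∈ A := by
    intro a
    obtain ⟨c, h1, h2, h3⟩ := btri a
    refine ⟨c, inj ?_, h2, h3⟩
    rw [hβ, map_add, φs, h1]
  have hop : BarOp r β := by
    constructor
    · intro x y; apply inj; rw [map_add, hβ, hβ, hβ, map_add, badd]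
    · intro x y; apply inj; rw [map_smul, hβ, hβ, map_smul, bsmul]
    · intro x; apply inj; rw [hβ, hβ, binv]
    · intro a
      obtain ⟨c, h1, h2, h3⟩ := bs a
      rw [h1]
      constructor
      · have : c a = 0 := by
          by_contra h0; exact ir _ (h2 a h0)
        rw [Finsupp.add_apply, Finsupp.single_eq_same, this, add_zero]
      · intro b hb h0
        rw [Finsupp.add_apply, Finsupp.single_eq_of_ne hb, zero_add] at h0
        exact h2 b h0
    · intro a b
      obtain ⟨c, h1, h2, h3⟩ := bs a
      rw [h1, Finsupp.add_apply]
      refine add_mem ?_ (h3 b)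
      rw [Finsupp.single_apply]
      split_ifs
      · exact one_mem _
      · exact zero_mem _
  choose B hB using can_exists hop wf tr ir
  have fB : ∀ a, φ (B a) - f a = φ (B a - Finsupp.single a 1) := fun a => by rw [map_sub, φs]
  have qB : ∀ a, φ (B a) - f a ∈ Submodule.span ℤ[X] ((fun x => qq • x) '' (Submodule.span ℤ[X] (Set.range f) : Set V)) := by
    intro a
    rw [fB]
    refine qlat_of f hc _ fun b => ?_
    rw [Finsupp.sub_apply]
    by_cases hb : b = a
    · subst hb
      rw [(hB b).2.1.1, Finsupp.single_eq_same, sub_self]; exact QQ.zero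
    · rw [Finsupp.single_eq_of_ne hb, sub_zero]; exact (hB a).2.2 b hb
  have bB : ∀ a, bar (φ (B a)) = φ (B a) := fun a => by rw [← hβ, (hB a).1]
  refine ⟨fun a => φ (B a), ⟨fun a => lat_of f hc _ (hB a).zz, qB, bB⟩, ?_, ?_, ?_, ?_⟩
  · rintro b' ⟨h1, h2, h3⟩
    funext a
    have h4 := sub_mem (h2 a) (qB a)
    rw [sub_sub_sub_cancel_right] at h4
    obtain ⟨x, hx, hq⟩ := of_qlat f hc _ h4
    have bx : bar (φ x) = φ x := by
      have e : b' a = φ x + φ (B a) := sub_eq_iff_eq_add.mp hx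
      have e2 := congrArg bar e
      rw [h3, badd, bB, e] at e2
      exact (add_right_cancel e2).symm
    have : x = 0 := can_unique hop tr ir x (inj (by rw [hβ, bx])) hq
    rw [this, map_zero] at hx
    exact sub_eq_zero.mp hx
  · rw [linearIndependent_iff']
    intro s g hg
    refine uni_indep tr ir g B (fun a _ => (hB a).2.1) (inj ?_)
    rw [map_sum, map_zero, ← hg]
    exact Finset.sum_congr rfl fun a _ => map_smul _ _ _
  · apply le_antisymm
    · rw [Submodule.span_le]
      rintro _ ⟨a, rfl⟩
      rw [← rg]
      exact ⟨_, rfl⟩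
    · rw [Submodule.span_le]
      rintro _ ⟨a, rfl⟩
      have h1 : Finsupp.single a (1 : 𝕂) ∈ (Submodule.span 𝕂 (Set.range B)).toAddSubgroup :=
        single_mem wf _ (fun _ => True) (fun _ _ _ _ => trivial) B (fun b _ => (Submodule.subset_span (Set.mem_range_self b) : B b ∈ Submodule.span 𝕂 (Set.range B)))
          (fun b _ => (hB b).2.1) (fun b c _ h => Submodule.smul_mem _ _ h) a trivial
      have h2 : φ (Finsupp.single a 1) ∈ (Submodule.span 𝕂 (Set.range B)).map φ := ⟨_, h1, rfl⟩
      rw [φs, Submodule.map_span, ← Set.range_comp] at h2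
      exact h2
  · intro a
    refine ⟨B a - Finsupp.single a 1, ?_, ?_⟩
    · have := fB a
      rw [sub_eq_iff_eq_add'] at this
      exact this
    · intro b hb
      rw [Finsupp.mem_support_iff, Finsupp.sub_apply] at hb
      by_cases hba : b = a
      · subst hba
        rw [(hB b).2.1.1, Finsupp.single_eq_same, sub_self] at hb
        exact absurd rfl hb
      · rw [Finsupp.single_eq_of_ne hba, sub_zero] at hb
        exact (hB a).2.1.2 b hba hb
end

section
variable {I : Type} [Fintype I] [DecidableEq I] {D : ADEData I}

lemma ltLeft_trans {N : ℕ} {a b c : Fin N → ℕ} : LtLeft a b → LtLeft b c → LtLeft a c := by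
  rintro ⟨k, h1, h2⟩ ⟨l, h3, h4⟩
  rcases lt_trichotomy k l with h | h | h
  · exact ⟨k, by rw [← h4 k h]; exact h1, fun m hm => (h2 m hm).trans (h4 m (hm.trans h))⟩
  · subst h; exact ⟨k, h3.trans h1, fun m hm => (h2 m hm).trans (h4 m hm)⟩
  · exact ⟨l, by rw [h2 l h]; exact h3, fun m hm => (h2 m (hm.trans h)).trans (h4 m hm)⟩

lemma ltRight_trans {N : ℕ} {a b c : Fin N → ℕ} : LtRight a b → LtRight b c → LtRight a c := by
  rintro ⟨k, h1, h2⟩ ⟨l, h3, h4⟩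
  rcases lt_trichotomy l k with h | h | h
  · exact ⟨k, by rw [← h4 k h]; exact h1, fun m hm => (h2 m hm).trans (h4 m (h.trans hm))⟩
  · subst h; exact ⟨l, h3.trans h1, fun m hm => (h2 m hm).trans (h4 m hm)⟩
  · exact ⟨l, by rw [h2 l h]; exact h3, fun m hm => (h2 m (h.trans hm)).trans (h4 m hm)⟩

lemma prec_trans (w : List I) (a b c : Fin w.length → ℕ) (h : Prec D w a b) (h' : Prec D w b c) : Prec D w a c :=
  ⟨h.1.trans h'.1, ltLeft_trans h.2.1 h'.2.1, ltRight_trans h.2.2 h'.2.2⟩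

lemma prec_irrefl (w : List I) (a : Fin w.length → ℕ) : ¬ Prec D w a a := by
  rintro ⟨_, ⟨k, h, _⟩, _⟩
  exact lt_irrefl _ h

lemma beta_sum {w : List I} (hw : IsReducedWord D w) (k : Fin w.length) : 1 ≤ ∑ j, beta D w k j := by
  refine pos_sum_ge (D := D) (wordAct_rt D _ _) (red_snoc_pos D ?_)
  have e : (w.take k ++ [w.get k]) ++ w.drop (k + 1) = w := by
    simp
  refine red_left D (y := w.drop (k + 1)) ?_
  rw [e]; exact hw

lemma entry_le {w : List I} (hw : IsReducedWord D w) (a : Fin w.length → ℕ) (k : Fin w.length) : (a k : ℤ) ≤ ∑ j, wtData D w a j := by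
  have e : ∑ j, wtData D w a j = ∑ k, (a k : ℤ) * ∑ j, beta D w k j := by
    simp only [wtData, Finset.sum_apply, Pi.smul_apply, smul_eq_mul, Finset.mul_sum]
    exact Finset.sum_comm
  rw [e]
  have h1 : (a k : ℤ) ≤ (a k : ℤ) * ∑ j, beta D w k j := le_mul_of_one_le_right (by positivity) (beta_sum hw k)
  refine h1.trans (Finset.single_le_sum (f := fun k => (a k : ℤ) * ∑ j, beta D w k j) ?_ (Finset.mem_univ k))
  intro i _
  exact mul_nonneg (by positivity) (le_trans zero_le_one (beta_sum hw i))

lemma prec_fin {w : List I} (hw : IsReducedWord D w) (a : Fin w.length → ℕ) : {b | Prec D w b a}.Finite := by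
  refine (Set.finite_Iic (fun _ : Fin w.length => (∑ j, wtData D w a j).toNat)).subset ?_
  intro b hb k
  have := entry_le hw b k
  rw [hb.1] at this
  show b k ≤ (∑ j, wtData D w a j).toNat
  omega

lemma prec_wf {w : List I} (hw : IsReducedWord D w) : WellFounded (Prec D w) := by
  refine Subrelation.wf (r := InvImage (· < ·) (fun a => {b | Prec D w b a}.ncard)) ?_ (InvImage.wf _ wellFounded_lt)
  intro a b hab
  refine Set.ncard_lt_ncard ⟨fun c hc => prec_trans w _ _ _ hc hab, fun h => prec_irrefl w a (h hab)⟩ (prec_fin hw b)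

theorem main_thm (T : I → (Uq D ≃ₐ[𝕂] Uq D)) (hT : IsLusztigAuts D T)
    (bar : Uq D →+* Uq D) (hbar : IsBar D bar)
    (w : List I) (hw : IsRedW0 D w) :
    ∃ b : (Fin w.length → ℕ) → Uq D,
      IsCanBasis T w bar b ∧
      (∀ b' : (Fin w.length → ℕ) → Uq D, IsCanBasis T w bar b' → b' = b) ∧
      LinearIndependent 𝕂 b ∧
      Submodule.span 𝕂 (Set.range b) = Subalgebra.toSubmodule (Uminus D) ∧
      (∀ a, ∃ c : (Fin w.length → ℕ) →₀ 𝕂,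
        b a = pbw T w a + c.sum (fun a' x => x • pbw T w a') ∧
        ∀ a' ∈ c.support, Prec D w a' a) := by
  have ef : (fun l : Fib w => P T l.1) ∘ (toF w) = pbw T w := by
    funext a; exact P_toL w a
  have li : LinearIndependent 𝕂 (pbw T w) := by
    rw [← ef]; exact (P_li hT w [] hw).comp _ (toF w).injective
  have sp : Submodule.span 𝕂 (Set.range (pbw T w)) = Subalgebra.toSubmodule (Uminus D) := by
    rw [← ef, (toF w).surjective.range_comp]; exact Ms_eq hT hw
  have bsp : ∀ x ∈ Submodule.span 𝕂 (Set.range (pbw T w)), bar x ∈ Submodule.span 𝕂 (Set.range (pbw T w)) := by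
    rw [sp]; exact fun x hx => bar_mem hbar hx
  have btri : ∀ a, ∃ c : (Fin w.length → ℕ) →₀ 𝕂, bar (pbw T w a) = pbw T w a + Finsupp.linearCombination 𝕂 (pbw T w) c ∧ (∀ b, c b ≠ 0 → Prec D w b a) ∧ ∀ b, c b ∈ A := by
    intro a
    obtain ⟨c, h1, h2, h3⟩ := tri hT hbar hw (toF w a)
    refine ⟨Finsupp.equivMapDomain (toF w).symm c, ?_, ?_, ?_⟩
    · rw [toF_val, P_toL] at h1
      rw [h1, Finsupp.linearCombination_equivMapDomain, ← ef]
      congr 2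
      rw [Function.comp_assoc, Equiv.self_comp_symm, Function.comp_id]
    · intro b hb
      rw [Finsupp.equivMapDomain_apply, Equiv.symm_symm] at hb
      obtain ⟨h4, h5, h6⟩ := h2 _ hb
      simp only [toF_val] at h4 h5 h6
      rw [wtL_toL, wtL_toL] at h4
      exact ⟨h4, ltL_toL w _ _ h5, ltR_toL w _ _ h6⟩
    · intro b
      rw [Finsupp.equivMapDomain_apply]; exact h3 _
  have := abs_can (pbw T w) (fun p x => rfl) (prec_wf hw.1) (prec_trans w) (prec_irrefl w) li bar (map_add bar) (bar_smul hbar) hbar.2.2.2.2 bsp btri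
  rw [sp] at this
  exact this
end
end CB
end

/-- Existence and uniqueness of the canonical basis: there is
a unique family `b` contained in `𝓛`, bar-invariant, whose residues mod `q𝓛`
are the residues of the PBW monomials; it is a basis of `U_q^-(𝔤)` and the
change of basis from `B_i` to `b` is unit-triangular for `≺`. -/
theorem canonical_basis_exists_unique
    {I : Type} [Fintype I] [DecidableEq I] (D : ADEData I)
    (T : I → (Uq D ≃ₐ[𝕂] Uq D)) (hT : IsLusztigAuts D T)
    (bar : Uq D →+* Uq D) (hbar : IsBar D bar)
    (w : List I) (hw : IsRedW0 D w) :
    ∃ b : (Fin w.length → ℕ) → Uq D,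
      IsCanBasis T w bar b ∧
      (∀ b' : (Fin w.length → ℕ) → Uq D, IsCanBasis T w bar b' → b' = b) ∧
      LinearIndependent 𝕂 b ∧
      Submodule.span 𝕂 (Set.range b) = Subalgebra.toSubmodule (Uminus D) ∧
      (∀ a, ∃ c : (Fin w.length → ℕ) →₀ 𝕂,
        b a = pbw T w a + c.sum (fun a' x => x • pbw T w a') ∧
        ∀ a' ∈ c.support, Prec D w a' a) := by
  exact CB.main_thm T hT bar hbar w hw
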